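/- Let γ : ℝ × (-∞,0] → ℝ² be an ancient complete non-compact embedded smooth curve shortening flow whose entropy equals a positive integer m, and let θ : ℝ × (-∞,0] → ℝ be a smooth angle function for γ with θ(0, t₀) ∈ [0, 2π) for some t₀ ≤ 0. Then |θ(u,t)| ≤ (2m + 1)π for all u ∈ ℝ and all t ≤ 0. -/

import Mathlib

open Real MeasureTheory Set Filter
open scoped RealInnerProductSpace ENNReal

noncomputable section

/-- The Euclidean plane. -/
abbrev R2 := EuclideanSpace ℝ (Fin 2)

/-- The point of `ℝ²` with coordinates `(x, y)`. -/
def toR2 (x y : ℝ) : R2 := (WithLp.equiv 2 (Fin 2 → ℝ)).symm ![x, y]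

/-- Counterclockwise rotation of the plane by `π/2`. -/
def Jrot (v : R2) : R2 := toR2 (-(v 1)) (v 0)

/-- Arclength derivative `∂ₛ := |∂ᵤγ|⁻¹ ∂ᵤ` along the time-`t` curve of the flow `γ`,
applied to a function `f` of `(u, t)`. -/
def aderiv (γ : ℝ → ℝ → R2) {F : Type} [NormedAddCommGroup F] [NormedSpace ℝ F]
    (f : ℝ → ℝ → F) (u t : ℝ) : F :=
  ‖deriv (fun v => γ v t) u‖⁻¹ • deriv (fun v => f v t) u

/-- The unit tangent `T = ∂ᵤγ / |∂ᵤγ|`. -/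
def unitT (γ : ℝ → ℝ → R2) (u t : ℝ) : R2 := aderiv γ γ u t

/-- The unit normal `n = J T`. -/
def unitN (γ : ℝ → ℝ → R2) (u t : ℝ) : R2 := Jrot (unitT γ u t)

/-- The signed curvature `κ = ⟨∂ₛT, n⟩`. -/
def curv (γ : ℝ → ℝ → R2) (u t : ℝ) : ℝ := ⟪aderiv γ (unitT γ) u t, unitN γ u t⟫

/-- `γ : ℝ × I → ℝ²` is a smooth curve shortening flow in fixed-parametrization form:
smooth, regular (`∂ᵤγ ≠ 0`), and `∂ₜγ = ∂ₛ(∂ₛγ)` (time derivative taken within `I`). -/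
structure IsCSF (γ : ℝ → ℝ → R2) (I : Set ℝ) : Prop where
  smooth : ContDiffOn ℝ (⊤ : ℕ∞) (fun p : ℝ × ℝ => γ p.1 p.2) (univ ×ˢ I)
  regular : ∀ (u : ℝ), ∀ t ∈ I, deriv (fun v => γ v t) u ≠ 0
  flow : ∀ (u : ℝ), ∀ t ∈ I, derivWithin (fun s => γ u s) I t = aderiv γ (aderiv γ γ) u t

/-- The Gaussian weighted length `F_{x₀,l}` of the time-`t` curve (as an extended real). -/
def gaussLenE (γ : ℝ → ℝ → R2) (x₀ : R2) (l t : ℝ) : ℝ≥0∞ :=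
  (ENNReal.ofReal (Real.sqrt (4 * π * l)))⁻¹ *
    ∫⁻ u : ℝ, ENNReal.ofReal
      (Real.exp (-‖γ u t - x₀‖ ^ 2 / (4 * l)) * ‖deriv (fun v => γ v t) u‖)

/-- The total curvature of the time-`t` curve (as an extended real). -/
def totalCurvE (γ : ℝ → ℝ → R2) (t : ℝ) : ℝ≥0∞ :=
  ∫⁻ u : ℝ, ENNReal.ofReal (|curv γ u t| * ‖deriv (fun v => γ v t) u‖)

/-- The entropy of the flow: the supremum of the Gaussian weighted lengths over all
times `t ∈ I`, centers `x₀ ∈ ℝ²` and scales `l > 0`. -/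
def entropyE (γ : ℝ → ℝ → R2) (I : Set ℝ) : ℝ≥0∞ :=
  ⨆ t ∈ I, ⨆ x₀ : R2, ⨆ l ∈ Ioi (0:ℝ), gaussLenE γ x₀ l t


open scoped Topology

section Part1

/-- A continuous real function vanishing at `u` with positive cosine on `[u,v]` stays below `π/2`. -/
lemma abs_lt_pi_div_two_of_cos_pos {u v : ℝ} (huv : u ≤ v) (h : ℝ → ℝ) (hc : ContinuousOn h (Icc u v))
    (h0 : h u = 0) (hpos : ∀ w ∈ Icc u v, 0 < Real.cos (h w)) : |h v| < π / 2 := by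
  by_contra hcon
  push Not at hcon
  have hcabs : ContinuousOn (fun w => |h w|) (Icc u v) := hc.abs
  have := intermediate_value_Icc huv hcabs
  have hm : π / 2 ∈ Icc (|h u|) (|h v|) := ⟨by rw [h0, abs_zero]; positivity, hcon⟩
  obtain ⟨w, hw, hw2⟩ := this hm
  have h3 := hpos w hw
  rw [← Real.cos_abs] at h3
  simp only at hw2
  rw [hw2, Real.cos_pi_div_two] at h3
  exact lt_irrefl _ h3

lemma chord_half (c : ℝ → ℂ) (hcc : Continuous c) {u v : ℝ} (huv : u < v) (S : Set ℝ)
    (hS : IsPreconnected S) (K : ℝ → ℝ → ℝ) (hK : Continuous (fun p : ℝ × ℝ => K p.1 p.2))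
    (ε : ℂ) (hε : ε ≠ 0)
    (hex : ∀ s ∈ S, ∀ w ∈ Icc u v, ∃ a : ℝ, 0 < a ∧ ε * (c w - c s) = a * Complex.exp (K s w * Complex.I))
    (hseg : ∀ s ∈ S, ∀ r ∈ Icc (0:ℝ) 1, c s ≠ c u + r * (c v - c u))
    (hfar : ∀ M : ℝ, ∃ s ∈ S, M < ‖c s‖) :
    ∀ s ∈ S, |K s v - K s u| ≤ π := by
  set ρ : ℝ → ℂ := fun s => (c v - c s) / (c u - c s) with hρ
  have hne : ∀ s ∈ S, c u - c s ≠ 0 := by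
    intro s hs h
    exact hseg s hs 0 ⟨le_rfl, zero_le_one⟩ (by simp; exact (sub_eq_zero.mp h).symm)
  have hratio : ∀ s ∈ S, ∀ w ∈ Icc u v, ∃ a : ℝ, 0 < a ∧
      (c w - c s) / (c u - c s) = a * Complex.exp ((K s w - K s u : ℝ) * Complex.I) := by
    intro s hs w hw
    obtain ⟨a, ha, h1⟩ := hex s hs w hw
    obtain ⟨b, hb, h2⟩ := hex s hs u ⟨le_rfl, huv.le⟩
    refine ⟨a / b, by positivity, ?_⟩
    have : (c w - c s) / (c u - c s) = (ε * (c w - c s)) / (ε * (c u - c s)) := by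
      rw [mul_div_mul_left _ _ hε]
    rw [this, h1, h2]
    push_cast
    rw [sub_mul, Complex.exp_sub]
    have hb' : (b : ℂ) ≠ 0 := by exact_mod_cast hb.ne'
    have := Complex.exp_ne_zero (K s u * Complex.I)
    field_simp
  have hslit : ∀ s ∈ S, ρ s ∈ Complex.slitPlane := by
    intro s hs
    rw [Complex.mem_slitPlane_iff]
    by_contra hcon
    push Not at hcon
    obtain ⟨hre, him⟩ := hcon
    set x := (ρ s).re with hx
    have hρx : ρ s = (x : ℂ) := by
      apply Complex.ext <;> simp [hx, him]
    have h1 : c v - c s = x * (c u - c s) := by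
      rw [← hρx, hρ]; field_simp [hne s hs]
    -- c s = (c v - x c u)/(1 - x)
    have h1x : (1 - x) ≠ 0 := by linarith
    have h1x' : (1 - (x:ℂ)) ≠ 0 := by exact_mod_cast h1x
    refine hseg s hs (1 / (1 - x)) ⟨by apply div_nonneg <;> linarith, by
      rw [div_le_one] <;> linarith⟩ ?_
    push_cast
    field_simp
    linear_combination -h1
  set D : ℝ → ℝ := fun s => (K s v - K s u) - Complex.arg (ρ s) with hD
  have hDint : ∀ s ∈ S, ∃ n : ℤ, D s = n * (2 * π) := by
    intro s hs
    obtain ⟨a, ha, h1⟩ := hratio s hs v ⟨huv.le, le_rfl⟩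
    have h2 : Complex.arg (ρ s) = toIocMod Real.two_pi_pos (-π) (K s v - K s u) := by
      rw [hρ]; simp only
      rw [h1, Complex.arg_real_mul _ ha, Complex.arg_exp_mul_I]
    refine ⟨toIocDiv Real.two_pi_pos (-π) (K s v - K s u), ?_⟩
    rw [hD]; simp only
    rw [h2, self_sub_toIocMod]; simp
  have hDc : ContinuousOn D S := by
    have h1 : Continuous (fun s => K s v) := hK.comp (by fun_prop : Continuous fun s : ℝ => (s, v))
    have h2 : Continuous (fun s => K s u) := hK.comp (by fun_prop : Continuous fun s : ℝ => (s, u))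
    refine (h1.sub h2).continuousOn.sub ?_
    intro s hs
    have hρc : ContinuousWithinAt ρ S s := by
      refine ContinuousWithinAt.div ?_ ?_ (hne s hs)
      · exact (continuous_const.sub hcc).continuousWithinAt
      · exact (continuous_const.sub hcc).continuousWithinAt
    exact (Complex.continuousAt_arg (hslit s hs)).comp_continuousWithinAt hρc
  have hDconst : ∀ s ∈ S, ∀ s' ∈ S, D s = D s' := by
    intro s hs s' hs'
    have hN : ContinuousOn (fun x => D x / (2 * π)) S := hDc.div_const _
    have hpi : (2 * π) ≠ 0 := by positivity
    have key := hS.image _ hN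
    have hsub : ∀ y ∈ Set.image (fun x => D x / (2 * π)) S, ∃ n : ℤ, y = n := by
      rintro y ⟨x, hx, rfl⟩
      obtain ⟨n, hn⟩ := hDint x hx
      exact ⟨n, by simp only; rw [hn]; field_simp⟩
    by_contra hne'
    obtain ⟨n, hn⟩ := hDint s hs
    obtain ⟨n', hn'⟩ := hDint s' hs'
    have hoc := key.ordConnected
    wlog hlt : n < n' generalizing s s' n n'
    · rcases lt_trichotomy n n' with h | h | h
      · exact hlt h
      · apply hne'; rw [hn, hn', h]
      · exact this s' hs' s hs (fun h => hne' h.symm) n' hn' n hn h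
    have m1 : (n : ℝ) ∈ Set.image (fun x => D x / (2 * π)) S := ⟨s, hs, by simp only; rw [hn]; field_simp⟩
    have m2 : (n' : ℝ) ∈ Set.image (fun x => D x / (2 * π)) S := ⟨s', hs', by simp only; rw [hn']; field_simp⟩
    have hnn : (n : ℝ) + 1 ≤ n' := by exact_mod_cast hlt
    have m3 := hoc.out m1 m2 (⟨by linarith, by linarith⟩ : (n : ℝ) + 1 / 2 ∈ Icc (n:ℝ) n')
    obtain ⟨k, hk⟩ := hsub _ m3
    have : (2 * n + 1 : ℝ) = 2 * k := by linarith
    have : (2 * n + 1 : ℤ) = 2 * k := by exact_mod_cast this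
    omega
  -- far point
  obtain ⟨M, hM⟩ := (isCompact_Icc (a := u) (b := v)).exists_bound_of_continuousOn hcc.continuousOn
  obtain ⟨s0, hs0, hs0M⟩ := hfar (3 * M)
  have hMu := hM u ⟨le_rfl, huv.le⟩
  have hM0 : 0 ≤ M := (norm_nonneg _).trans hMu
  have hrepos : ∀ w ∈ Icc u v, 0 < ((c w - c s0) / (c u - c s0)).re := by
    intro w hw
    have e1 : (c w - c s0) / (c u - c s0) = 1 + (c w - c u) / (c u - c s0) := by
      have := hne s0 hs0; field_simp; ring
    have e2 : ‖(c w - c u) / (c u - c s0)‖ < 1 := by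
      rw [norm_div, div_lt_one (norm_pos_iff.mpr (hne s0 hs0))]
      have a1 : ‖c w - c u‖ ≤ 2 * M := (norm_sub_le _ _).trans (by linarith [hM w hw])
      have a2 : ‖c s0‖ - ‖c u‖ ≤ ‖c u - c s0‖ := by
        rw [norm_sub_rev]; exact norm_sub_norm_le _ _
      linarith
    rw [e1, Complex.add_re, Complex.one_re]
    have := Complex.abs_re_le_norm ((c w - c u) / (c u - c s0))
    have := neg_abs_le ((c w - c u) / (c u - c s0)).re
    linarith
  have hcos : ∀ w ∈ Icc u v, 0 < Real.cos (K s0 w - K s0 u) := by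
    intro w hw
    obtain ⟨a, ha, h1⟩ := hratio s0 hs0 w hw
    have h2 := hrepos w hw
    rw [h1, Complex.re_ofReal_mul, Complex.exp_ofReal_mul_I_re] at h2
    exact (pos_iff_pos_of_mul_pos h2).mp ha
  have hsmall : |K s0 v - K s0 u| < π / 2 := by
    refine abs_lt_pi_div_two_of_cos_pos huv.le (fun w => K s0 w - K s0 u) ?_ (by simp) hcos
    have h1 : Continuous (fun w => K s0 w) := hK.comp (by fun_prop : Continuous fun w : ℝ => (s0, w))
    exact (h1.sub continuous_const).continuousOn
  have harg : |Complex.arg (ρ s0)| < π / 2 :=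
    Complex.abs_arg_lt_pi_div_two_iff.mpr (Or.inl (hrepos v ⟨huv.le, le_rfl⟩))
  have hD0 : D s0 = 0 := by
    obtain ⟨n, hn⟩ := hDint s0 hs0
    have hlt : |D s0| < π := by
      rw [hD]; simp only
      exact (abs_sub _ _).trans_lt (by linarith)
    rw [hn, abs_mul, abs_of_pos Real.two_pi_pos] at hlt
    have h1 : |(n:ℝ)| < 1 := by
      by_contra hcon
      push Not at hcon
      nlinarith [Real.pi_pos]
    have h2 : |n| < 1 := by exact_mod_cast h1
    rw [Int.abs_lt_one_iff] at h2
    rw [hn, h2]; simp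
  intro s hs
  have h1 := hDconst s hs s0 hs0
  rw [hD0, hD] at h1
  simp only at h1
  rw [sub_eq_zero.mp h1]
  exact Complex.abs_arg_le_pi _

lemma chord_lemma (c c' : ℝ → ℂ) (θ : ℝ → ℝ) (hc : ∀ u, HasDerivAt c (c' u) u) (hc' : Continuous c')
    (hne : ∀ u, c' u ≠ 0) (hinj : Function.Injective c)
    (htop : Tendsto (fun u => ‖c u‖) (cocompact ℝ) atTop) (hθc : Continuous θ)
    (hθ : ∀ u, c' u = (‖c' u‖ : ℂ) * Complex.exp (θ u * Complex.I)) {u v : ℝ} (huv : u < v)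
    (hseg : ∀ s, ∀ r ∈ Ioo (0:ℝ) 1, c s ≠ c u + r * (c v - c u)) : |θ v - θ u| ≤ 2 * π := by
  set Q : ℝ × ℝ → ℂ := fun p => ∫ r in (0:ℝ)..1, c' (p.1 + r * (p.2 - p.1)) with hQ
  have hQc : Continuous Q := by
    apply intervalIntegral.continuous_parametric_intervalIntegral_of_continuous'
    fun_prop
  have hQe : ∀ s w, ((w - s : ℝ) : ℂ) * Q (s, w) = c w - c s := by
    intro s w
    have h1 : ∀ r ∈ uIcc (0:ℝ) 1, HasDerivAt (fun r => c (s + r * (w - s)))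
        (((w - s : ℝ) : ℂ) * c' (s + r * (w - s))) r := by
      intro r _
      have h2 : HasDerivAt (fun r : ℝ => s + r * (w - s)) (w - s) r := by
        simpa using ((hasDerivAt_id r).mul_const (w - s)).const_add s
      have := (hc (s + r * (w - s))).scomp r h2
      simpa [Function.comp_def] using this
    have h3 := intervalIntegral.integral_eq_sub_of_hasDerivAt h1
      (by apply Continuous.intervalIntegrable; fun_prop)
    rw [intervalIntegral.integral_const_mul] at h3
    simp only [hQ]
    rw [h3]; simp
  have hQd : ∀ s, Q (s, s) = c' s := by intro s; simp [hQ]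
  have hQne : ∀ p, Q p ≠ 0 := by
    rintro ⟨s, w⟩ h
    by_cases hsw : s = w
    · subst hsw; rw [hQd] at h; exact hne s h
    · have := hQe s w
      rw [h, mul_zero] at this
      exact hsw (hinj (sub_eq_zero.mp this.symm)).symm
  obtain ⟨F, ⟨-, hF⟩, -⟩ := Complex.isCoveringMapOn_exp.existsUnique_continuousMap_lifts
    (⟨Q, hQc⟩ : C(ℝ × ℝ, ℂ)) (a₀ := (u, u)) (Complex.exp_log (hQne (u, u))) (fun a => hQne a)
  have hF' : ∀ p, Complex.exp (F p) = Q p := fun p => congr_fun hF p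
  set A : ℝ → ℝ → ℝ := fun s w => (F (s, w)).im with hA
  have hAc : Continuous (fun p : ℝ × ℝ => A p.1 p.2) := Complex.continuous_im.comp F.continuous
  have hQA : ∀ s w, Q (s, w) = (Real.exp (F (s, w)).re : ℂ) * Complex.exp (A s w * Complex.I) := by
    intro s w
    rw [← hF', Complex.ofReal_exp, ← Complex.exp_add]
    congr 1
    exact (Complex.re_add_im _).symm
  -- comparison with θ on the diagonal
  have hdiag : A v v - A u u = θ v - θ u := by
    have hintg : ∀ s, ∃ n : ℤ, A s s - θ s = n * (2 * π) := by
      intro s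
      have h1 := hQA s s
      rw [hQd, hθ s] at h1
      have h2 := congr_arg Complex.arg h1
      rw [Complex.arg_real_mul _ (norm_pos_iff.mpr (hne s)),
        Complex.arg_real_mul _ (Real.exp_pos _), Complex.arg_exp_mul_I,
        Complex.arg_exp_mul_I] at h2
      have e1 := self_sub_toIocMod Real.two_pi_pos (-π) (A s s)
      have e2 := self_sub_toIocMod Real.two_pi_pos (-π) (θ s)
      refine ⟨toIocDiv Real.two_pi_pos (-π) (A s s) - toIocDiv Real.two_pi_pos (-π) (θ s), ?_⟩
      push_cast
      simp only [zsmul_eq_mul] at e1 e2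
      linarith
    have hcont : Continuous (fun s => A s s - θ s) :=
      (hAc.comp (by fun_prop : Continuous fun s : ℝ => (s, s))).sub hθc
    by_contra hcon
    obtain ⟨n, hn⟩ := hintg u
    obtain ⟨n', hn'⟩ := hintg v
    have hnn' : n ≠ n' := by
      rintro rfl; apply hcon; linarith
    have hoc : (range (fun s => A s s - θ s)).OrdConnected :=
      (isPreconnected_range hcont).ordConnected
    have m1 : (n : ℝ) * (2 * π) ∈ range (fun s => A s s - θ s) := ⟨u, hn⟩
    have m2 : (n' : ℝ) * (2 * π) ∈ range (fun s => A s s - θ s) := ⟨v, hn'⟩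
    clear hn hn' hcon
    wlog hlt : n < n' generalizing n n'
    · exact this n' n hnn'.symm m2 m1 (lt_of_le_of_ne (not_lt.mp hlt) hnn'.symm)
    have hnn : (n : ℝ) + 1 ≤ n' := by exact_mod_cast hlt
    have m3 := hoc.out m1 m2 (⟨by nlinarith [Real.pi_pos], by nlinarith [Real.pi_pos]⟩ :
      ((n : ℝ) + 1 / 2) * (2 * π) ∈ Icc ((n:ℝ) * (2 * π)) (n' * (2 * π)))
    obtain ⟨s, hs⟩ := m3
    obtain ⟨k, hk⟩ := hintg s
    simp only at hs
    rw [hs] at hk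
    have : ((n : ℝ) + 1 / 2) = k := mul_right_cancel₀ (by positivity) hk
    have : (2 * n + 1 : ℝ) = 2 * k := by linarith
    have : (2 * n + 1 : ℤ) = 2 * k := by exact_mod_cast this
    omega
  have hcc : Continuous c := continuous_iff_continuousAt.mpr fun s => (hc s).continuousAt
  have hseg' : ∀ s, s ≠ u → s ≠ v → ∀ r ∈ Icc (0:ℝ) 1, c s ≠ c u + r * (c v - c u) := by
    intro s hsu hsv r hr h
    rcases eq_or_lt_of_le hr.1 with h0 | h0
    · subst h0; apply hsu; apply hinj; simpa using h
    rcases eq_or_lt_of_le hr.2 with h1 | h1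
    · subst h1; apply hsv; apply hinj; simpa using h
    exact hseg s r ⟨h0, h1⟩ h
  rw [cocompact_eq_atBot_atTop, tendsto_sup] at htop
  have H1 : ∀ s ∈ Iio u, |A s v - A s u| ≤ π := by
    refine chord_half c hcc huv (Iio u) isPreconnected_Iio A hAc 1 one_ne_zero ?_ ?_ ?_
    · intro s hs w hw
      have hs' : s < w := lt_of_lt_of_le hs hw.1
      refine ⟨(w - s) * Real.exp (F (s, w)).re, mul_pos (by linarith) (Real.exp_pos _), ?_⟩
      rw [one_mul, ← hQe s w, hQA s w]; push_cast; ring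
    · intro s hs
      exact hseg' s (ne_of_lt hs) (ne_of_lt (lt_trans hs huv))
    · intro M
      obtain ⟨s, h1, h2⟩ := ((htop.1.eventually_gt_atTop M).and (eventually_lt_atBot u)).exists
      exact ⟨s, h2, h1⟩
  have H2 : ∀ s ∈ Ioi v, |A v s - A u s| ≤ π := by
    refine chord_half c hcc huv (Ioi v) isPreconnected_Ioi (fun s w => A w s) (hAc.comp continuous_swap)
      (-1) (by norm_num) ?_ ?_ ?_
    · intro s hs w hw
      have hs' : w < s := lt_of_le_of_lt hw.2 hs
      refine ⟨(s - w) * Real.exp (F (w, s)).re, mul_pos (by linarith) (Real.exp_pos _), ?_⟩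
      have := hQe w s
      rw [hQA w s] at this
      push_cast at this ⊢
      linear_combination -this
    · intro s hs
      exact hseg' s (ne_of_gt (lt_trans huv hs)) (ne_of_gt hs)
    · intro M
      obtain ⟨s, h1, h2⟩ := ((htop.2.eventually_gt_atTop M).and (eventually_gt_atTop v)).exists
      exact ⟨s, h2, h1⟩
  have H1' : |A u v - A u u| ≤ π := by
    have hcl : IsClosed {s | |A s v - A s u| ≤ π} := by
      refine isClosed_le (Continuous.abs (Continuous.sub ?_ ?_)) continuous_const
      · exact hAc.comp (by fun_prop : Continuous fun s : ℝ => (s, v))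
      · exact hAc.comp (by fun_prop : Continuous fun s : ℝ => (s, u))
    have : closure (Iio u) ⊆ {s | |A s v - A s u| ≤ π} := hcl.closure_subset_iff.mpr H1
    rw [closure_Iio] at this
    exact this self_mem_Iic
  have H2' : |A v v - A u v| ≤ π := by
    have hcl : IsClosed {s | |A v s - A u s| ≤ π} := by
      refine isClosed_le (Continuous.abs (Continuous.sub ?_ ?_)) continuous_const
      · exact hAc.comp (by fun_prop : Continuous fun s : ℝ => (v, s))
      · exact hAc.comp (by fun_prop : Continuous fun s : ℝ => (u, s))
    have : closure (Ioi v) ⊆ {s | |A v s - A u s| ≤ π} := hcl.closure_subset_iff.mpr H2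
    rw [closure_Ioi] at this
    exact this self_mem_Ici
  rw [← hdiag]
  calc |A v v - A u u| = |(A v v - A u v) + (A u v - A u u)| := by ring_nf
    _ ≤ _ := abs_add_le _ _
    _ ≤ 2 * π := by linarith
end Part1

section Part2

/-- A static proper embedded regular planar curve with angle and curvature. -/
structure SC (X Y θ v κ : ℝ → ℝ) : Prop where
  hX : ∀ u, HasDerivAt X (v u * Real.cos (θ u)) u
  hY : ∀ u, HasDerivAt Y (v u * Real.sin (θ u)) u
  hθ : ∀ u, HasDerivAt θ (v u * κ u) u
  hv : ∀ u, 0 < v u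
  cv : Continuous v
  cκ : Continuous κ
  inj : ∀ u u', X u = X u' → Y u = Y u' → u = u'
  prop : Tendsto (fun u => X u ^ 2 + Y u ^ 2) (cocompact ℝ) atTop

/-- Gaussian bounds on a static curve. -/
structure SB (X Y θ v κ : ℝ → ℝ) (m : ℕ) (ε : ℝ) : Prop where
  E1 : ∫⁻ u, ENNReal.ofReal (Real.exp (-(X u ^ 2 + Y u ^ 2) / 4) * v u) ≤
    ENNReal.ofReal (Real.sqrt (4 * π) * m)
  E2 : ∫⁻ u, ENNReal.ofReal (Real.exp (-(X u ^ 2 + Y u ^ 2) / 8) * v u) ≤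
    ENNReal.ofReal (Real.sqrt (8 * π) * m)
  E3 : ∫⁻ u, ENNReal.ofReal ((κ u + (-X u * Real.sin (θ u) + Y u * Real.cos (θ u)) / 2) ^ 2 *
    Real.exp (-(X u ^ 2 + Y u ^ 2) / 4) * v u) ≤ ENNReal.ofReal ε

lemma integrable_of_lintegral_le {f : ℝ → ℝ} (hf : Continuous f) (h0 : ∀ u, 0 ≤ f u) {C : ℝ}
    (hC : 0 ≤ C) (h : ∫⁻ u, ENNReal.ofReal (f u) ≤ ENNReal.ofReal C) :
    Integrable f ∧ ∫ u, f u ≤ C := by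
  have hi : Integrable f := by
    refine ⟨hf.aestronglyMeasurable, ?_⟩
    rw [hasFiniteIntegral_iff_ofReal (Eventually.of_forall h0)]
    exact h.trans_lt ENNReal.ofReal_lt_top
  refine ⟨hi, ?_⟩
  rw [← ofReal_integral_eq_lintegral_ofReal hi (Eventually.of_forall h0)] at h
  exact (ENNReal.ofReal_le_ofReal_iff hC).mp h

lemma abs_mul_le_half {a b A : ℝ} (hA : 0 < A) : |a * b| ≤ (A * a ^ 2 + b ^ 2 / A) / 2 := by
  have h1 : 0 ≤ (A * |a| - |b|) ^ 2 / A := by positivity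
  have h2 : (A * |a| - |b|) ^ 2 / A = A * a ^ 2 + b ^ 2 / A - 2 * |a * b| := by
    rw [abs_mul, ← sq_abs a, ← sq_abs b]; field_simp; ring
  linarith

lemma sq_mul_exp_le (x : ℝ) : x * Real.exp (-x / 4) ≤ 8 * Real.exp (-x / 8) := by
  have h1 : x / 8 + 1 ≤ Real.exp (x / 8) := Real.add_one_le_exp _
  have h2 : Real.exp (-x / 8) = Real.exp (x / 8) * Real.exp (-x / 4) := by
    rw [← Real.exp_add]; ring_nf
  rw [h2, ← mul_assoc]
  exact mul_le_mul_of_nonneg_right (by linarith) (Real.exp_pos _).le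

section
variable {X Y θ v κ : ℝ → ℝ}

lemma SC.cX (h : SC X Y θ v κ) : Continuous X :=
  continuous_iff_continuousAt.mpr fun u => (h.hX u).continuousAt
lemma SC.cY (h : SC X Y θ v κ) : Continuous Y :=
  continuous_iff_continuousAt.mpr fun u => (h.hY u).continuousAt
lemma SC.cθ (h : SC X Y θ v κ) : Continuous θ :=
  continuous_iff_continuousAt.mpr fun u => (h.hθ u).continuousAt

lemma SC.hg (h : SC X Y θ v κ) (u : ℝ) :
    HasDerivAt (fun u => (-X u * Real.sin (θ u) + Y u * Real.cos (θ u)) *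
      Real.exp (-(X u ^ 2 + Y u ^ 2) / 4))
      (-((κ u + (-X u * Real.sin (θ u) + Y u * Real.cos (θ u)) / 2) *
        (X u * Real.cos (θ u) + Y u * Real.sin (θ u))) *
      Real.exp (-(X u ^ 2 + Y u ^ 2) / 4) * v u) u := by
  have hx := h.hX u
  have hy := h.hY u
  have ht := h.hθ u
  have h1 := ((hx.neg.mul ht.sin).add (hy.mul ht.cos)).mul
    ((((hx.pow 2).add (hy.pow 2)).neg.div_const 4).exp)
  refine h1.congr_deriv ?_
  simp
  ring

lemma SC.w_le (h : SC X Y θ v κ) {m : ℕ} {ε : ℝ} (hε : 0 ≤ ε) (hB : SB X Y θ v κ m ε)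
    {A : ℝ} (hA : 0 < A) (u : ℝ) :
    |(-X u * Real.sin (θ u) + Y u * Real.cos (θ u)) * Real.exp (-(X u ^ 2 + Y u ^ 2) / 4)| ≤
      (A * ε + 8 * (Real.sqrt (8 * π) * m) / A) / 2 := by
  have cX := h.cX
  have cY := h.cY
  have cθ := h.cθ
  have cv := h.cv
  have cκ := h.cκ
  obtain ⟨i2, I2⟩ := integrable_of_lintegral_le (by fun_prop)
    (fun u => mul_nonneg (Real.exp_pos _).le (h.hv u).le) (by positivity) hB.E2
  obtain ⟨i3, I3⟩ := integrable_of_lintegral_le (by fun_prop)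
    (fun u => mul_nonneg (by positivity) (h.hv u).le) hε hB.E3
  set g' : ℝ → ℝ := fun u => (-((κ u + (-X u * Real.sin (θ u) + Y u * Real.cos (θ u)) / 2) *
        (X u * Real.cos (θ u) + Y u * Real.sin (θ u))) *
      Real.exp (-(X u ^ 2 + Y u ^ 2) / 4) * v u) with hg'
  set G : ℝ → ℝ := fun u => (A * ((κ u + (-X u * Real.sin (θ u) + Y u * Real.cos (θ u)) / 2) ^ 2 *
    Real.exp (-(X u ^ 2 + Y u ^ 2) / 4) * v u) +
      8 / A * (Real.exp (-(X u ^ 2 + Y u ^ 2) / 8) * v u)) / 2 with hG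
  have hGi : Integrable G := ((i3.const_mul A).add (i2.const_mul (8 / A))).div_const 2
  have hle : ∀ u, ‖g' u‖ ≤ G u := by
    intro u
    have e0 := Real.exp_pos (-(X u ^ 2 + Y u ^ 2) / 4)
    have hv := h.hv u
    rw [hg', hG]
    simp only [Real.norm_eq_abs]
    rw [abs_mul, abs_mul, abs_neg, abs_of_pos e0, abs_of_pos hv]
    have h1 := abs_mul_le_half (a := (κ u + (-X u * Real.sin (θ u) + Y u * Real.cos (θ u)) / 2))
      (b := (X u * Real.cos (θ u) + Y u * Real.sin (θ u))) hA
    have h2 : (X u * Real.cos (θ u) + Y u * Real.sin (θ u)) ^ 2 ≤ X u ^ 2 + Y u ^ 2 := by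
      nlinarith [sq_nonneg (X u * Real.sin (θ u) - Y u * Real.cos (θ u)), Real.sin_sq_add_cos_sq (θ u),
        mul_nonneg (sq_nonneg (X u)) (sq_nonneg (Real.sin (θ u)))]
    have h3 := sq_mul_exp_le (X u ^ 2 + Y u ^ 2)
    have h4 : (X u * Real.cos (θ u) + Y u * Real.sin (θ u)) ^ 2 * Real.exp (-(X u ^ 2 + Y u ^ 2) / 4)
        ≤ 8 * Real.exp (-(X u ^ 2 + Y u ^ 2) / 8) :=
      (mul_le_mul_of_nonneg_right h2 e0.le).trans h3
    set a := (κ u + (-X u * Real.sin (θ u) + Y u * Real.cos (θ u)) / 2)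
    set b := (X u * Real.cos (θ u) + Y u * Real.sin (θ u))
    set e := Real.exp (-(X u ^ 2 + Y u ^ 2) / 4)
    set e8 := Real.exp (-(X u ^ 2 + Y u ^ 2) / 8)
    calc |a * b| * e * v u ≤ (A * a ^ 2 + b ^ 2 / A) / 2 * e * v u := by gcongr
      _ = (A * (a ^ 2 * e) + (b ^ 2 * e) / A) / 2 * v u := by ring
      _ ≤ (A * (a ^ 2 * e) + (8 * e8) / A) / 2 * v u := by gcongr
      _ = _ := by ring
  have hg'c : Continuous g' := by rw [hg']; fun_prop
  have hg'i : Integrable g' := hGi.mono' hg'c.aestronglyMeasurable (Eventually.of_forall hle)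
  have hlim : Tendsto (fun u => (-X u * Real.sin (θ u) + Y u * Real.cos (θ u)) *
      Real.exp (-(X u ^ 2 + Y u ^ 2) / 4)) atTop (𝓝 0) := by
    have hp := h.prop
    rw [cocompact_eq_atBot_atTop, tendsto_sup] at hp
    have hp := hp.2
    have h1 : Tendsto (fun u => (X u ^ 2 + Y u ^ 2 + 1) * Real.exp (-(X u ^ 2 + Y u ^ 2) / 4)) atTop (𝓝 0) := by
      have h2 : Tendsto (fun x : ℝ => (x + 1) * Real.exp (-x / 4)) atTop (𝓝 0) := by
        have h3 := Real.tendsto_pow_mul_exp_neg_atTop_nhds_zero 1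
        have h4 : Tendsto (fun x : ℝ => x / 4) atTop atTop := tendsto_id.atTop_div_const (by norm_num)
        have h5 := (h3.comp h4).const_mul 4
        have h6 := Real.tendsto_exp_neg_atTop_nhds_zero.comp h4
        have h7 := h5.add h6
        simp only [mul_zero, add_zero] at h7
        refine h7.congr fun x => ?_
        simp only [Function.comp, pow_one]
        rw [neg_div]; ring
      exact h2.comp hp
    refine squeeze_zero_norm (fun u => ?_) h1
    rw [Real.norm_eq_abs, abs_mul, abs_of_pos (Real.exp_pos _)]
    gcongr
    apply abs_le_of_sq_le_sq
    · nlinarith [sq_nonneg (X u * Real.cos (θ u) + Y u * Real.sin (θ u)), Real.sin_sq_add_cos_sq (θ u),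
        sq_nonneg (X u ^ 2 + Y u ^ 2), sq_nonneg (X u), sq_nonneg (Y u)]
    · positivity
  have hintg := integral_Ioi_of_hasDerivAt_of_tendsto' (a := u) (fun x _ => h.hg x) hg'i.integrableOn hlim
  rw [zero_sub] at hintg
  rw [← abs_neg, ← hintg]
  calc |∫ x in Ioi u, g' x| ≤ ∫ x in Ioi u, ‖g' x‖ := by
        rw [← Real.norm_eq_abs]; exact norm_integral_le_integral_norm _
    _ ≤ ∫ x, ‖g' x‖ := setIntegral_le_integral hg'i.norm (Eventually.of_forall fun x => norm_nonneg _)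
    _ ≤ ∫ x, G x := integral_mono hg'i.norm hGi hle
    _ ≤ _ := by
      rw [hG, integral_div, integral_add (i3.const_mul A) (i2.const_mul (8 / A)),
        integral_const_mul, integral_const_mul]
      have : 8 * (Real.sqrt (8 * π) * m) / A = 8 / A * (Real.sqrt (8 * π) * m) := by ring
      rw [this]
      gcongr

lemma static_small (m : ℕ) (R' δ : ℝ) (hδ : 0 < δ) : ∃ ε > 0, ∀ X Y θ v κ : ℝ → ℝ,
    SC X Y θ v κ → SB X Y θ v κ m ε →
    (∀ u, X u ^ 2 + Y u ^ 2 ≤ R' ^ 2 → |-X u * Real.sin (θ u) + Y u * Real.cos (θ u)| ≤ δ) ∧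
    (∀ a b, a ≤ b → (∀ u ∈ Icc a b, X u ^ 2 + Y u ^ 2 ≤ R' ^ 2) → |θ b - θ a| ≤ δ) := by
  set E := Real.exp (R' ^ 2 / 4) with hE
  have hE0 : 0 < E := Real.exp_pos _
  set C8 := Real.sqrt (8 * π) * m with hC8
  set C4 := Real.sqrt (4 * π) * m with hC4
  have hC80 : 0 ≤ C8 := by positivity
  have hC40 : 0 ≤ C4 := by positivity
  -- η target for |w| e^{-..}
  set η := δ / (E * (1 + E * C4)) / 2 with hη
  have hη0 : 0 < η := by positivity
  set A1 := (8 * C8 + 1) / η with hA1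
  have hA10 : 0 < A1 := by positivity
  set A2 := (C4 + 1) * (E * 2) / δ with hA2
  have hA20 : 0 < A2 := by positivity
  set ε := min (η / A1) (δ / (2 * E * A2)) with hε
  have hε0 : 0 < ε := by positivity
  refine ⟨ε, hε0, fun X Y θ v κ h hB => ?_⟩
  have hw : ∀ u, X u ^ 2 + Y u ^ 2 ≤ R' ^ 2 →
      |-X u * Real.sin (θ u) + Y u * Real.cos (θ u)| ≤ E * η := by
    intro u hu
    have h1 := h.w_le hε0.le hB hA10 u
    rw [abs_mul, abs_of_pos (Real.exp_pos _)] at h1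
    have h2 : A1 * ε ≤ η := by
      calc A1 * ε ≤ A1 * (η / A1) := by gcongr; exact min_le_left _ _
        _ = η := by field_simp
    have h3 : 8 * C8 / A1 ≤ η := by
      rw [hA1, div_div_eq_mul_div, div_le_iff₀ (by positivity)]; nlinarith
    have h4 : 1 ≤ E * Real.exp (-(X u ^ 2 + Y u ^ 2) / 4) := by
      rw [hE, ← Real.exp_add]; apply Real.one_le_exp; linarith
    have h5 := abs_nonneg (-X u * Real.sin (θ u) + Y u * Real.cos (θ u))
    calc |-X u * Real.sin (θ u) + Y u * Real.cos (θ u)|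
        ≤ |-X u * Real.sin (θ u) + Y u * Real.cos (θ u)| * (E * Real.exp (-(X u ^ 2 + Y u ^ 2) / 4)) :=
          le_mul_of_one_le_right h5 h4
      _ = E * (|-X u * Real.sin (θ u) + Y u * Real.cos (θ u)| * Real.exp (-(X u ^ 2 + Y u ^ 2) / 4)) := by ring
      _ ≤ E * η := by gcongr; linarith
  have hEη : E * η ≤ δ / 2 ∧ E * (E * η * C4) ≤ δ / 2 := by
    have : E * η * (1 + E * C4) = δ / 2 := by rw [hη]; field_simp
    constructor <;> nlinarith [mul_pos hE0 hη0, mul_nonneg hE0.le hC40, mul_nonneg (mul_pos hE0 hη0).le (mul_nonneg hE0.le hC40)]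
  refine ⟨fun u hu => (hw u hu).trans (by linarith), fun a b hab hu => ?_⟩
  have cX := h.cX
  have cY := h.cY
  have cθ := h.cθ
  have cv := h.cv
  have cκ := h.cκ
  obtain ⟨i1, I1⟩ := integrable_of_lintegral_le (by fun_prop)
    (fun u => mul_nonneg (Real.exp_pos _).le (h.hv u).le) (by positivity) hB.E1
  obtain ⟨i3, I3⟩ := integrable_of_lintegral_le (by fun_prop)
    (fun u => mul_nonneg (by positivity) (h.hv u).le) hε0.le hB.E3
  have hFTC : ∫ u in a..b, v u * κ u = θ b - θ a :=
    intervalIntegral.integral_eq_sub_of_hasDerivAt (fun x _ => h.hθ x)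
      ((cv.mul cκ).intervalIntegrable _ _)
  set G : ℝ → ℝ := fun u => E / 2 * A2 * ((κ u + (-X u * Real.sin (θ u) + Y u * Real.cos (θ u)) / 2) ^ 2 *
    Real.exp (-(X u ^ 2 + Y u ^ 2) / 4) * v u) +
      (E / (2 * A2) + E * (E * η) / 2) * (Real.exp (-(X u ^ 2 + Y u ^ 2) / 4) * v u) with hG
  have hG0 : ∀ u, 0 ≤ G u := fun u => by
    have := (h.hv u).le
    rw [hG]; positivity
  have hGi : Integrable G := (i3.const_mul _).add (i1.const_mul _)
  have hGc : Continuous G := by rw [hG]; fun_prop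
  have hle : ∀ u ∈ Icc a b, |v u * κ u| ≤ G u := by
    intro u hu'
    have h1 := hw u (hu u hu')
    have hv := h.hv u
    set w := -X u * Real.sin (θ u) + Y u * Real.cos (θ u)
    set e := Real.exp (-(X u ^ 2 + Y u ^ 2) / 4) with he
    have he0 : 0 < e := Real.exp_pos _
    have h4 : 1 ≤ E * e := by
      rw [hE, he, ← Real.exp_add]; apply Real.one_le_exp; linarith [hu u hu']
    have h5 : |κ u| ≤ |κ u + w / 2| + |w| / 2 := by
      have := abs_sub (κ u + w / 2) (w / 2)
      rw [add_sub_cancel_right, abs_div, abs_two] at this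
      exact this
    have h6 := abs_mul_le_half (a := κ u + w / 2) (b := 1) hA20
    rw [mul_one] at h6
    rw [abs_mul, abs_of_pos hv]
    have h7 : |κ u| ≤ (A2 * (κ u + w / 2) ^ 2 + 1 ^ 2 / A2) / 2 + E * η / 2 := by linarith
    calc v u * |κ u| ≤ v u * ((A2 * (κ u + w / 2) ^ 2 + 1 ^ 2 / A2) / 2 + E * η / 2) := by gcongr
      _ ≤ v u * ((A2 * (κ u + w / 2) ^ 2 + 1 ^ 2 / A2) / 2 + E * η / 2) * (E * e) :=
        le_mul_of_one_le_right (by positivity) h4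
      _ = E / 2 * A2 * ((κ u + w / 2) ^ 2 * e * v u) +
          (E / (2 * A2) + E * (E * η) / 2) * (e * v u) := by field_simp; ring
      _ = G u := rfl
  rw [← hFTC]
  calc |∫ u in a..b, v u * κ u| ≤ ∫ u in a..b, |v u * κ u| :=
        intervalIntegral.abs_integral_le_integral_abs hab
    _ ≤ ∫ u in a..b, G u := intervalIntegral.integral_mono_on hab
        ((cv.mul cκ).abs.intervalIntegrable _ _) (hGc.intervalIntegrable _ _) hle
    _ ≤ ∫ u, G u := by
        rw [intervalIntegral.integral_of_le hab]
        exact setIntegral_le_integral hGi (Eventually.of_forall hG0)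
    _ ≤ E / 2 * A2 * ε + (E / (2 * A2) + E * (E * η) / 2) * C4 := by
        rw [hG, integral_add (i3.const_mul _) (i1.const_mul _), integral_const_mul, integral_const_mul]
        gcongr
    _ ≤ δ := by
        have h1 : E / 2 * A2 * ε ≤ δ / 4 := by
          calc E / 2 * A2 * ε ≤ E / 2 * A2 * (δ / (2 * E * A2)) := by gcongr; exact min_le_right _ _
            _ = δ / 4 := by field_simp; norm_num
        have h2 : E / (2 * A2) * C4 ≤ δ / 4 := by
          rw [hA2]
          have : E / (2 * ((C4 + 1) * (E * 2) / δ)) * C4 = δ / 4 * (C4 / (C4 + 1)) := by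
            field_simp; ring
          rw [this]
          have : C4 / (C4 + 1) ≤ 1 := by rw [div_le_one (by positivity)]; linarith
          nlinarith
        nlinarith [hEη.2]
end

end Part2

section Part3

lemma exit_right (f : ℝ → ℝ) (hc : Continuous f) (hf : Tendsto f atTop atTop) (z K : ℝ)
    (hz : f z < K) : ∃ b, z < b ∧ f b = K ∧ ∀ u ∈ Ico z b, f u < K := by
  set S := {u | z ≤ u ∧ K ≤ f u} with hS
  have hSc : IsClosed S := (isClosed_le continuous_const continuous_id).inter
    (isClosed_le continuous_const hc)
  have hne : S.Nonempty := by
    obtain ⟨u, h1, h2⟩ := ((hf.eventually_ge_atTop K).and (eventually_ge_atTop z)).exists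
    exact ⟨u, h2, h1⟩
  have hbd : BddBelow S := ⟨z, fun u hu => hu.1⟩
  have hmem := hSc.csInf_mem hne hbd
  set b := sInf S
  have hzb : z < b := lt_of_le_of_ne hmem.1 (by
    intro h; have := hmem.2; rw [← h] at this; linarith)
  have hlt : ∀ u ∈ Ico z b, f u < K := by
    intro u hu
    by_contra hcon
    push Not at hcon
    have := csInf_le hbd (show u ∈ S from ⟨hu.1, hcon⟩)
    exact absurd hu.2 (not_lt.mpr this)
  refine ⟨b, hzb, le_antisymm ?_ hmem.2, hlt⟩
  have hcl : IsClosed {u | f u ≤ K} := isClosed_le hc continuous_const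
  have : closure (Ico z b) ⊆ {u | f u ≤ K} := hcl.closure_subset_iff.mpr fun u hu => (hlt u hu).le
  rw [closure_Ico hzb.ne] at this
  exact this ⟨hzb.le, le_rfl⟩

lemma exit_interval (f : ℝ → ℝ) (hc : Continuous f) (hf : Tendsto f (cocompact ℝ) atTop) (z K : ℝ)
    (hz : f z < K) : ∃ a b, a < z ∧ z < b ∧ f a = K ∧ f b = K ∧ ∀ u ∈ Ioo a b, f u < K := by
  rw [cocompact_eq_atBot_atTop, tendsto_sup] at hf
  obtain ⟨b, h1, h2, h3⟩ := exit_right f hc hf.2 z K hz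
  obtain ⟨a, h4, h5, h6⟩ := exit_right (fun u => f (-u)) (by fun_prop)
    (hf.1.comp tendsto_neg_atTop_atBot) (-z) K (by simpa using hz)
  refine ⟨-a, b, by linarith, h1, h5, h2, fun u hu => ?_⟩
  rcases le_total z u with h | h
  · exact h3 u ⟨h, hu.2⟩
  · have := h6 (-u) ⟨by linarith, by linarith [hu.1]⟩
    simpa using this

section
variable {X Y θ v κ : ℝ → ℝ}

lemma SC.strand (h : SC X Y θ v κ) {R R' δ : ℝ} (hR : 0 < R) (hRR : R + 2 ≤ R') (hδ : 0 < δ)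
    (hδ2 : δ * (1 + R') ≤ 1)
    (Hw : ∀ u, X u ^ 2 + Y u ^ 2 ≤ R' ^ 2 → |-X u * Real.sin (θ u) + Y u * Real.cos (θ u)| ≤ δ)
    (Hθ : ∀ a b, a ≤ b → (∀ u ∈ Icc a b, X u ^ 2 + Y u ^ 2 ≤ R' ^ 2) → |θ b - θ a| ≤ δ)
    (z : ℝ) (hz : X z ^ 2 + Y z ^ 2 < R ^ 2) :
    ∃ a b, a < z ∧ z < b ∧ X a ^ 2 + Y a ^ 2 = R' ^ 2 ∧ X b ^ 2 + Y b ^ 2 = R' ^ 2 ∧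
      (∀ u ∈ Ioo a b, X u ^ 2 + Y u ^ 2 < R' ^ 2) ∧
      (∀ u ∈ Icc a b, |θ u - θ z| ≤ δ) ∧
      (∀ u ∈ Icc a b, |-X u * Real.sin (θ z) + Y u * Real.cos (θ z)| ≤ δ * (1 + R')) ∧
      X a * Real.cos (θ z) + Y a * Real.sin (θ z) ≤ -(R' - 1) ∧
      R' - 1 ≤ X b * Real.cos (θ z) + Y b * Real.sin (θ z) := by
  have cX := h.cX
  have cY := h.cY
  obtain ⟨a, b, haz, hzb, ha, hb, hin⟩ := exit_interval (fun u => X u ^ 2 + Y u ^ 2)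
    (by fun_prop) h.prop z (R' ^ 2) (by nlinarith)
  have hinc : ∀ u ∈ Icc a b, X u ^ 2 + Y u ^ 2 ≤ R' ^ 2 := by
    intro u hu
    rcases eq_or_lt_of_le hu.1 with h1 | h1
    · rw [← h1, ha]
    rcases eq_or_lt_of_le hu.2 with h2 | h2
    · rw [h2, hb]
    exact (hin u ⟨h1, h2⟩).le
  have hθz : ∀ u ∈ Icc a b, |θ u - θ z| ≤ δ := by
    intro u hu
    rcases le_total z u with hzu | hzu
    · exact Hθ z u hzu fun x hx => hinc x ⟨by linarith [hx.1], by linarith [hx.2, hu.2]⟩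
    · rw [abs_sub_comm]
      exact Hθ u z hzu fun x hx => hinc x ⟨by linarith [hx.1, hu.1], by linarith [hx.2]⟩
  have hQ : ∀ u ∈ Icc a b, |-X u * Real.sin (θ z) + Y u * Real.cos (θ z)| ≤ δ * (1 + R') := by
    intro u hu
    set w := -X u * Real.sin (θ u) + Y u * Real.cos (θ u) with hw
    set p := X u * Real.cos (θ u) + Y u * Real.sin (θ u) with hp
    have e1 : -X u * Real.sin (θ z) + Y u * Real.cos (θ z) =
        w * Real.cos (θ u - θ z) + p * Real.sin (θ u - θ z) := by
      rw [hw, hp, Real.cos_sub, Real.sin_sub]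
      have := Real.sin_sq_add_cos_sq (θ u)
      linear_combination (X u * Real.sin (θ z) - Y u * Real.cos (θ z)) * this
    have e2 : |p| ≤ R' := by
      apply abs_le_of_sq_le_sq _ (by linarith)
      refine le_trans ?_ (hinc u hu)
      rw [hp]
      nlinarith [sq_nonneg (X u * Real.sin (θ u) - Y u * Real.cos (θ u)), Real.sin_sq_add_cos_sq (θ u)]
    have e3 : |Real.sin (θ u - θ z)| ≤ δ := Real.abs_sin_le_abs.trans (hθz u hu)
    rw [e1]
    calc _ ≤ |w * Real.cos (θ u - θ z)| + |p * Real.sin (θ u - θ z)| := abs_add_le _ _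
      _ = |w| * |Real.cos (θ u - θ z)| + |p| * |Real.sin (θ u - θ z)| := by rw [abs_mul, abs_mul]
      _ ≤ δ * 1 + R' * δ := by
        gcongr
        · exact Hw u (hinc u hu)
        · exact Real.abs_cos_le_one _
        · linarith
      _ = _ := by ring
  have hδ1 : δ ≤ 1 := by nlinarith
  set P : ℝ → ℝ := fun u => X u * Real.cos (θ z) + Y u * Real.sin (θ z) with hP
  have hPd : ∀ u, HasDerivAt P (v u * Real.cos (θ u - θ z)) u := by
    intro u
    refine (((h.hX u).mul_const (Real.cos (θ z))).add ((h.hY u).mul_const (Real.sin (θ z)))).congr_deriv ?_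
    rw [Real.cos_sub]; ring
  have hmono : StrictMonoOn P (Icc a b) := by
    refine strictMonoOn_of_deriv_pos (convex_Icc a b)
      (fun u _ => (hPd u).continuousAt.continuousWithinAt) fun u hu => ?_
    rw [interior_Icc] at hu
    rw [(hPd u).deriv]
    refine mul_pos (h.hv u) (Real.cos_pos_of_mem_Ioo ?_)
    have := abs_le.mp (hθz u (Ioo_subset_Icc_self hu))
    constructor <;> linarith [Real.pi_gt_three]
  have habs : ∀ u ∈ Icc a b, X u ^ 2 + Y u ^ 2 = R' ^ 2 → R' - 1 ≤ |P u| := by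
    intro u hu hu2
    have h1 := hQ u hu
    have h2 : (-X u * Real.sin (θ z) + Y u * Real.cos (θ z)) ^ 2 ≤ 1 := by
      rw [← sq_abs]; have := abs_nonneg (-X u * Real.sin (θ z) + Y u * Real.cos (θ z)); nlinarith
    have h3 : P u ^ 2 + (-X u * Real.sin (θ z) + Y u * Real.cos (θ z)) ^ 2 = R' ^ 2 := by
      rw [← hu2, hP]; simp only
      linear_combination (X u ^ 2 + Y u ^ 2) * Real.sin_sq_add_cos_sq (θ z)
    by_contra hcon
    push Not at hcon
    have := sq_abs (P u)
    nlinarith [abs_nonneg (P u)]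
  have hPz : |P z| ≤ R := by
    apply abs_le_of_sq_le_sq _ hR.le
    refine le_trans ?_ hz.le
    rw [hP]; simp only
    nlinarith [sq_nonneg (X z * Real.sin (θ z) - Y z * Real.cos (θ z)), Real.sin_sq_add_cos_sq (θ z)]
  have hPz' := abs_le.mp hPz
  refine ⟨a, b, haz, hzb, ha, hb, hin, hθz, hQ, ?_, ?_⟩
  · have h1 := habs a ⟨le_rfl, by linarith⟩ ha
    have h2 := hmono ⟨le_rfl, by linarith⟩ ⟨haz.le, hzb.le⟩ haz
    rcases abs_cases (P a) with h3 | h3 <;> simp only [hP] at * <;> linarith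
  · have h1 := habs b ⟨by linarith, le_rfl⟩ hb
    have h2 := hmono ⟨haz.le, hzb.le⟩ ⟨by linarith, le_rfl⟩ hzb
    rcases abs_cases (P b) with h3 | h3 <;> simp only [hP] at * <;> linarith

lemma SC.strand_len (h : SC X Y θ v κ) {K d : ℝ} (hK : 0 ≤ K) (a b z : ℝ) (hab : a ≤ b)
    (hQ : ∀ u ∈ Icc a b, |-X u * Real.sin (θ z) + Y u * Real.cos (θ z)| ≤ d)
    (ha : X a * Real.cos (θ z) + Y a * Real.sin (θ z) ≤ -K)
    (hb : K ≤ X b * Real.cos (θ z) + Y b * Real.sin (θ z)) :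
    Real.exp (-d ^ 2 / 4) * ∫ y in (-K)..K, Real.exp (-y ^ 2 / 4) ≤
      ∫ u in a..b, Real.exp (-(X u ^ 2 + Y u ^ 2) / 4) * v u := by
  have cX := h.cX
  have cY := h.cY
  have cθ := h.cθ
  have cv := h.cv
  set P : ℝ → ℝ := fun u => X u * Real.cos (θ z) + Y u * Real.sin (θ z) with hP
  have hPd : ∀ u, HasDerivAt P (v u * Real.cos (θ u - θ z)) u := by
    intro u
    refine (((h.hX u).mul_const (Real.cos (θ z))).add ((h.hY u).mul_const (Real.sin (θ z)))).congr_deriv ?_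
    rw [Real.cos_sub]; ring
  have hsub := intervalIntegral.integral_comp_mul_deriv (a := a) (b := b) (f := P)
    (g := fun y => Real.exp (-y ^ 2 / 4)) (fun u _ => hPd u) (by fun_prop) (by fun_prop)
  have h1 : ∫ y in (-K)..K, Real.exp (-y ^ 2 / 4) ≤ ∫ y in (P a)..(P b), Real.exp (-y ^ 2 / 4) := by
    apply intervalIntegral.integral_mono_interval ha (by linarith) hb
    · exact Eventually.of_forall fun y => (Real.exp_pos _).le
    · apply Continuous.intervalIntegrable; fun_prop
  calc _ ≤ Real.exp (-d ^ 2 / 4) * ∫ y in (P a)..(P b), Real.exp (-y ^ 2 / 4) := by gcongr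
    _ = ∫ u in a..b, Real.exp (-d ^ 2 / 4) * (Real.exp (-P u ^ 2 / 4) * (v u * Real.cos (θ u - θ z))) := by
      rw [← hsub, intervalIntegral.integral_const_mul]; rfl
    _ ≤ _ := by
      apply intervalIntegral.integral_mono_on hab
      · apply Continuous.intervalIntegrable
        have : Continuous P := by rw [hP]; fun_prop
        fun_prop
      · apply Continuous.intervalIntegrable; fun_prop
      · intro u hu
        have h3 : P u ^ 2 + (-X u * Real.sin (θ z) + Y u * Real.cos (θ z)) ^ 2 = X u ^ 2 + Y u ^ 2 := by
          rw [hP]; simp only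
          linear_combination (X u ^ 2 + Y u ^ 2) * Real.sin_sq_add_cos_sq (θ z)
        have h4 : (-X u * Real.sin (θ z) + Y u * Real.cos (θ z)) ^ 2 ≤ d ^ 2 := by
          rw [← sq_abs]; exact pow_le_pow_left₀ (abs_nonneg _) (hQ u hu) 2
        rw [← mul_assoc, ← Real.exp_add]
        have hv := (h.hv u).le
        calc _ ≤ Real.exp (-d ^ 2 / 4 + -P u ^ 2 / 4) * (v u * 1) := by
              gcongr; exact Real.cos_le_one _
          _ ≤ _ := by
              rw [mul_one]
              gcongr
              linarith

lemma SC.count (h : SC X Y θ v κ) {m : ℕ} {R R' q : ℝ} (_hq : 0 ≤ q)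
    (hE : ∫⁻ u, ENNReal.ofReal (Real.exp (-(X u ^ 2 + Y u ^ 2) / 4) * v u) ≤
      ENNReal.ofReal (Real.sqrt (4 * π) * m)) (hqm : Real.sqrt (4 * π) * m < q * (m + 1))
    (hlen : ∀ z, X z ^ 2 + Y z ^ 2 < R ^ 2 → ∃ a b, a < z ∧ z < b ∧
      X a ^ 2 + Y a ^ 2 = R' ^ 2 ∧ X b ^ 2 + Y b ^ 2 = R' ^ 2 ∧
      (∀ u ∈ Ioo a b, X u ^ 2 + Y u ^ 2 < R' ^ 2) ∧
      q ≤ ∫ u in a..b, Real.exp (-(X u ^ 2 + Y u ^ 2) / 4) * v u)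
    (Z : Finset ℝ) (hZ : ∀ z ∈ Z, X z ^ 2 + Y z ^ 2 < R ^ 2)
    (hsep : ∀ z ∈ Z, ∀ z' ∈ Z, z < z' → ∃ s ∈ Ioo z z', R' ^ 2 ≤ X s ^ 2 + Y s ^ 2) :
    Z.card ≤ m := by
  have cX := h.cX
  have cY := h.cY
  have cv := h.cv
  by_contra hcon
  push Not at hcon
  obtain ⟨i1, I1⟩ := integrable_of_lintegral_le (by fun_prop)
    (fun u => mul_nonneg (Real.exp_pos _).le (h.hv u).le) (by positivity) hE
  choose! a b haz hzb ha hb hin hl using hlen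
  set f := fun u => Real.exp (-(X u ^ 2 + Y u ^ 2) / 4) * v u with hf
  have hf0 : ∀ u, 0 ≤ f u := fun u => mul_nonneg (Real.exp_pos _).le (h.hv u).le
  have hdisj' : ∀ z ∈ Z, ∀ z' ∈ Z, z < z' → Disjoint (Ioc (a z) (b z)) (Ioc (a z') (b z')) := by
    intro z hz z' hz' hlt
    obtain ⟨s, hs, hs2⟩ := hsep z hz z' hz' hlt
    have h1 : b z ≤ s := by
      by_contra hc; push Not at hc
      have := hin z (hZ z hz) s ⟨by linarith [haz z (hZ z hz), hs.1], hc⟩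
      linarith
    have h2 : s ≤ a z' := by
      by_contra hc; push Not at hc
      have := hin z' (hZ z' hz') s ⟨hc, by linarith [hzb z' (hZ z' hz'), hs.2]⟩
      linarith
    rw [Set.disjoint_left]
    intro x hx hx'
    linarith [hx.2, hx'.1]
  have hdisj : Set.Pairwise (↑Z) (Function.onFun Disjoint fun z => Ioc (a z) (b z)) := by
    intro z hz z' hz' hne
    rcases lt_or_gt_of_ne hne with hlt | hlt
    · exact hdisj' z hz z' hz' hlt
    · exact (hdisj' z' hz' z hz hlt).symm
  have hsum : ∑ z ∈ Z, ∫ u in Ioc (a z) (b z), f u ≤ ∫ u, f u := by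
    rw [← integral_biUnion_finset Z (fun z _ => measurableSet_Ioc) hdisj (fun z _ => i1.integrableOn)]
    exact setIntegral_le_integral i1 (Eventually.of_forall hf0)
  have hsum2 : ∑ z ∈ Z, q ≤ ∑ z ∈ Z, ∫ u in Ioc (a z) (b z), f u := by
    apply Finset.sum_le_sum
    intro z hz
    rw [← intervalIntegral.integral_of_le (by linarith [haz z (hZ z hz), hzb z (hZ z hz)])]
    exact hl z (hZ z hz)
  rw [Finset.sum_const, nsmul_eq_mul] at hsum2
  have : ((m:ℝ) + 1) ≤ Z.card := by exact_mod_cast hcon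
  nlinarith
end

lemma chain_lemma (S : Finset ℝ) (g : ℝ → ℝ) (c : ℝ) (hc : 0 ≤ c)
    (hadj : ∀ x ∈ S, ∀ y ∈ S, x < y → (∀ z ∈ S, ¬ (x < z ∧ z < y)) → |g y - g x| ≤ c) :
    ∀ x ∈ S, ∀ y ∈ S, |g y - g x| ≤ c * ((S.card : ℝ) - 1) := by
  have key : ∀ n : ℕ, ∀ x ∈ S, ∀ y ∈ S, x ≤ y → (S.filter (fun z => x < z ∧ z ≤ y)).card = n →
      |g y - g x| ≤ c * n := by
    intro n
    induction n with
    | zero =>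
      intro x hx y hy hxy hcard
      rcases eq_or_lt_of_le hxy with h | h
      · subst h; simp
      · have : y ∈ S.filter (fun z => x < z ∧ z ≤ y) := Finset.mem_filter.mpr ⟨hy, h, le_rfl⟩
        rw [Finset.card_eq_zero] at hcard
        rw [hcard] at this
        exact absurd this (Finset.notMem_empty _)
    | succ n ih =>
      intro x hx y hy hxy hcard
      have hlt : x < y := by
        rcases eq_or_lt_of_le hxy with h | h
        · exfalso
          subst h
          have : S.filter (fun z => x < z ∧ z ≤ x) = ∅ := by
            ext z; simp
          rw [this] at hcard; simp at hcard
        · exact h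
      set B := S.filter (fun z => x ≤ z ∧ z < y) with hB
      have hBne : B.Nonempty := ⟨x, Finset.mem_filter.mpr ⟨hx, le_rfl, hlt⟩⟩
      set y' := B.max' hBne with hy'
      have hm : y' ∈ B := B.max'_mem hBne
      rw [hB, Finset.mem_filter] at hm
      have hno : ∀ z ∈ S, ¬ (y' < z ∧ z < y) := by
        rintro z hz ⟨h1, h2⟩
        have : z ≤ y' := B.le_max' z (Finset.mem_filter.mpr ⟨hz, by linarith [hm.2.1], h2⟩)
        linarith
      have h1 := hadj y' hm.1 y hy hm.2.2 hno
      have hins : S.filter (fun z => x < z ∧ z ≤ y) = insert y (S.filter (fun z => x < z ∧ z ≤ y')) := by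
        ext z
        simp only [Finset.mem_filter, Finset.mem_insert]
        constructor
        · rintro ⟨hz, h2, h3⟩
          rcases eq_or_lt_of_le h3 with h4 | h4
          · exact Or.inl h4
          · right
            refine ⟨hz, h2, ?_⟩
            by_contra hcon
            push Not at hcon
            exact hno z hz ⟨hcon, h4⟩
        · rintro (rfl | ⟨hz, h2, h3⟩)
          · exact ⟨hy, hlt, le_rfl⟩
          · exact ⟨hz, h2, h3.trans hm.2.2.le⟩
      rw [hins, Finset.card_insert_of_notMem (by
        simp only [Finset.mem_filter, not_and, not_le]
        intro _ _; exact hm.2.2)] at hcard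
      have h2 := ih x hx y' hm.1 hm.2.1 (by omega)
      calc |g y - g x| = |(g y - g y') + (g y' - g x)| := by ring_nf
        _ ≤ |g y - g y'| + |g y' - g x| := abs_add_le _ _
        _ ≤ c + c * n := by linarith
        _ = c * ((n + 1 : ℕ) : ℝ) := by push_cast; ring
  have key2 : ∀ x ∈ S, ∀ y ∈ S, x ≤ y → |g y - g x| ≤ c * ((S.card : ℝ) - 1) := by
    intro x hx y hy hxy
    refine (key _ x hx y hy hxy rfl).trans ?_
    gcongr
    have : S.filter (fun z => x < z ∧ z ≤ y) ⊆ S.erase x := by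
      intro z hz
      rw [Finset.mem_filter] at hz
      exact Finset.mem_erase.mpr ⟨hz.2.1.ne', hz.1⟩
    have := Finset.card_le_card this
    rw [Finset.card_erase_of_mem hx] at this
    have h1 : 1 ≤ S.card := Finset.card_pos.mpr ⟨x, hx⟩
    have : (S.filter (fun z => x < z ∧ z ≤ y)).card + 1 ≤ S.card := by omega
    have : ((S.filter (fun z => x < z ∧ z ≤ y)).card : ℝ) + 1 ≤ S.card := by exact_mod_cast this
    linarith
  intro x hx y hy
  rcases le_total x y with h | h
  · exact key2 x hx y hy h
  · rw [abs_sub_comm]; exact key2 y hy x hx h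
end Part3

section Part4

lemma abs_sin_add_le' (x y : ℝ) : |Real.sin (x + y)| ≤ |Real.sin x| + |Real.sin y| := by
  rw [Real.sin_add]
  refine (abs_add_le _ _).trans ?_
  rw [abs_mul, abs_mul]
  nlinarith [abs_nonneg (Real.sin x), abs_nonneg (Real.sin y), Real.abs_cos_le_one x, Real.abs_cos_le_one y]

lemma sin_grid (m : ℕ) (hm : 0 < m) (j k : Fin (m + 1)) (hjk : j ≠ k) :
    Real.sin (π / (m + 1)) ≤ |Real.sin ((j : ℝ) * (π / (m + 1)) - (k : ℝ) * (π / (m + 1)))| := by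
  have main : ∀ j k : Fin (m + 1), k < j →
      Real.sin (π / (m + 1)) ≤ |Real.sin ((j : ℝ) * (π / (m + 1)) - (k : ℝ) * (π / (m + 1)))| := by
    intro j k hlt
    refine le_trans ?_ (le_abs_self _)
    have hπ := Real.pi_pos
    set a := π / ((m:ℝ) + 1) with ha
    have ha0 : 0 < a := by positivity
    have ham : a * (m + 1) = π := by rw [ha]; field_simp
    have h1 : (k : ℝ) + 1 ≤ j := by exact_mod_cast hlt
    have h2 : (j : ℝ) ≤ m := by exact_mod_cast Nat.lt_succ_iff.mp j.2
    have h3 : (0:ℝ) ≤ k := by positivity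
    have h4 : (1:ℝ) ≤ m := by exact_mod_cast hm
    have h5 : a ≤ (j:ℝ) * a - k * a := by nlinarith
    have h6 : (j:ℝ) * a - k * a ≤ π - a := by nlinarith
    rcases le_total ((j:ℝ) * a - k * a) (π / 2) with h | h
    · exact Real.sin_le_sin_of_le_of_le_pi_div_two (by linarith) h h5
    · rw [← Real.sin_pi_sub ((j:ℝ) * a - k * a)]
      exact Real.sin_le_sin_of_le_of_le_pi_div_two (by linarith) (by linarith) (by linarith)
  rcases lt_or_gt_of_ne hjk with h | h
  · have := main k j h
    rw [← abs_neg, ← Real.sin_neg, neg_sub]; exact this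
  · exact main j k h

lemma gauss_trunc (c : ℝ) (hc : c < Real.sqrt (4 * π)) (K0 : ℝ) :
    ∃ K ≥ K0, c ≤ ∫ y in (-K)..K, Real.exp (-y ^ 2 / 4) := by
  have hintg : Integrable (fun y : ℝ => Real.exp (-y ^ 2 / 4)) := by
    have := integrable_exp_neg_mul_sq (b := 1 / 4) (by norm_num)
    refine this.congr (Eventually.of_forall fun y => ?_)
    simp only; congr 1; ring
  have hval : ∫ y : ℝ, Real.exp (-y ^ 2 / 4) = Real.sqrt (4 * π) := by
    have := integral_gaussian (1 / 4)
    rw [show π / (1 / 4) = 4 * π by ring] at this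
    rw [← this]
    congr 1; ext y; congr 1; ring
  have ht := intervalIntegral_tendsto_integral hintg tendsto_neg_atTop_atBot tendsto_id
  rw [hval] at ht
  obtain ⟨K, h1, h2⟩ := ((ht.eventually_const_le hc).and (eventually_ge_atTop K0)).exists
  exact ⟨K, h2, h1⟩

lemma SC.chord {X Y θ v κ : ℝ → ℝ} (h : SC X Y θ v κ) {a b : ℝ} (hab : a ≠ b)
    (hseg : ∀ s, ∀ r ∈ Ioo (0:ℝ) 1, ¬ (X s = X a + r * (X b - X a) ∧ Y s = Y a + r * (Y b - Y a))) :
    |θ b - θ a| ≤ 2 * π := by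
  wlog hlt : a < b generalizing a b
  · rw [abs_sub_comm]
    refine this hab.symm ?_ (lt_of_le_of_ne (not_lt.mp hlt) hab.symm)
    rintro s r hr ⟨h1, h2⟩
    refine hseg s (1 - r) ⟨by linarith [hr.2], by linarith [hr.1]⟩ ⟨?_, ?_⟩
    · rw [h1]; ring
    · rw [h2]; ring
  have cX := h.cX
  have cY := h.cY
  have cθ := h.cθ
  have cv := h.cv
  have hnorm : ∀ u, ‖(v u : ℂ) * Complex.exp (θ u * Complex.I)‖ = v u := by
    intro u
    rw [norm_mul, Complex.norm_exp_ofReal_mul_I, mul_one, Complex.norm_real, Real.norm_eq_abs,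
      abs_of_pos (h.hv u)]
  refine chord_lemma (fun u => (X u : ℂ) + Y u * Complex.I)
    (fun u => (v u : ℂ) * Complex.exp (θ u * Complex.I)) θ ?_ ?_ ?_ ?_ ?_ cθ ?_ hlt ?_
  · intro u
    have := (h.hX u).ofReal_comp.add ((h.hY u).ofReal_comp.mul_const Complex.I)
    refine this.congr_deriv ?_
    rw [Complex.exp_mul_I]; push_cast; ring
  · fun_prop
  · intro u
    rw [← norm_pos_iff, hnorm]; exact h.hv u
  · intro u u' huu
    have e1 := congr_arg Complex.re huu
    have e2 := congr_arg Complex.im huu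
    simp at e1 e2
    exact h.inj u u' e1 e2
  · have : (fun u => ‖(X u : ℂ) + Y u * Complex.I‖) = fun u => Real.sqrt (X u ^ 2 + Y u ^ 2) := by
      ext u
      rw [Complex.norm_add_mul_I]
    rw [this]
    exact Real.tendsto_sqrt_atTop.comp h.prop
  · intro u; rw [hnorm]
  · intro s r hr huu
    have e1 := congr_arg Complex.re huu
    have e2 := congr_arg Complex.im huu
    simp at e1 e2
    exact hseg s r hr ⟨e1, e2⟩

set_option maxHeartbeats 2000000 in
lemma static_main (m : ℕ) (hm : 0 < m) (R : ℝ) (hR0 : 0 < R) : ∃ ε > 0, ∀ X Y θ v κ : ℝ → ℝ,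
    SC X Y θ v κ → SB X Y θ v κ m ε → ∀ p q, X p ^ 2 + Y p ^ 2 < R ^ 2 → X q ^ 2 + Y q ^ 2 < R ^ 2 →
    |θ p - θ q| ≤ (2 * (m:ℝ) - 2) * π + 1 := by
  wlog hR : 1 ≤ R generalizing R
  · obtain ⟨ε, hε, H⟩ := this 1 one_pos le_rfl
    refine ⟨ε, hε, fun X Y θ v κ h hB p q hp hq => H X Y θ v κ h hB p q ?_ ?_⟩ <;> nlinarith
  have hm1 : (1:ℝ) ≤ m := by exact_mod_cast hm
  set s := Real.sin (π / (m + 1)) / 4 with hs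
  have hs0 : 0 < s := by
    have : 0 < Real.sin (π / (m + 1)) := by
      apply Real.sin_pos_of_pos_of_lt_pi
      · positivity
      · rw [div_lt_iff₀ (by positivity)]; nlinarith [Real.pi_pos]
    positivity
  have hs1 : s ≤ 1 / 4 := by
    have := Real.sin_le_one (π / ((m:ℝ) + 1)); rw [hs]; linarith
  have hsq : 0 < Real.sqrt (4 * π) := by positivity
  obtain ⟨K, hK, hKI⟩ := gauss_trunc (Real.sqrt (4 * π) * ((m + 3 / 4) / (m + 1)))
    (by
      have : ((m:ℝ) + 3 / 4) / (m + 1) < 1 := by rw [div_lt_one (by positivity)]; linarith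
      nlinarith) (R + 1)
  set R' := K + 1 with hR'
  set d := min (s / 2) (1 / (4 * (m + 1))) with hd
  have hd0 : 0 < d := by positivity
  have hds : d ≤ s / 2 := min_le_left _ _
  have hdm : d * (4 * (m + 1)) ≤ 1 := by
    have : d ≤ 1 / (4 * (m + 1)) := min_le_right _ _
    rwa [le_div_iff₀ (by positivity)] at this
  set δ := d / (1 + R') with hδ
  have hR'0 : 0 < 1 + R' := by linarith
  have hδ0 : 0 < δ := by positivity
  have hδd : δ * (1 + R') = d := by rw [hδ]; field_simp
  have hδd' : δ ≤ d := by nlinarith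
  obtain ⟨ε, hε, H⟩ := static_small m R' δ hδ0
  refine ⟨ε, hε, fun X Y θ v κ h hB => ?_⟩
  obtain ⟨Hw, Hθ⟩ := H X Y θ v κ h hB
  have cX := h.cX
  have cY := h.cY
  have cθ := h.cθ
  have hst := fun z hz => h.strand hR0 (by linarith : R + 2 ≤ R') hδ0 (by rw [hδd]; linarith) Hw Hθ z hz
  set q := Real.sqrt (4 * π) * ((m + 1 / 2) / (m + 1)) with hq
  have hcount : ∀ Z : Finset ℝ, (∀ z ∈ Z, X z ^ 2 + Y z ^ 2 < R ^ 2) →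
      (∀ z ∈ Z, ∀ z' ∈ Z, z < z' → ∃ s ∈ Ioo z z', R' ^ 2 ≤ X s ^ 2 + Y s ^ 2) → Z.card ≤ m := by
    refine h.count (by positivity : 0 ≤ q) hB.E1 ?_ ?_
    · have : q * (m + 1) = Real.sqrt (4 * π) * (m + 1 / 2) := by rw [hq]; field_simp
      rw [this]; nlinarith
    · intro z hz
      obtain ⟨a, b, haz, hzb, ha, hb, hin, -, hQ, hPa, hPb⟩ := hst z hz
      refine ⟨a, b, haz, hzb, ha, hb, hin, ?_⟩
      have h1 := h.strand_len (K := K) (by linarith) a b z (by linarith) hQ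
        (by rw [hR'] at hPa; linarith) (by rw [hR'] at hPb; linarith)
      refine le_trans ?_ h1
      rw [hδd]
      have h2 : 1 - d ≤ Real.exp (-d ^ 2 / 4) := by
        have := Real.add_one_le_exp (-d ^ 2 / 4)
        nlinarith
      have h3 : q ≤ (1 - d) * (Real.sqrt (4 * π) * ((m + 3 / 4) / (m + 1))) := by
        have : (1 - d) * (Real.sqrt (4 * π) * ((m + 3 / 4) / (m + 1))) =
          Real.sqrt (4 * π) * ((1 - d) * (m + 3 / 4) / (m + 1)) := by ring
        rw [this, hq]
        gcongr
        nlinarith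
      refine h3.trans ?_
      have : 0 ≤ 1 - d := by linarith
      gcongr
  -- dichotomy
  have hdich : ∀ p q, X p ^ 2 + Y p ^ 2 < R ^ 2 → X q ^ 2 + Y q ^ 2 < R ^ 2 → p < q →
      ¬ (∃ s ∈ Ioo p q, R' ^ 2 ≤ X s ^ 2 + Y s ^ 2) →
      ∀ u ∈ Icc p q, |θ u - θ p| ≤ δ := by
    intro p q hp hq hpq hno u hu
    push Not at hno
    apply Hθ p u hu.1
    intro x hx
    have hRR : R ^ 2 ≤ R' ^ 2 := by nlinarith
    rcases eq_or_lt_of_le hx.1 with h1 | h1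
    · rw [← h1]; linarith
    rcases eq_or_lt_of_le (hx.2.trans hu.2) with h2 | h2
    · rw [h2]; linarith
    exact (hno x ⟨h1, h2⟩).le
  -- choice of direction
  have hdir : ∃ ν : ℝ, ∀ p, X p ^ 2 + Y p ^ 2 < R ^ 2 → s ≤ |Real.sin (θ p - ν)| := by
    by_contra hcon
    push Not at hcon
    choose f hf1 hf2 using hcon
    set P : Fin (m + 1) → ℝ := fun j => f ((j:ℝ) * (π / (m + 1))) with hP
    have hclose : ∀ j k, j ≠ k → ¬ |θ (P j) - θ (P k)| ≤ δ := by
      intro j k hjk hle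
      have h1 := sin_grid m hm j k hjk
      have h2 := hf2 ((j:ℝ) * (π / (m + 1)))
      have h3 := hf2 ((k:ℝ) * (π / (m + 1)))
      have e : (j:ℝ) * (π / (m + 1)) - (k:ℝ) * (π / (m + 1)) =
        ((θ (P j) - θ (P k)) + -(θ (P j) - (j:ℝ) * (π / (m + 1)))) + (θ (P k) - (k:ℝ) * (π / (m + 1))) := by ring
      rw [e] at h1
      have h4 := abs_sin_add_le' ((θ (P j) - θ (P k)) + -(θ (P j) - (j:ℝ) * (π / (m + 1))))
        (θ (P k) - (k:ℝ) * (π / (m + 1)))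
      have h5 := abs_sin_add_le' (θ (P j) - θ (P k)) (-(θ (P j) - (j:ℝ) * (π / (m + 1))))
      rw [Real.sin_neg, abs_neg] at h5
      have h6 : |Real.sin (θ (P j) - θ (P k))| ≤ δ := Real.abs_sin_le_abs.trans hle
      have h7 : Real.sin (π / (m + 1)) = 4 * s := by rw [hs]; ring
      simp only [hP] at *
      linarith
    have hinj : Function.Injective P := by
      intro j k hjk
      by_contra hne
      apply hclose j k hne
      rw [hjk, sub_self, abs_zero]; exact hδ0.le
    have := hcount (Finset.univ.image P) (by
      intro z hz
      obtain ⟨j, -, rfl⟩ := Finset.mem_image.mp hz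
      exact hf1 _) (by
      intro z hz z' hz' hlt
      obtain ⟨j, -, rfl⟩ := Finset.mem_image.mp hz
      obtain ⟨k, -, rfl⟩ := Finset.mem_image.mp hz'
      by_contra hno
      have hne : k ≠ j := by rintro rfl; exact lt_irrefl _ hlt
      exact hclose k j hne (hdich _ _ (hf1 _) (hf1 _) hlt hno _ ⟨hlt.le, le_rfl⟩))
    rw [Finset.card_image_of_injective _ hinj, Finset.card_univ, Fintype.card_fin] at this
    omega
  obtain ⟨ν, hν⟩ := hdir
  set N : ℝ → ℝ := fun u => -X u * Real.sin ν + Y u * Real.cos ν with hN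
  set L : ℝ → ℝ := fun u => X u * Real.cos ν + Y u * Real.sin ν with hL
  have hNc : Continuous N := by rw [hN]; fun_prop
  have hNd : ∀ u, HasDerivAt N (v u * Real.sin (θ u - ν)) u := by
    intro u
    refine (((h.hX u).neg.mul_const (Real.sin ν)).add ((h.hY u).mul_const (Real.cos ν))).congr_deriv ?_
    rw [Real.sin_sub]; ring
  have hNL : ∀ u, L u ^ 2 + N u ^ 2 = X u ^ 2 + Y u ^ 2 := by
    intro u; simp only [hN, hL]
    linear_combination (X u ^ 2 + Y u ^ 2) * Real.sin_sq_add_cos_sq ν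
  have hcross : ∀ p, X p ^ 2 + Y p ^ 2 < R ^ 2 → ∃ z, X z ^ 2 + Y z ^ 2 < 1 ∧ N z = 0 ∧ |θ z - θ p| ≤ δ := by
    intro p hp
    obtain ⟨a, b, haz, hzb, ha, hb, hin, hθp, hQ, hPa, hPb⟩ := hst p hp
    rw [hδd] at hQ
    set P : ℝ → ℝ := fun u => X u * Real.cos (θ p) + Y u * Real.sin (θ p) with hP
    set Q : ℝ → ℝ := fun u => -X u * Real.sin (θ p) + Y u * Real.cos (θ p) with hQd
    have hNP : ∀ u, N u = P u * Real.sin (θ p - ν) + Q u * Real.cos (θ p - ν) := by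
      intro u
      simp only [hN, hP, hQd]
      rw [Real.sin_sub, Real.cos_sub]
      linear_combination (X u * Real.sin ν - Y u * Real.cos ν) * Real.sin_sq_add_cos_sq (θ p)
    have hQc : ∀ u ∈ Icc a b, |Q u * Real.cos (θ p - ν)| ≤ d := by
      intro u hu
      rw [abs_mul]
      have q1 : |Q u| ≤ d := hQ u hu
      calc |Q u| * |Real.cos (θ p - ν)| ≤ d * 1 :=
            mul_le_mul q1 (Real.abs_cos_le_one _) (abs_nonneg _) hd0.le
        _ = d := mul_one _
    have hQa := abs_le.mp (hQc a ⟨le_rfl, by linarith⟩)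
    have hQb := abs_le.mp (hQc b ⟨by linarith, le_rfl⟩)
    have h0 : (0:ℝ) ∈ uIcc (N a) (N b) := by
      rw [mem_uIcc, hNP a, hNP b]
      have hPa' : P a ≤ -2 := by simp only [hP]; linarith
      have hPb' : 2 ≤ P b := by simp only [hP]; linarith
      have h1 := hν p hp
      rcases abs_cases (Real.sin (θ p - ν)) with h2 | h2
      · left; constructor <;> nlinarith
      · right; constructor <;> nlinarith
    obtain ⟨z, hz, hz0⟩ := intermediate_value_uIcc hNc.continuousOn h0
    rw [uIcc_of_le (by linarith)] at hz
    refine ⟨z, ?_, hz0, hθp z hz⟩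
    have e1 : P z ^ 2 + Q z ^ 2 = X z ^ 2 + Y z ^ 2 := by
      simp only [hP, hQd]
      linear_combination (X z ^ 2 + Y z ^ 2) * Real.sin_sq_add_cos_sq (θ p)
    have e2 : P z * Real.sin (θ p - ν) = -(Q z * Real.cos (θ p - ν)) := by
      have := hNP z; rw [hz0] at this; linarith
    have e3 : (P z) ^ 2 * s ^ 2 ≤ d ^ 2 := by
      calc (P z) ^ 2 * s ^ 2 ≤ (P z) ^ 2 * |Real.sin (θ p - ν)| ^ 2 := by
            gcongr; exact hν p hp
        _ = |Q z * Real.cos (θ p - ν)| ^ 2 := by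
            rw [sq_abs, sq_abs, ← mul_pow, e2]; ring
        _ ≤ d ^ 2 := by gcongr; exact hQc z hz
    have e4 : P z ^ 2 ≤ 1 / 4 := by
      have : d ^ 2 ≤ (1 / 4) * s ^ 2 := by nlinarith
      have hs2 : 0 < s ^ 2 := by positivity
      by_contra hc
      push Not at hc
      nlinarith
    have e5 : Q z ^ 2 ≤ 1 / 4 := by
      rw [← sq_abs]
      have : |Q z| ≤ d := hQ z hz
      have := abs_nonneg (Q z)
      nlinarith
    linarith
  have hR1 : (1:ℝ) ≤ R ^ 2 := by nlinarith
  set Zs : Set ℝ := {u | X u ^ 2 + Y u ^ 2 < 1 ∧ N u = 0} with hZs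
  have hsep : ∀ z ∈ Zs, ∀ z' ∈ Zs, z < z' → ∃ s ∈ Ioo z z', R' ^ 2 ≤ X s ^ 2 + Y s ^ 2 := by
    intro z hz z' hz' hlt
    by_contra hno
    have h1 := hdich z z' (by linarith [hz.1]) (by linarith [hz'.1]) hlt hno
    obtain ⟨u, hu, hu0⟩ := exists_hasDerivAt_eq_zero hlt hNc.continuousOn
      (by rw [hz.2, hz'.2]) (fun x _ => hNd x)
    have h2 := hν z (by linarith [hz.1])
    have h3 : Real.sin (θ u - ν) = 0 := by
      rcases mul_eq_zero.mp hu0 with hvu | h'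
      · exact absurd hvu (h.hv u).ne'
      · exact h'
    have h4 := abs_sin_add_le' (θ u - ν) (-(θ u - θ z))
    rw [show θ u - ν + -(θ u - θ z) = θ z - ν by ring, h3, abs_zero, zero_add, Real.sin_neg, abs_neg] at h4
    have h5 := (Real.abs_sin_le_abs (x := θ u - θ z)).trans (h1 u ⟨hu.1.le, hu.2.le⟩)
    linarith
  have hfin : Zs.Finite := by
    by_contra hinf
    obtain ⟨t, ht, htc⟩ := (show Zs.Infinite from hinf).exists_subset_card_eq (m + 1)
    have := hcount t (fun z hz => by linarith [(ht hz).1]) (fun z hz z' hz' => hsep z (ht hz) z' (ht hz'))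
    omega
  have hLinj : InjOn L Zs := by
    intro z hz z' hz' hLL
    apply h.inj
    · have e : ∀ u, X u = L u * Real.cos ν - N u * Real.sin ν := by
        intro u; simp only [hN, hL]
        linear_combination -X u * Real.sin_sq_add_cos_sq ν
      rw [e z, e z', hLL, hz.2, hz'.2]
    · have e : ∀ u, Y u = L u * Real.sin ν + N u * Real.cos ν := by
        intro u; simp only [hN, hL]
        linear_combination -Y u * Real.sin_sq_add_cos_sq ν
      rw [e z, e z', hLL, hz.2, hz'.2]
  set S : Finset ℝ := hfin.toFinset.image L with hS
  have hScard : S.card ≤ m := by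
    refine Finset.card_image_le.trans (hcount _ ?_ ?_)
    · intro z hz
      have : z ∈ Zs := hfin.mem_toFinset.mp hz
      linarith [this.1]
    · intro z hz z' hz'
      exact hsep z (hfin.mem_toFinset.mp hz) z' (hfin.mem_toFinset.mp hz')
  have hchain := chain_lemma S (fun x => θ (Function.invFunOn L Zs x)) (2 * π) (by positivity) (by
    intro x hx y hy hxy hno
    obtain ⟨z, hz, rfl⟩ := Finset.mem_image.mp hx
    obtain ⟨z', hz', rfl⟩ := Finset.mem_image.mp hy
    rw [hfin.mem_toFinset] at hz hz'
    rw [hLinj.leftInvOn_invFunOn hz, hLinj.leftInvOn_invFunOn hz']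
    apply h.chord (by rintro rfl; exact lt_irrefl _ hxy)
    rintro t r hr ⟨h1, h2⟩
    have hNt : N t = 0 := by
      have a1 : N z = 0 := hz.2
      have a2 : N z' = 0 := hz'.2
      have : N t = N z + r * (N z' - N z) := by simp only [hN]; rw [h1, h2]; ring
      rw [this, a1, a2]; ring
    have hLt : L t = L z + r * (L z' - L z) := by simp only [hL]; rw [h1, h2]; ring
    have hrr : X t ^ 2 + Y t ^ 2 < 1 := by
      have a1 : X z ^ 2 + Y z ^ 2 < 1 := hz.1
      have a2 : X z' ^ 2 + Y z' ^ 2 < 1 := hz'.1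
      have : X t ^ 2 + Y t ^ 2 = (1 - r) * (X z ^ 2 + Y z ^ 2) + r * (X z' ^ 2 + Y z' ^ 2)
          - r * (1 - r) * ((X z' - X z) ^ 2 + (Y z' - Y z) ^ 2) := by rw [h1, h2]; ring
      rw [this]
      have := mul_nonneg (mul_nonneg hr.1.le (by linarith [hr.2] : 0 ≤ 1 - r))
        (by positivity : 0 ≤ (X z' - X z) ^ 2 + (Y z' - Y z) ^ 2)
      nlinarith [hr.1, hr.2]
    refine hno (L t) (Finset.mem_image.mpr ⟨t, hfin.mem_toFinset.mpr ⟨hrr, hNt⟩, rfl⟩) ⟨?_, ?_⟩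
    · rw [hLt]; nlinarith [hr.1]
    · rw [hLt]; nlinarith [hr.2])
  intro p q hp hq
  obtain ⟨z, hz1, hz2, hz3⟩ := hcross p hp
  obtain ⟨z', hz1', hz2', hz3'⟩ := hcross q hq
  have hz : z ∈ Zs := ⟨hz1, hz2⟩
  have hz' : z' ∈ Zs := ⟨hz1', hz2'⟩
  have := hchain (L z') (Finset.mem_image.mpr ⟨z', hfin.mem_toFinset.mpr hz', rfl⟩)
    (L z) (Finset.mem_image.mpr ⟨z, hfin.mem_toFinset.mpr hz, rfl⟩)
  rw [hLinj.leftInvOn_invFunOn hz, hLinj.leftInvOn_invFunOn hz'] at this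
  have hc : 2 * π * ((S.card:ℝ) - 1) ≤ (2 * (m:ℝ) - 2) * π := by
    have : (S.card:ℝ) ≤ m := by exact_mod_cast hScard
    nlinarith [Real.pi_pos]
  have e1 := abs_le.mp hz3
  have e2 := abs_le.mp hz3'
  have e3 := abs_le.mp this
  rw [abs_le]; constructor <;> linarith
end Part4

section Part5

/-- Coordinate form of an ancient proper embedded curve shortening flow with entropy bound. -/
structure FL (X Y θ v κ κs : ℝ → ℝ → ℝ) (m : ℕ) : Prop where
  Xu : ∀ u, ∀ t < 0, HasDerivAt (fun u => X u t) (v u t * Real.cos (θ u t)) u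
  Yu : ∀ u, ∀ t < 0, HasDerivAt (fun u => Y u t) (v u t * Real.sin (θ u t)) u
  θu : ∀ u, ∀ t < 0, HasDerivAt (fun u => θ u t) (v u t * κ u t) u
  κu : ∀ u, ∀ t < 0, HasDerivAt (fun u => κ u t) (v u t * κs u t) u
  Xt : ∀ u, ∀ t < 0, HasDerivAt (fun t => X u t) (-κ u t * Real.sin (θ u t)) t
  Yt : ∀ u, ∀ t < 0, HasDerivAt (fun t => Y u t) (κ u t * Real.cos (θ u t)) t
  vt : ∀ u, ∀ t < 0, HasDerivAt (fun t => v u t) (-κ u t ^ 2 * v u t) t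
  θt : ∀ u, ∀ t < 0, HasDerivAt (fun t => θ u t) (κs u t) t
  vpos : ∀ u, ∀ t < 0, 0 < v u t
  cX : ContinuousOn (fun p : ℝ × ℝ => X p.1 p.2) (univ ×ˢ Iio 0)
  cY : ContinuousOn (fun p : ℝ × ℝ => Y p.1 p.2) (univ ×ˢ Iio 0)
  cθ : ContinuousOn (fun p : ℝ × ℝ => θ p.1 p.2) (univ ×ˢ Iio 0)
  cv : ContinuousOn (fun p : ℝ × ℝ => v p.1 p.2) (univ ×ˢ Iio 0)
  cκ : ContinuousOn (fun p : ℝ × ℝ => κ p.1 p.2) (univ ×ˢ Iio 0)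
  cκs : ContinuousOn (fun p : ℝ × ℝ => κs p.1 p.2) (univ ×ˢ Iio 0)
  prop : ∀ t < 0, Tendsto (fun u => X u t ^ 2 + Y u t ^ 2) (cocompact ℝ) atTop
  inj : ∀ t < 0, ∀ u u', X u t = X u' t → Y u t = Y u' t → u = u'
  ent : ∀ t < 0, ∀ l > 0, ∫⁻ u, ENNReal.ofReal (Real.exp (-(X u t ^ 2 + Y u t ^ 2) / (4 * l)) * v u t) ≤
    ENNReal.ofReal (Real.sqrt (4 * π * l) * m)

/-- Cubic cutoff and its derivatives. -/
def pp (x : ℝ) : ℝ := max x 0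
lemma pp_nonneg (x : ℝ) : 0 ≤ pp x := le_max_right _ _
lemma pp_cont : Continuous pp := continuous_id.max continuous_const
lemma pp_of_nonpos {x : ℝ} (h : x ≤ 0) : pp x = 0 := max_eq_right h
lemma pp_of_nonneg {x : ℝ} (h : 0 ≤ x) : pp x = x := max_eq_left h
lemma le_pp (x : ℝ) : x ≤ pp x := le_max_left _ _

lemma hasDerivAt_pp_pow (k : ℕ) (x : ℝ) :
    HasDerivAt (fun x => pp x ^ (k + 2)) ((k + 2 : ℝ) * pp x ^ (k + 1)) x := by
  rcases lt_trichotomy x 0 with h | h | h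
  · rw [pp_of_nonpos h.le]
    simp only [ne_eq, Nat.add_eq_zero_iff, one_ne_zero, and_false, not_false_eq_true, zero_pow, mul_zero]
    refine (hasDerivAt_const x (0:ℝ)).congr_of_eventuallyEq ?_
    filter_upwards [Iio_mem_nhds h] with y hy
    rw [pp_of_nonpos (le_of_lt hy)]; simp
  · subst h
    rw [pp_of_nonpos le_rfl]
    have h1 : HasDerivWithinAt (fun x : ℝ => pp x ^ (k + 2)) ((k + 2 : ℝ) * 0 ^ (k + 1)) (Iic 0) 0 := by
      have : HasDerivWithinAt (fun _ : ℝ => (0:ℝ)) ((k + 2 : ℝ) * 0 ^ (k + 1)) (Iic 0) 0 := by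
        simpa using hasDerivWithinAt_const (0:ℝ) (Iic (0:ℝ)) (0:ℝ)
      refine this.congr (fun y hy => ?_) ?_
      · rw [pp_of_nonpos hy]; simp
      · rw [pp_of_nonpos le_rfl]; simp
    have h2 : HasDerivWithinAt (fun x : ℝ => pp x ^ (k + 2)) ((k + 2 : ℝ) * 0 ^ (k + 1)) (Ici 0) 0 := by
      have := (hasDerivAt_pow (k + 2) (0:ℝ)).hasDerivWithinAt (s := Ici 0)
      have h3 : HasDerivWithinAt (fun x : ℝ => x ^ (k + 2)) ((k + 2 : ℝ) * 0 ^ (k + 1)) (Ici 0) 0 := by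
        refine this.congr_deriv ?_
        simp
      refine h3.congr (fun y hy => ?_) ?_
      · rw [pp_of_nonneg hy]
      · rw [pp_of_nonneg le_rfl]
    have := h1.union h2
    rw [Iic_union_Ici] at this
    exact this.hasDerivAt univ_mem
  · rw [pp_of_nonneg h.le]
    have := hasDerivAt_pow (k + 2) x
    refine (this.congr_deriv (by push_cast; simp)).congr_of_eventuallyEq ?_
    filter_upwards [Ioi_mem_nhds h] with y hy
    rw [pp_of_nonneg (le_of_lt hy)]

def ps (r : ℝ) (y : ℝ) : ℝ := pp (1 - y / r) ^ 3
def ps1 (r : ℝ) (y : ℝ) : ℝ := -(3 / r * pp (1 - y / r) ^ 2)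
def ps2 (r : ℝ) (y : ℝ) : ℝ := 6 / r ^ 2 * pp (1 - y / r)

lemma ps_deriv (r y : ℝ) : HasDerivAt (ps r) (ps1 r y) y := by
  have h1 : HasDerivAt (fun y => 1 - y / r) (-(1 / r)) y := ((hasDerivAt_id y).div_const r).const_sub 1
  have := (hasDerivAt_pp_pow 1 (1 - y / r)).comp y h1
  refine this.congr_deriv ?_
  rw [ps1]; push_cast; ring

lemma ps1_deriv (r y : ℝ) : HasDerivAt (ps1 r) (ps2 r y) y := by
  have h1 : HasDerivAt (fun y => 1 - y / r) (-(1 / r)) y := ((hasDerivAt_id y).div_const r).const_sub 1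
  have := (((hasDerivAt_pp_pow 0 (1 - y / r)).comp y h1).const_mul (3 / r)).neg
  refine this.congr_deriv ?_
  rw [ps2]; push_cast; ring

lemma ps_cont (r : ℝ) : Continuous (ps r) := continuous_iff_continuousAt.mpr fun y => (ps_deriv r y).continuousAt
lemma ps1_cont (r : ℝ) : Continuous (ps1 r) := continuous_iff_continuousAt.mpr fun y => (ps1_deriv r y).continuousAt
lemma ps2_cont (r : ℝ) : Continuous (ps2 r) := by
  unfold ps2; exact continuous_const.mul (pp_cont.comp (by fun_prop))

/-- Log-form Gaussian kernel. -/
def Ph (X Y : ℝ → ℝ → ℝ) (u t : ℝ) : ℝ :=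
  Real.exp (-(X u t ^ 2 + Y u t ^ 2) / (4 * (1 - t)) - Real.log (1 - t) / 2)
def Ff (X Y : ℝ → ℝ → ℝ) (t₁ u t : ℝ) : ℝ := X u t ^ 2 + Y u t ^ 2 + 2 * (t - t₁)
def ww (X Y θ : ℝ → ℝ → ℝ) (u t : ℝ) : ℝ := -X u t * Real.sin (θ u t) + Y u t * Real.cos (θ u t)
def pt (X Y θ : ℝ → ℝ → ℝ) (u t : ℝ) : ℝ := X u t * Real.cos (θ u t) + Y u t * Real.sin (θ u t)

/-- time derivative of the localized density -/
def gg (X Y θ v κ κs : ℝ → ℝ → ℝ) (f f1 : ℝ → ℝ) (q q1 : ℝ → ℝ) (t₁ u t : ℝ) : ℝ :=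
  ((f1 (θ u t) * κs u t * q (Ff X Y t₁ u t) +
      f (θ u t) * q1 (Ff X Y t₁ u t) * (2 + 2 * κ u t * ww X Y θ u t)) +
    f (θ u t) * q (Ff X Y t₁ u t) * (1 / (2 * (1 - t)) - (X u t ^ 2 + Y u t ^ 2) / (4 * (1 - t) ^ 2)
      - κ u t * ww X Y θ u t / (2 * (1 - t))) -
    f (θ u t) * q (Ff X Y t₁ u t) * κ u t ^ 2) * Ph X Y u t * v u t

def GG (X Y θ κ : ℝ → ℝ → ℝ) (f f1 : ℝ → ℝ) (q q1 : ℝ → ℝ) (t₁ u t : ℝ) : ℝ :=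
  Ph X Y u t * (f1 (θ u t) * κ u t * q (Ff X Y t₁ u t) +
    2 * pt X Y θ u t * f (θ u t) * q1 (Ff X Y t₁ u t) +
    f (θ u t) * q (Ff X Y t₁ u t) * pt X Y θ u t / (2 * (1 - t)))

def SS (X Y θ v κ : ℝ → ℝ → ℝ) (f f1 f2 : ℝ → ℝ) (q q1 q2 : ℝ → ℝ) (t₁ u t : ℝ) : ℝ :=
  -((f2 (θ u t) * κ u t ^ 2 * q (Ff X Y t₁ u t) +
    4 * f (θ u t) * q2 (Ff X Y t₁ u t) * pt X Y θ u t ^ 2 +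
    4 * f1 (θ u t) * κ u t * q1 (Ff X Y t₁ u t) * pt X Y θ u t +
    f (θ u t) * q (Ff X Y t₁ u t) * (κ u t + ww X Y θ u t / (2 * (1 - t))) ^ 2) * Ph X Y u t * v u t)

section
variable {X Y θ v κ κs : ℝ → ℝ → ℝ} {m : ℕ}

lemma FL.Ph_t (h : FL X Y θ v κ κs m) (u t : ℝ) (ht : t < 0) :
    HasDerivAt (fun t => Ph X Y u t) (Ph X Y u t * (1 / (2 * (1 - t)) -
      (X u t ^ 2 + Y u t ^ 2) / (4 * (1 - t) ^ 2) - κ u t * ww X Y θ u t / (2 * (1 - t)))) t := by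
  have hl : (1 - t) ≠ 0 := by linarith
  have h1 : HasDerivAt (fun t : ℝ => 1 - t) (-1) t := (hasDerivAt_id t).const_sub 1
  have h2 := ((((h.Xt u t ht).pow 2).add ((h.Yt u t ht).pow 2)).neg.div (h1.const_mul 4)
    (by simpa using hl)).sub ((h1.log hl).div_const 2)
  refine h2.exp.congr_deriv ?_
  simp only [Ph, ww, Pi.pow_apply, Pi.add_apply, Pi.neg_apply, Pi.sub_apply, Pi.div_apply]
  congr 1
  field_simp
  ring

lemma FL.Ph_u (h : FL X Y θ v κ κs m) (u t : ℝ) (ht : t < 0) :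
    HasDerivAt (fun u => Ph X Y u t) (Ph X Y u t * (-(v u t * pt X Y θ u t) / (2 * (1 - t)))) u := by
  have hl : (1 - t) ≠ 0 := by linarith
  have h2 := ((((h.Xu u t ht).pow 2).add ((h.Yu u t ht).pow 2)).neg.div_const (4 * (1 - t))).sub_const
    (Real.log (1 - t) / 2)
  refine h2.exp.congr_deriv ?_
  simp only [Ph, pt, Pi.pow_apply, Pi.add_apply, Pi.neg_apply]
  congr 1
  field_simp
  ring

lemma FL.Ff_t (h : FL X Y θ v κ κs m) (t₁ u t : ℝ) (ht : t < 0) :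
    HasDerivAt (fun t => Ff X Y t₁ u t) (2 + 2 * κ u t * ww X Y θ u t) t := by
  have h2 := (((h.Xt u t ht).pow 2).add ((h.Yt u t ht).pow 2)).add
    (((hasDerivAt_id t).sub_const t₁).const_mul 2)
  refine h2.congr_deriv ?_
  simp only [ww]
  push_cast
  ring

lemma FL.Ff_u (h : FL X Y θ v κ κs m) (t₁ u t : ℝ) (ht : t < 0) :
    HasDerivAt (fun u => Ff X Y t₁ u t) (2 * v u t * pt X Y θ u t) u := by
  have h2 := (((h.Xu u t ht).pow 2).add ((h.Yu u t ht).pow 2)).add_const (2 * (t - t₁))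
  refine h2.congr_deriv ?_
  simp only [pt]
  push_cast
  ring

lemma FL.pt_u (h : FL X Y θ v κ κs m) (u t : ℝ) (ht : t < 0) :
    HasDerivAt (fun u => pt X Y θ u t) (v u t * (1 + κ u t * ww X Y θ u t)) u := by
  have h2 := ((h.Xu u t ht).mul (h.θu u t ht).cos).add ((h.Yu u t ht).mul (h.θu u t ht).sin)
  refine h2.congr_deriv ?_
  simp only [ww]
  linear_combination v u t * Real.sin_sq_add_cos_sq (θ u t)

lemma FL.e_t (h : FL X Y θ v κ κs m) {f f1 q q1 : ℝ → ℝ} (hf : ∀ x, HasDerivAt f (f1 x) x)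
    (hq : ∀ x, HasDerivAt q (q1 x) x) (t₁ u t : ℝ) (ht : t < 0) :
    HasDerivAt (fun t => f (θ u t) * q (Ff X Y t₁ u t) * Ph X Y u t * v u t)
      (gg X Y θ v κ κs f f1 q q1 t₁ u t) t := by
  have h1 := (hf (θ u t)).comp t (h.θt u t ht)
  have h2 := (hq (Ff X Y t₁ u t)).comp t (h.Ff_t t₁ u t ht)
  have h3 := ((h1.mul h2).mul (h.Ph_t u t ht)).mul (h.vt u t ht)
  refine h3.congr_deriv ?_
  simp only [gg, Function.comp, Pi.mul_apply]
  ring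

lemma FL.GG_u (h : FL X Y θ v κ κs m) {f f1 f2 q q1 q2 : ℝ → ℝ} (hf : ∀ x, HasDerivAt f (f1 x) x)
    (hf1 : ∀ x, HasDerivAt f1 (f2 x) x)
    (hq : ∀ x, HasDerivAt q (q1 x) x) (hq1 : ∀ x, HasDerivAt q1 (q2 x) x) (t₁ u t : ℝ) (ht : t < 0) :
    HasDerivAt (fun u => GG X Y θ κ f f1 q q1 t₁ u t)
      (gg X Y θ v κ κs f f1 q q1 t₁ u t - SS X Y θ v κ f f1 f2 q q1 q2 t₁ u t) u := by
  have hl : (1 - t) ≠ 0 := by linarith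
  have a1 := (hf (θ u t)).comp u (h.θu u t ht)
  have a2 := (hf1 (θ u t)).comp u (h.θu u t ht)
  have b1 := (hq (Ff X Y t₁ u t)).comp u (h.Ff_u t₁ u t ht)
  have b2 := (hq1 (Ff X Y t₁ u t)).comp u (h.Ff_u t₁ u t ht)
  have c := h.pt_u u t ht
  have h3 := (h.Ph_u u t ht).mul ((((a2.mul (h.κu u t ht)).mul b1).add (((c.const_mul 2).mul a1).mul b2)).add
    (((a1.mul b1).mul c).div_const (2 * (1 - t))))
  refine h3.congr_deriv ?_
  have hpw : X u t ^ 2 + Y u t ^ 2 = pt X Y θ u t ^ 2 + ww X Y θ u t ^ 2 := by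
    simp only [pt, ww]
    linear_combination -(X u t ^ 2 + Y u t ^ 2) * Real.sin_sq_add_cos_sq (θ u t)
  simp only [gg, SS, Function.comp, Pi.mul_apply, Pi.add_apply]
  rw [hpw]
  field_simp
  ring
end

end Part5

section Part6

lemma fub (U : Set ℝ) (hU : MeasurableSet U) (a b : ℝ) (hab : a ≤ b) (e g B : ℝ → ℝ → ℝ)
    (he : ∀ u ∈ U, ∀ τ ∈ Icc a b, HasDerivAt (e u) (g u τ) τ)
    (hgc : ContinuousOn (fun p : ℝ × ℝ => g p.1 p.2) (univ ×ˢ Icc a b))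
    (he0 : ∀ u ∈ U, ∀ τ ∈ Icc a b, 0 ≤ e u τ)
    (hea : IntegrableOn (fun u => e u a) U)
    (hB : ∀ u ∈ U, ∀ τ ∈ Icc a b, g u τ ≤ B u τ) (hB0 : ∀ u ∈ U, ∀ τ ∈ Icc a b, 0 ≤ B u τ)
    (hBi : Integrable (fun p : ℝ × ℝ => B p.1 p.2) ((volume.restrict U).prod (volume.restrict (Ioc a b)))) :
    Integrable (fun p : ℝ × ℝ => g p.1 p.2) ((volume.restrict U).prod (volume.restrict (Ioc a b))) ∧
    IntegrableOn (fun u => e u b) U ∧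
    ∫ u in U, e u b = (∫ u in U, e u a) + ∫ τ in Ioc a b, ∫ u in U, g u τ := by
  have hgm : AEStronglyMeasurable (fun p : ℝ × ℝ => g p.1 p.2)
      ((volume.restrict U).prod (volume.restrict (Ioc a b))) := by
    rw [Measure.prod_restrict]
    exact (hgc.mono (prod_mono (subset_univ _) Ioc_subset_Icc_self)).aestronglyMeasurable
      (hU.prod measurableSet_Ioc)
  have hgi : ∀ u, IntervalIntegrable (g u) volume a b := by
    intro u
    apply ContinuousOn.intervalIntegrable
    rw [uIcc_of_le hab]
    exact hgc.comp (by fun_prop : ContinuousOn (fun τ : ℝ => (u, τ)) (Icc a b)) (fun τ hτ => ⟨mem_univ _, hτ⟩)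
  have hgi' : ∀ u, Integrable (g u) (volume.restrict (Ioc a b)) := fun u => (hgi u).1
  have hftc : ∀ u ∈ U, ∫ τ in Ioc a b, g u τ = e u b - e u a := by
    intro u hu
    rw [← intervalIntegral.integral_of_le hab]
    apply intervalIntegral.integral_eq_sub_of_hasDerivAt _ (hgi u)
    rw [uIcc_of_le hab]; exact he u hu
  have hmemb : b ∈ Icc a b := ⟨hab, le_rfl⟩
  have hmema : a ∈ Icc a b := ⟨le_rfl, hab⟩
  set k : ℝ × ℝ → ℝ := fun p => 2 * B p.1 p.2 - g p.1 p.2 with hk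
  have hkm : AEStronglyMeasurable k ((volume.restrict U).prod (volume.restrict (Ioc a b))) :=
    (hBi.1.const_mul 2).sub hgm
  have hBs := hBi.prod_right_ae
  have hB2 := hBi.integral_prod_left
  have hki : Integrable k ((volume.restrict U).prod (volume.restrict (Ioc a b))) := by
    rw [integrable_prod_iff hkm]
    constructor
    · filter_upwards [hBs] with u hu
      exact (hu.const_mul 2).sub (hgi' u)
    · have hd : Integrable (fun u => 2 * (∫ τ in Ioc a b, B u τ) + e u a) (volume.restrict U) :=
        (hB2.const_mul 2).add hea
      refine hd.mono' hkm.norm.integral_prod_right' ?_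
      filter_upwards [hBs, ae_restrict_mem hU] with u hu huU
      have h1 : ∫ τ in Ioc a b, ‖k (u, τ)‖ = ∫ τ in Ioc a b, (2 * B u τ - g u τ) := by
        apply setIntegral_congr_fun measurableSet_Ioc
        intro τ hτ
        simp only [hk]
        have hτ' := Ioc_subset_Icc_self hτ
        rw [Real.norm_eq_abs, abs_of_nonneg]
        linarith [hB u huU τ hτ', hB0 u huU τ hτ']
      rw [Real.norm_eq_abs, abs_of_nonneg (integral_nonneg fun τ => norm_nonneg _), h1,
        integral_sub (hu.const_mul 2) (hgi' u), integral_const_mul, hftc u huU]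
      linarith [he0 u huU b hmemb]
  have hgI : Integrable (fun p : ℝ × ℝ => g p.1 p.2) ((volume.restrict U).prod (volume.restrict (Ioc a b))) := by
    have := (hBi.const_mul 2).sub hki
    refine this.congr (Eventually.of_forall fun p => ?_)
    simp [hk]
  have hgl := hgI.integral_prod_left
  have heq : ∀ᵐ u ∂(volume.restrict U), e u a + ∫ τ in Ioc a b, g u τ = e u b := by
    filter_upwards [ae_restrict_mem hU] with u hu
    rw [hftc u hu]; ring
  refine ⟨hgI, (hea.add hgl).congr heq, ?_⟩
  rw [← integral_congr_ae heq, integral_add hea hgl]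
  congr 1
  exact integral_integral_swap hgI

section
variable {X Y θ v κ κs : ℝ → ℝ → ℝ} {m : ℕ}

lemma FL.cPh (h : FL X Y θ v κ κs m) :
    ContinuousOn (fun p : ℝ × ℝ => Ph X Y p.1 p.2) (univ ×ˢ Iio 0) := by
  unfold Ph
  have := h.cX
  have := h.cY
  refine ContinuousOn.rexp (ContinuousOn.sub (ContinuousOn.div ?_ ?_ ?_) (ContinuousOn.div_const (ContinuousOn.log ?_ ?_) _))
  · fun_prop
  · fun_prop
  · rintro ⟨u, t⟩ ⟨-, ht⟩
    have : t < 0 := ht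
    simp only; linarith
  · fun_prop
  · rintro ⟨u, t⟩ ⟨-, ht⟩
    have : t < 0 := ht
    simp only; linarith

lemma FL.cFf (h : FL X Y θ v κ κs m) (t₁ : ℝ) :
    ContinuousOn (fun p : ℝ × ℝ => Ff X Y t₁ p.1 p.2) (univ ×ˢ Iio 0) := by
  unfold Ff
  have := h.cX
  have := h.cY
  fun_prop

lemma FL.cww (h : FL X Y θ v κ κs m) :
    ContinuousOn (fun p : ℝ × ℝ => ww X Y θ p.1 p.2) (univ ×ˢ Iio 0) := by
  unfold ww
  have := h.cX
  have := h.cY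
  have := h.cθ
  fun_prop

lemma FL.cpt (h : FL X Y θ v κ κs m) :
    ContinuousOn (fun p : ℝ × ℝ => pt X Y θ p.1 p.2) (univ ×ˢ Iio 0) := by
  unfold pt
  have := h.cX
  have := h.cY
  have := h.cθ
  fun_prop

lemma cinv1 : ContinuousOn (fun p : ℝ × ℝ => 1 / (2 * (1 - p.2))) (univ ×ˢ Iio 0) := by
  refine ContinuousOn.div (by fun_prop) (by fun_prop) ?_
  rintro ⟨u, t⟩ ⟨-, ht⟩
  have : t < 0 := ht
  simp only; linarith

lemma FL.cgg (h : FL X Y θ v κ κs m) {f f1 q q1 : ℝ → ℝ} (hf : Continuous f) (hf1 : Continuous f1)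
    (hq : Continuous q) (hq1 : Continuous q1) (t₁ : ℝ) :
    ContinuousOn (fun p : ℝ × ℝ => gg X Y θ v κ κs f f1 q q1 t₁ p.1 p.2) (univ ×ˢ Iio 0) := by
  have a1 := h.cX
  have a2 := h.cY
  have a3 := h.cθ
  have a4 := h.cv
  have a5 := h.cκ
  have a6 := h.cκs
  have a7 := h.cPh
  have a8 := h.cFf t₁
  have a9 := h.cww
  have i1 := cinv1
  have f1' := hf.comp_continuousOn a3
  have f2' := hf1.comp_continuousOn a3
  have q1' := hq.comp_continuousOn a8
  have q2' := hq1.comp_continuousOn a8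
  simp only [Function.comp_def] at f1' f2' q1' q2'
  have : (fun p : ℝ × ℝ => gg X Y θ v κ κs f f1 q q1 t₁ p.1 p.2) = fun p : ℝ × ℝ =>
    ((f1 (θ p.1 p.2) * κs p.1 p.2 * q (Ff X Y t₁ p.1 p.2) +
      f (θ p.1 p.2) * q1 (Ff X Y t₁ p.1 p.2) * (2 + 2 * κ p.1 p.2 * ww X Y θ p.1 p.2)) +
    f (θ p.1 p.2) * q (Ff X Y t₁ p.1 p.2) * (1 / (2 * (1 - p.2)) - (X p.1 p.2 ^ 2 + Y p.1 p.2 ^ 2) * (1 / (2 * (1 - p.2))) ^ 2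
      - κ p.1 p.2 * ww X Y θ p.1 p.2 * (1 / (2 * (1 - p.2)))) -
    f (θ p.1 p.2) * q (Ff X Y t₁ p.1 p.2) * κ p.1 p.2 ^ 2) * Ph X Y p.1 p.2 * v p.1 p.2 := by
    ext p
    simp only [gg]
    rw [show (1 / (2 * (1 - p.2))) ^ 2 = 1 / (4 * (1 - p.2) ^ 2) by rw [div_pow]; ring_nf]
    ring
  rw [this]
  fun_prop

lemma FL.cSS (h : FL X Y θ v κ κs m) {f f1 f2 q q1 q2 : ℝ → ℝ} (hf : Continuous f) (hf1 : Continuous f1)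
    (hf2 : Continuous f2) (hq : Continuous q) (hq1 : Continuous q1) (hq2 : Continuous q2) (t₁ : ℝ) :
    ContinuousOn (fun p : ℝ × ℝ => SS X Y θ v κ f f1 f2 q q1 q2 t₁ p.1 p.2) (univ ×ˢ Iio 0) := by
  have a3 := h.cθ
  have a4 := h.cv
  have a5 := h.cκ
  have a7 := h.cPh
  have a8 := h.cFf t₁
  have a9 := h.cww
  have a10 := h.cpt
  have i1 := cinv1
  have f1' := hf.comp_continuousOn a3
  have f2' := hf1.comp_continuousOn a3
  have f3' := hf2.comp_continuousOn a3
  have q1' := hq.comp_continuousOn a8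
  have q2' := hq1.comp_continuousOn a8
  have q3' := hq2.comp_continuousOn a8
  simp only [Function.comp_def] at f1' f2' f3' q1' q2' q3'
  have : (fun p : ℝ × ℝ => SS X Y θ v κ f f1 f2 q q1 q2 t₁ p.1 p.2) = fun p : ℝ × ℝ =>
  -((f2 (θ p.1 p.2) * κ p.1 p.2 ^ 2 * q (Ff X Y t₁ p.1 p.2) +
    4 * f (θ p.1 p.2) * q2 (Ff X Y t₁ p.1 p.2) * pt X Y θ p.1 p.2 ^ 2 +
    4 * f1 (θ p.1 p.2) * κ p.1 p.2 * q1 (Ff X Y t₁ p.1 p.2) * pt X Y θ p.1 p.2 +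
    f (θ p.1 p.2) * q (Ff X Y t₁ p.1 p.2) * (κ p.1 p.2 + ww X Y θ p.1 p.2 * (1 / (2 * (1 - p.2)))) ^ 2) * Ph X Y p.1 p.2 * v p.1 p.2) := by
    ext p
    simp only [SS]
    ring
  rw [this]
  fun_prop

/-- restriction of a jointly continuous function to a time slice -/
lemma slice_cont {F : ℝ → ℝ → ℝ} (hF : ContinuousOn (fun p : ℝ × ℝ => F p.1 p.2) (univ ×ˢ Iio 0))
    {t : ℝ} (ht : t < 0) : Continuous (fun u => F u t) := by
  rw [← continuousOn_univ]
  exact hF.comp (by fun_prop : ContinuousOn (fun u : ℝ => (u, t)) univ) (fun u _ => ⟨mem_univ _, ht⟩)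

lemma Ph_eq (X Y : ℝ → ℝ → ℝ) (u : ℝ) {t : ℝ} (ht : t < 0) :
    Ph X Y u t = (Real.sqrt (1 - t))⁻¹ * Real.exp (-(X u t ^ 2 + Y u t ^ 2) / (4 * (1 - t))) := by
  unfold Ph
  have hl : 0 < 1 - t := by linarith
  rw [Real.exp_sub, div_eq_mul_inv, mul_comm, ← Real.log_sqrt hl.le, Real.exp_log (Real.sqrt_pos.mpr hl)]

lemma Ph_pos (X Y : ℝ → ℝ → ℝ) (u t : ℝ) : 0 < Ph X Y u t := Real.exp_pos _

lemma FL.ent1 (h : FL X Y θ v κ κs m) {t : ℝ} (ht : t < 0) :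
    Integrable (fun u => Ph X Y u t * v u t) ∧ ∫ u, Ph X Y u t * v u t ≤ Real.sqrt (4 * π) * m := by
  have hl : 0 < 1 - t := by linarith
  have hs : 0 < Real.sqrt (1 - t) := Real.sqrt_pos.mpr hl
  have cX := slice_cont h.cX ht
  have cY := slice_cont h.cY ht
  have cv := slice_cont h.cv ht
  obtain ⟨i, I⟩ := integrable_of_lintegral_le (by fun_prop)
    (fun u => mul_nonneg (Real.exp_pos _).le (h.vpos u t ht).le) (by positivity) (h.ent t ht (1 - t) hl)
  have e : (fun u => Ph X Y u t * v u t) = fun u => (Real.sqrt (1 - t))⁻¹ *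
      (Real.exp (-(X u t ^ 2 + Y u t ^ 2) / (4 * (1 - t))) * v u t) := by
    ext u; rw [Ph_eq X Y u ht]; ring
  rw [e]
  refine ⟨i.const_mul _, ?_⟩
  rw [integral_const_mul, inv_mul_le_iff₀ hs]
  refine I.trans (le_of_eq ?_)
  rw [Real.sqrt_mul (by positivity)]; ring

lemma FL.ent2 (h : FL X Y θ v κ κs m) {t : ℝ} (ht : t < 0) :
    Integrable (fun u => (X u t ^ 2 + Y u t ^ 2) / (1 - t) * (Ph X Y u t * v u t)) ∧
    ∫ u, (X u t ^ 2 + Y u t ^ 2) / (1 - t) * (Ph X Y u t * v u t) ≤ 8 * (Real.sqrt (8 * π) * m) := by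
  have hl : 0 < 1 - t := by linarith
  have hs : 0 < Real.sqrt (1 - t) := Real.sqrt_pos.mpr hl
  have cX := slice_cont h.cX ht
  have cY := slice_cont h.cY ht
  have cv := slice_cont h.cv ht
  have cP := slice_cont h.cPh ht
  obtain ⟨i, I⟩ := integrable_of_lintegral_le (by fun_prop)
    (fun u => mul_nonneg (Real.exp_pos _).le (h.vpos u t ht).le) (by positivity)
    (h.ent t ht (2 * (1 - t)) (by positivity))
  have hle : ∀ u, (X u t ^ 2 + Y u t ^ 2) / (1 - t) * (Ph X Y u t * v u t) ≤ 8 * (Real.sqrt (1 - t))⁻¹ *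
      (Real.exp (-(X u t ^ 2 + Y u t ^ 2) / (4 * (2 * (1 - t)))) * v u t) := by
    intro u
    rw [Ph_eq X Y u ht]
    have h1 := sq_mul_exp_le ((X u t ^ 2 + Y u t ^ 2) / (1 - t))
    rw [show -((X u t ^ 2 + Y u t ^ 2) / (1 - t)) / 4 = -(X u t ^ 2 + Y u t ^ 2) / (4 * (1 - t)) by field_simp,
      show -((X u t ^ 2 + Y u t ^ 2) / (1 - t)) / 8 = -(X u t ^ 2 + Y u t ^ 2) / (4 * (2 * (1 - t))) by
        field_simp; ring] at h1
    have hv := (h.vpos u t ht).le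
    calc _ = (Real.sqrt (1 - t))⁻¹ * ((X u t ^ 2 + Y u t ^ 2) / (1 - t) *
          Real.exp (-(X u t ^ 2 + Y u t ^ 2) / (4 * (1 - t)))) * v u t := by ring
      _ ≤ (Real.sqrt (1 - t))⁻¹ * (8 * Real.exp (-(X u t ^ 2 + Y u t ^ 2) / (4 * (2 * (1 - t))))) * v u t := by
        gcongr
      _ = _ := by ring
  have hnn : ∀ u, 0 ≤ (X u t ^ 2 + Y u t ^ 2) / (1 - t) * (Ph X Y u t * v u t) := by
    intro u
    have := (h.vpos u t ht).le
    have := (Ph_pos X Y u t).le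
    positivity
  have hi : Integrable (fun u => (X u t ^ 2 + Y u t ^ 2) / (1 - t) * (Ph X Y u t * v u t)) := by
    refine (i.const_mul (8 * (Real.sqrt (1 - t))⁻¹)).mono' (by
      apply Continuous.aestronglyMeasurable; fun_prop) (Eventually.of_forall fun u => ?_)
    rw [Real.norm_eq_abs, abs_of_nonneg (hnn u)]; exact hle u
  refine ⟨hi, ?_⟩
  refine (integral_mono hi (i.const_mul _) hle).trans ?_
  rw [integral_const_mul, mul_assoc]
  refine mul_le_mul_of_nonneg_left ?_ (by norm_num)
  rw [inv_mul_le_iff₀ hs]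
  refine I.trans (le_of_eq ?_)
  rw [show 4 * π * (2 * (1 - t)) = (8 * π) * (1 - t) by ring, Real.sqrt_mul (by positivity)]; ring

lemma FL.ent_prod (h : FL X Y θ v κ κs m) (C : ℝ) (U : Set ℝ) (hU : MeasurableSet U) {a b : ℝ} (hb : b < 0) :
    Integrable (fun p : ℝ × ℝ => C * (Ph X Y p.1 p.2 * v p.1 p.2))
      ((volume.restrict U).prod (volume.restrict (Ioc a b))) := by
  apply Integrable.const_mul
  have hm : AEStronglyMeasurable (fun p : ℝ × ℝ => Ph X Y p.1 p.2 * v p.1 p.2)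
      ((volume.restrict U).prod (volume.restrict (Ioc a b))) := by
    rw [Measure.prod_restrict]
    refine ((h.cPh.mul h.cv).mono (prod_mono (subset_univ _) ?_)).aestronglyMeasurable
      (hU.prod measurableSet_Ioc)
    intro t ht; exact lt_of_le_of_lt ht.2 hb
  rw [integrable_prod_iff' hm]
  constructor
  · filter_upwards [ae_restrict_mem measurableSet_Ioc] with t ht
    exact (h.ent1 (lt_of_le_of_lt ht.2 hb)).1.integrableOn
  · have hc : Integrable (fun _ : ℝ => Real.sqrt (4 * π) * m) (volume.restrict (Ioc a b)) := by
      rw [integrable_const_iff]; right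
      exact ⟨by simp⟩
    refine hc.mono' hm.norm.prod_swap.integral_prod_right' ?_
    filter_upwards [ae_restrict_mem measurableSet_Ioc] with t ht
    have ht0 := lt_of_le_of_lt ht.2 hb
    obtain ⟨i, I⟩ := h.ent1 ht0
    have hnn : ∀ u, 0 ≤ Ph X Y u t * v u t := fun u => mul_nonneg (Ph_pos _ _ _ _).le (h.vpos u t ht0).le
    rw [Real.norm_eq_abs, abs_of_nonneg (integral_nonneg fun u => norm_nonneg _)]
    calc ∫ u in U, ‖Ph X Y u t * v u t‖ ≤ ∫ u, ‖Ph X Y u t * v u t‖ :=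
          setIntegral_le_integral i.norm (Eventually.of_forall fun u => norm_nonneg _)
      _ = ∫ u, Ph X Y u t * v u t := by
          congr 1; ext u; rw [Real.norm_eq_abs, abs_of_nonneg (hnn u)]
      _ ≤ _ := I
end

end Part6

section Part7

section
variable {X Y θ v κ κs : ℝ → ℝ → ℝ} {m : ℕ}

lemma ps_zero {r y : ℝ} (hr : 0 < r) (h : r ≤ y) : ps r y = 0 ∧ ps1 r y = 0 ∧ ps2 r y = 0 := by
  have : pp (1 - y / r) = 0 := by
    apply pp_of_nonpos
    rw [sub_nonpos, le_div_iff₀ hr]; linarith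
  simp [ps, ps1, ps2, this]

lemma gg_zero {f f1 : ℝ → ℝ} {r t₁ u t : ℝ} (hr : 0 < r) (h : r ≤ Ff X Y t₁ u t) :
    gg X Y θ v κ κs f f1 (ps r) (ps1 r) t₁ u t = 0 := by
  obtain ⟨a, b, c⟩ := ps_zero hr h
  simp [gg, a, b]

lemma SS_zero {f f1 f2 : ℝ → ℝ} {r t₁ u t : ℝ} (hr : 0 < r) (h : r ≤ Ff X Y t₁ u t) :
    SS X Y θ v κ f f1 f2 (ps r) (ps1 r) (ps2 r) t₁ u t = 0 := by
  obtain ⟨a, b, c⟩ := ps_zero hr h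
  simp [SS, a, b, c]

lemma GG_zero {f f1 : ℝ → ℝ} {r t₁ u t : ℝ} (hr : 0 < r) (h : r ≤ Ff X Y t₁ u t) :
    GG X Y θ κ f f1 (ps r) (ps1 r) t₁ u t = 0 := by
  obtain ⟨a, b, c⟩ := ps_zero hr h
  simp [GG, a, b]

/-- properness in terms of the cutoff function -/
lemma FL.exN (h : FL X Y θ v κ κs m) (t₁ r : ℝ) {t : ℝ} (ht : t < 0) :
    ∃ N : ℝ, 0 < N ∧ ∀ u, N ≤ |u| → r < Ff X Y t₁ u t := by
  have h1 := (h.prop t ht).eventually (eventually_gt_atTop (r - 2 * (t - t₁)))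
  rw [Metric.cobounded_eq_cocompact.symm] at h1
  rw [← comap_norm_atTop, eventually_comap] at h1
  obtain ⟨N, hN⟩ := eventually_atTop.mp h1
  refine ⟨max N 1, by positivity, fun u hu => ?_⟩
  have := hN |u| (le_trans (le_max_left _ _) hu) u rfl
  simp only [Ff]; linarith

/-- integration by parts on a time slice -/
lemma FL.slice_ibp (h : FL X Y θ v κ κs m) {f f1 f2 : ℝ → ℝ} (hf : ∀ x, HasDerivAt f (f1 x) x)
    (hf1 : ∀ x, HasDerivAt f1 (f2 x) x) (hf2 : Continuous f2) {r : ℝ} (hr : 0 < r) (t₁ : ℝ) {t : ℝ} (ht : t < 0)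
    (U : Set ℝ) (hU : MeasurableSet U) {a b : ℝ} (hab : a ≤ b) (hs : Ioc a b ⊆ U)
    (ha : r ≤ Ff X Y t₁ a t) (hb : r ≤ Ff X Y t₁ b t) (ho : ∀ u ∈ U, u ∉ Ioc a b → r ≤ Ff X Y t₁ u t) :
    ∫ u in U, gg X Y θ v κ κs f f1 (ps r) (ps1 r) t₁ u t =
      ∫ u in U, SS X Y θ v κ f f1 f2 (ps r) (ps1 r) (ps2 r) t₁ u t ∧
    IntegrableOn (fun u => SS X Y θ v κ f f1 f2 (ps r) (ps1 r) (ps2 r) t₁ u t) U := by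
  have cf : Continuous f := continuous_iff_continuousAt.mpr fun y => (hf y).continuousAt
  have cf1 : Continuous f1 := continuous_iff_continuousAt.mpr fun y => (hf1 y).continuousAt
  have cg := slice_cont (h.cgg cf cf1 (ps_cont r) (ps1_cont r) t₁) ht
  have cS := slice_cont (h.cSS cf cf1 hf2 (ps_cont r) (ps1_cont r) (ps2_cont r) t₁) ht
  constructor
  · rw [setIntegral_eq_of_subset_of_forall_sdiff_eq_zero
      (f := fun u => gg X Y θ v κ κs f f1 (ps r) (ps1 r) t₁ u t) hU hs
      (fun u hu => gg_zero hr (ho u hu.1 hu.2)),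
      setIntegral_eq_of_subset_of_forall_sdiff_eq_zero
      (f := fun u => SS X Y θ v κ f f1 f2 (ps r) (ps1 r) (ps2 r) t₁ u t) hU hs
      (fun u hu => SS_zero hr (ho u hu.1 hu.2)),
      ← intervalIntegral.integral_of_le hab, ← intervalIntegral.integral_of_le hab, ← sub_eq_zero,
      ← intervalIntegral.integral_sub (cg.intervalIntegrable _ _) (cS.intervalIntegrable _ _),
      intervalIntegral.integral_eq_sub_of_hasDerivAt
        (fun u _ => h.GG_u hf hf1 (ps_deriv r) (ps1_deriv r) t₁ u t ht)
        ((cg.sub cS).intervalIntegrable _ _), GG_zero hr ha, GG_zero hr hb, sub_zero]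
  · have h1 : IntegrableOn (fun u => SS X Y θ v κ f f1 f2 (ps r) (ps1 r) (ps2 r) t₁ u t) (Ioc a b) :=
      (cS.integrableOn_Icc).mono_set Ioc_subset_Icc_self
    refine IntegrableOn.of_forall_sdiff_eq_zero h1 hU (fun u hu => SS_zero hr (ho u hu.1 hu.2))

lemma ww_sq_le (X Y θ : ℝ → ℝ → ℝ) (u t : ℝ) :
    ww X Y θ u t ^ 2 + pt X Y θ u t ^ 2 = X u t ^ 2 + Y u t ^ 2 := by
  simp only [pt, ww]
  linear_combination (X u t ^ 2 + Y u t ^ 2) * Real.sin_sq_add_cos_sq (θ u t)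

lemma gg1_alg (P k w r l r2 : ℝ) (hP0 : 0 ≤ P) (hP1 : P ≤ 1) (hr : 0 < r) (hl : 1 ≤ l) (hw : w ^ 2 ≤ r)
    (h2 : 0 ≤ r2) :
    (-(3 / r * P ^ 2)) * (2 + 2 * k * w) + P ^ 3 * (1 / (2 * l) - r2 / (4 * l ^ 2) - k * w / (2 * l)) - P ^ 3 * k ^ 2
    ≤ 18 / r + 1 / 2 + r / 8 := by
  have hP3 : P ^ 3 ≤ 1 := pow_le_one₀ hP0 hP1
  have hP30 : 0 ≤ P ^ 3 := by positivity
  have e1 : (-(3 / r * P ^ 2)) * (2 * k * w) ≤ P ^ 3 * k ^ 2 / 2 + 18 / r := by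
    have h1 : 0 ≤ P * (P * k + 6 / r * w) ^ 2 / 2 := by positivity
    have h3 : P * (6 / r) ^ 2 * w ^ 2 / 2 ≤ 18 / r := by
      calc P * (6 / r) ^ 2 * w ^ 2 / 2 ≤ 1 * (6 / r) ^ 2 * r / 2 := by gcongr
        _ = 18 / r := by field_simp; norm_num
    have h4 : P * (P * k + 6 / r * w) ^ 2 / 2 =
      P ^ 3 * k ^ 2 / 2 - (-(3 / r * P ^ 2)) * (2 * k * w) + P * (6 / r) ^ 2 * w ^ 2 / 2 := by ring
    linarith
  have e2 : P ^ 3 * (1 / (2 * l)) ≤ 1 / 2 := by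
    have : 1 / (2 * l) ≤ 1 / 2 := by
      apply one_div_le_one_div_of_le <;> linarith
    calc P ^ 3 * (1 / (2 * l)) ≤ 1 * (1 / 2) := by gcongr
      _ = _ := by ring
  have e3 : - (P ^ 3 * (k * w / (2 * l))) ≤ P ^ 3 * k ^ 2 / 2 + r / 8 := by
    have h1 : 0 ≤ P ^ 3 * (k + w / (2 * l)) ^ 2 / 2 := by positivity
    have h3 : P ^ 3 * (w / (2 * l)) ^ 2 / 2 ≤ r / 8 := by
      have : (w / (2 * l)) ^ 2 ≤ r / 4 := by
        rw [div_pow, div_le_div_iff₀ (by positivity) (by positivity)]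
        have : 1 ≤ l ^ 2 := one_le_pow₀ hl
        nlinarith [mul_le_mul_of_nonneg_left this hr.le]
      calc P ^ 3 * (w / (2 * l)) ^ 2 / 2 ≤ 1 * (r / 4) / 2 := by gcongr
        _ = _ := by ring
    have h4 : P ^ 3 * (k + w / (2 * l)) ^ 2 / 2 = P ^ 3 * k ^ 2 / 2 + P ^ 3 * (k * w / (2 * l)) + P ^ 3 * (w / (2 * l)) ^ 2 / 2 := by
      field_simp; ring
    linarith
  have e4 : 0 ≤ P ^ 3 * (r2 / (4 * l ^ 2)) := by positivity
  have e5 : 0 ≤ 3 / r * P ^ 2 * 2 := by positivity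
  nlinarith

lemma pp_le_one {x : ℝ} (h : x ≤ 1) : pp x ≤ 1 := max_le h zero_le_one

lemma Ff_nonneg (X Y : ℝ → ℝ → ℝ) (u : ℝ) {t₁ t : ℝ} (h : t₁ ≤ t) :
    X u t ^ 2 + Y u t ^ 2 ≤ Ff X Y t₁ u t := by simp only [Ff]; linarith

lemma FL.gg1_le (h : FL X Y θ v κ κs m) {r t₁ : ℝ} (hr : 0 < r) (u : ℝ) {t : ℝ} (ht : t < 0) (h1 : t₁ ≤ t) :
    gg X Y θ v κ κs (fun _ => 1) (fun _ => 0) (ps r) (ps1 r) t₁ u t ≤ (18 / r + 1 / 2 + r / 8) * (Ph X Y u t * v u t) := by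
  have hpv : 0 ≤ Ph X Y u t * v u t := mul_nonneg (Ph_pos _ _ _ _).le (h.vpos u t ht).le
  have hF := Ff_nonneg X Y u h1
  by_cases hc : r ≤ Ff X Y t₁ u t
  · rw [gg_zero hr hc]; positivity
  · push Not at hc
    have hF0 : 0 ≤ Ff X Y t₁ u t := le_trans (by positivity) hF
    have hw : ww X Y θ u t ^ 2 ≤ r := by nlinarith [ww_sq_le X Y θ u t, sq_nonneg (pt X Y θ u t)]
    have := gg1_alg (pp (1 - Ff X Y t₁ u t / r)) (κ u t) (ww X Y θ u t) r (1 - t) (X u t ^ 2 + Y u t ^ 2)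
      (pp_nonneg _) (pp_le_one (by have : 0 ≤ Ff X Y t₁ u t / r := by positivity
                                   linarith)) hr (by linarith) hw (by positivity)
    have := mul_le_mul_of_nonneg_right this hpv
    refine le_trans (le_of_eq ?_) this
    simp only [gg, ps, ps1]; ring

lemma ps_nonneg (r y : ℝ) : 0 ≤ ps r y := pow_nonneg (pp_nonneg _) 3

lemma ps_le_one {r y : ℝ} (hr : 0 < r) (hy : 0 ≤ y) : ps r y ≤ 1 :=
  pow_le_one₀ (pp_nonneg _) (pp_le_one (by have : 0 ≤ y / r := by positivity
                                           linarith))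

lemma FL.e1_int (h : FL X Y θ v κ κs m) {r t₁ : ℝ} (hr : 0 < r) {t : ℝ} (ht : t < 0) (h1 : t₁ ≤ t) :
    Integrable (fun u => (1:ℝ) * ps r (Ff X Y t₁ u t) * Ph X Y u t * v u t) ∧
    ∫ u, (1:ℝ) * ps r (Ff X Y t₁ u t) * Ph X Y u t * v u t ≤ Real.sqrt (4 * π) * m := by
  obtain ⟨i, I⟩ := h.ent1 ht
  have hle : ∀ u, (1:ℝ) * ps r (Ff X Y t₁ u t) * Ph X Y u t * v u t ≤ Ph X Y u t * v u t := by
    intro u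
    have hpv : 0 ≤ Ph X Y u t * v u t := mul_nonneg (Ph_pos _ _ _ _).le (h.vpos u t ht).le
    have h1 := ps_le_one hr (le_trans (by positivity) (Ff_nonneg X Y u h1))
    nlinarith
  have hnn : ∀ u, 0 ≤ (1:ℝ) * ps r (Ff X Y t₁ u t) * Ph X Y u t * v u t := by
    intro u
    have := ps_nonneg r (Ff X Y t₁ u t)
    have := (Ph_pos X Y u t).le
    have := (h.vpos u t ht).le
    positivity
  have c1 := slice_cont h.cPh ht
  have c2 := slice_cont h.cv ht
  have c3 := (ps_cont r).comp (slice_cont (h.cFf t₁) ht)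
  simp only [Function.comp_def] at c3
  have hi : Integrable (fun u => (1:ℝ) * ps r (Ff X Y t₁ u t) * Ph X Y u t * v u t) := by
    refine i.mono' (by apply Continuous.aestronglyMeasurable; fun_prop) (Eventually.of_forall fun u => ?_)
    rw [Real.norm_eq_abs, abs_of_nonneg (hnn u)]; exact hle u
  exact ⟨hi, (integral_mono hi i hle).trans I⟩

lemma FL.fub1 (h : FL X Y θ v κ κs m) {r t₁ : ℝ} (hr : 0 < r) (U : Set ℝ) (hU : MeasurableSet U)
    {a b : ℝ} (hab : a ≤ b) (hb : b < 0) (h1 : t₁ ≤ a) :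
    Integrable (fun p : ℝ × ℝ => gg X Y θ v κ κs (fun _ => 1) (fun _ => 0) (ps r) (ps1 r) t₁ p.1 p.2)
      ((volume.restrict U).prod (volume.restrict (Ioc a b))) ∧
    IntegrableOn (fun u => (1:ℝ) * ps r (Ff X Y t₁ u b) * Ph X Y u b * v u b) U ∧
    ∫ u in U, (1:ℝ) * ps r (Ff X Y t₁ u b) * Ph X Y u b * v u b =
      (∫ u in U, (1:ℝ) * ps r (Ff X Y t₁ u a) * Ph X Y u a * v u a) +
      ∫ τ in Ioc a b, ∫ u in U, gg X Y θ v κ κs (fun _ => 1) (fun _ => 0) (ps r) (ps1 r) t₁ u τ :=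
  fub U hU a b hab (fun u t => (1:ℝ) * ps r (Ff X Y t₁ u t) * Ph X Y u t * v u t)
    (fun u t => gg X Y θ v κ κs (fun _ => 1) (fun _ => 0) (ps r) (ps1 r) t₁ u t)
    (fun u t => (18 / r + 1 / 2 + r / 8) * (Ph X Y u t * v u t))
    (fun u _ τ hτ => h.e_t (f := fun _ => 1) (f1 := fun _ => 0) (fun x => hasDerivAt_const x _) (ps_deriv r) t₁ u τ
      (lt_of_le_of_lt hτ.2 hb))
    ((h.cgg (by fun_prop) (by fun_prop) (ps_cont r) (ps1_cont r) t₁).mono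
      (prod_mono subset_rfl fun τ hτ => lt_of_le_of_lt hτ.2 hb))
    (fun u _ τ hτ => mul_nonneg (mul_nonneg (mul_nonneg zero_le_one (ps_nonneg _ _)) (Ph_pos _ _ _ _).le)
      (h.vpos u τ (lt_of_le_of_lt hτ.2 hb)).le)
    ((h.e1_int hr (lt_of_le_of_lt hab hb) h1).1.integrableOn)
    (fun u _ τ hτ => h.gg1_le hr u (lt_of_le_of_lt hτ.2 hb) (h1.trans hτ.1))
    (fun u _ τ hτ => mul_nonneg (by positivity)
      (mul_nonneg (Ph_pos _ _ _ _).le (h.vpos u τ (lt_of_le_of_lt hτ.2 hb)).le))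
    (h.ent_prod _ U hU hb)

lemma SS1_le {r t₁ u t : ℝ} (hv : 0 < v u t) :
    SS X Y θ v κ (fun _ => 1) (fun _ => 0) (fun _ => 0) (ps r) (ps1 r) (ps2 r) t₁ u t ≤
    -(ps r (Ff X Y t₁ u t) * (κ u t + ww X Y θ u t / (2 * (1 - t))) ^ 2 * Ph X Y u t * v u t) := by
  have h1 : 0 ≤ ps2 r (Ff X Y t₁ u t) := by
    unfold ps2
    have := pp_nonneg (1 - Ff X Y t₁ u t / r)
    positivity
  have hpv : 0 ≤ 4 * ps2 r (Ff X Y t₁ u t) * pt X Y θ u t ^ 2 * (Ph X Y u t * v u t) := by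
    have := (Ph_pos X Y u t).le
    positivity
  simp only [SS]
  nlinarith

lemma FL.A2a (h : FL X Y θ v κ κs m) {r a b : ℝ} (hr : 0 < r) (hab : a ≤ b) (hb : b < 0) :
    ∫⁻ τ in Ioc a b, ∫⁻ u, ENNReal.ofReal
      (ps r (Ff X Y a u τ) * (κ u τ + ww X Y θ u τ / (2 * (1 - τ))) ^ 2 * Ph X Y u τ * v u τ)
    ≤ ENNReal.ofReal (Real.sqrt (4 * π) * m) := by
  obtain ⟨i1, i2, i3⟩ := h.fub1 (t₁ := a) hr univ MeasurableSet.univ hab hb le_rfl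
  simp only [Measure.restrict_univ] at i1 i2 i3
  have hsl : ∀ τ ∈ Ioc a b, (∫⁻ u, ENNReal.ofReal
      (ps r (Ff X Y a u τ) * (κ u τ + ww X Y θ u τ / (2 * (1 - τ))) ^ 2 * Ph X Y u τ * v u τ)) ≤
      ENNReal.ofReal (-∫ u, gg X Y θ v κ κs (fun _ => 1) (fun _ => 0) (ps r) (ps1 r) a u τ) ∧
      0 ≤ (-∫ u, gg X Y θ v κ κs (fun _ => 1) (fun _ => 0) (ps r) (ps1 r) a u τ) := by
    intro τ hτ
    have ht : τ < 0 := lt_of_le_of_lt hτ.2 hb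
    obtain ⟨N, hN0, hN⟩ := h.exN a r ht
    obtain ⟨s1, s2⟩ := h.slice_ibp (f := fun _ => 1) (f1 := fun _ => 0) (f2 := fun _ => 0)
      (fun x => hasDerivAt_const x _) (fun x => hasDerivAt_const x _) continuous_const hr a ht univ
      MeasurableSet.univ (a := -N) (b := N) (by linarith) (subset_univ _)
      (hN _ (by rw [abs_neg]; exact le_abs_self N)).le (hN _ (le_abs_self N)).le (fun u _ hu => by
        refine (hN u ?_).le
        by_contra hc
        push Not at hc
        exact hu ⟨(abs_lt.mp hc).1, (abs_lt.mp hc).2.le⟩)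
    rw [setIntegral_univ, setIntegral_univ] at s1
    rw [integrableOn_univ] at s2
    have hn : ∀ u, 0 ≤ ps r (Ff X Y a u τ) * (κ u τ + ww X Y θ u τ / (2 * (1 - τ))) ^ 2 * Ph X Y u τ * v u τ := by
      intro u
      have := ps_nonneg r (Ff X Y a u τ)
      have := (Ph_pos X Y u τ).le
      have := (h.vpos u τ ht).le
      positivity
    have hle : ∀ u, ps r (Ff X Y a u τ) * (κ u τ + ww X Y θ u τ / (2 * (1 - τ))) ^ 2 * Ph X Y u τ * v u τ ≤
        -SS X Y θ v κ (fun _ => 1) (fun _ => 0) (fun _ => 0) (ps r) (ps1 r) (ps2 r) a u τ := by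
      intro u
      have := SS1_le (X := X) (Y := Y) (θ := θ) (κ := κ) (r := r) (t₁ := a) (h.vpos u τ ht)
      linarith
    rw [s1, ← integral_neg]
    refine ⟨?_, integral_nonneg fun u => (hn u).trans (hle u)⟩
    rw [ofReal_integral_eq_lintegral_ofReal
      (f := fun u => -SS X Y θ v κ (fun _ => 1) (fun _ => 0) (fun _ => 0) (ps r) (ps1 r) (ps2 r) a u τ) s2.neg (Eventually.of_forall fun u => (hn u).trans (hle u))]
    exact lintegral_mono fun u => ENNReal.ofReal_le_ofReal (hle u)
  have i4 := i1.integral_prod_right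
  calc _ ≤ ∫⁻ τ in Ioc a b, ENNReal.ofReal (-∫ u, gg X Y θ v κ κs (fun _ => 1) (fun _ => 0) (ps r) (ps1 r) a u τ) :=
        setLIntegral_mono' measurableSet_Ioc fun τ hτ => (hsl τ hτ).1
    _ = ENNReal.ofReal (∫ τ in Ioc a b, (-∫ u, gg X Y θ v κ κs (fun _ => 1) (fun _ => 0) (ps r) (ps1 r) a u τ)) := by
        rw [ofReal_integral_eq_lintegral_ofReal
          (f := fun τ => -∫ u, gg X Y θ v κ κs (fun _ => 1) (fun _ => 0) (ps r) (ps1 r) a u τ) i4.neg]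
        · filter_upwards [ae_restrict_mem measurableSet_Ioc] with τ hτ
          exact (hsl τ hτ).2
    _ ≤ _ := by
        apply ENNReal.ofReal_le_ofReal
        rw [integral_neg]
        have h1 := (h.e1_int (t₁ := a) hr (lt_of_le_of_lt hab hb) le_rfl).2
        have h2 : 0 ≤ ∫ u, (1:ℝ) * ps r (Ff X Y a u b) * Ph X Y u b * v u b := by
          apply integral_nonneg
          intro u
          have := ps_nonneg r (Ff X Y a u b)
          have := (Ph_pos X Y u b).le
          have := (h.vpos u b hb).le
          positivity
        linarith

lemma ps_tendsto (y : ℝ) : Tendsto (fun n : ℕ => ps ((n:ℝ) + 1) y) atTop (𝓝 1) := by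
  have h1 : Tendsto (fun n : ℕ => 1 - y / ((n:ℝ) + 1)) atTop (𝓝 (1 - 0)) := by
    apply Tendsto.sub tendsto_const_nhds
    apply Tendsto.div_atTop tendsto_const_nhds
    exact tendsto_atTop_add_const_right _ _ tendsto_natCast_atTop_atTop
  have h2 := ((pp_cont.tendsto _).comp h1).pow 3
  simpa [ps, pp] using h2

lemma FL.A2b (h : FL X Y θ v κ κs m) {a b : ℝ} (hab : a ≤ b) (hb : b < 0) :
    ∫⁻ τ in Ioc a b, ∫⁻ u, ENNReal.ofReal
      ((κ u τ + ww X Y θ u τ / (2 * (1 - τ))) ^ 2 * Ph X Y u τ * v u τ)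
    ≤ ENNReal.ofReal (Real.sqrt (4 * π) * m) := by
  obtain ⟨Q, hQ⟩ : ∃ Q : ℕ → ℝ → ℝ → ℝ, Q = fun (n : ℕ) (u τ : ℝ) =>
    ps ((n:ℝ) + 1) (Ff X Y a u τ) * (κ u τ + ww X Y θ u τ / (2 * (1 - τ))) ^ 2 * Ph X Y u τ * v u τ := ⟨_, rfl⟩
  have cQ : ∀ n, ContinuousOn (fun p : ℝ × ℝ => Q n p.1 p.2) (univ ×ˢ Iio 0) := by
    intro n
    have a4 := h.cv
    have a5 := h.cκ
    have a7 := h.cPh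
    have a9 := h.cww
    have i1 := cinv1
    have q1' := (ps_cont ((n:ℝ) + 1)).comp_continuousOn (h.cFf a)
    simp only [Function.comp_def] at q1'
    have : (fun p : ℝ × ℝ => Q n p.1 p.2) = fun p : ℝ × ℝ => ps ((n:ℝ) + 1) (Ff X Y a p.1 p.2) *
      (κ p.1 p.2 + ww X Y θ p.1 p.2 * (1 / (2 * (1 - p.2)))) ^ 2 * Ph X Y p.1 p.2 * v p.1 p.2 := by
      ext p; simp only [hQ]; ring
    rw [this]; fun_prop
  have mQ : ∀ n, AEMeasurable (fun τ => ∫⁻ u, ENNReal.ofReal (Q n u τ)) (volume.restrict (Ioc a b)) := by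
    intro n
    have : AEMeasurable (fun p : ℝ × ℝ => Q n p.2 p.1) ((volume.restrict (Ioc a b)).prod (volume.restrict univ)) := by
      rw [Measure.prod_restrict]
      have c : ContinuousOn (fun p : ℝ × ℝ => Q n p.2 p.1) (Ioc a b ×ˢ univ) :=
        (cQ n).comp (by fun_prop : ContinuousOn (fun p : ℝ × ℝ => (p.2, p.1)) _)
          (fun p hp => ⟨mem_univ _, lt_of_le_of_lt hp.1.2 hb⟩)
      exact (c.aestronglyMeasurable (measurableSet_Ioc.prod MeasurableSet.univ)).aemeasurable
    have := this.ennreal_ofReal.lintegral_prod_right'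
    simpa using this
  have hin : ∀ τ ∈ Ioc a b, (∫⁻ u, ENNReal.ofReal
      ((κ u τ + ww X Y θ u τ / (2 * (1 - τ))) ^ 2 * Ph X Y u τ * v u τ)) ≤
      liminf (fun n => ∫⁻ u, ENNReal.ofReal (Q n u τ)) atTop := by
    intro τ hτ
    have ht : τ < 0 := lt_of_le_of_lt hτ.2 hb
    refine le_trans (le_of_eq ?_) (lintegral_liminf_le' fun n =>
      (slice_cont (cQ n) ht).measurable.aemeasurable.ennreal_ofReal)
    congr 1
    ext u
    have h1 : Tendsto (fun n => ENNReal.ofReal (Q n u τ)) atTop (𝓝 (ENNReal.ofReal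
      (1 * (κ u τ + ww X Y θ u τ / (2 * (1 - τ))) ^ 2 * Ph X Y u τ * v u τ))) := by
      apply ENNReal.tendsto_ofReal
      rw [hQ]
      exact (((ps_tendsto _).mul_const _).mul_const _).mul_const _
    rw [h1.liminf_eq, one_mul]
  calc _ ≤ ∫⁻ τ in Ioc a b, liminf (fun n => ∫⁻ u, ENNReal.ofReal (Q n u τ)) atTop :=
        setLIntegral_mono' measurableSet_Ioc hin
    _ ≤ liminf (fun n => ∫⁻ τ in Ioc a b, ∫⁻ u, ENNReal.ofReal (Q n u τ)) atTop := lintegral_liminf_le' mQ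
    _ ≤ _ := by
        refine liminf_le_of_frequently_le' (Frequently.of_forall fun n => ?_)
        rw [hQ]
        exact h.A2a (by positivity) hab hb

lemma FL.A2 (h : FL X Y θ v κ κs m) {ε : ℝ} (hε : 0 < ε) (Λ : ℝ) (hΛ : 0 < Λ) :
    ∃ t < -Λ, ∫⁻ u, ENNReal.ofReal ((κ u t + ww X Y θ u t / (2 * (1 - t))) ^ 2 * Ph X Y u t * v u t)
      ≤ ENNReal.ofReal (ε / (1 - t)) := by
  by_contra hc
  push Not at hc
  set C := Real.sqrt (4 * π) * m + 1
  set b := -Λ - 1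
  set a := 1 - (1 - b) * Real.exp (C / ε) with ha
  have hC : 0 < C := by positivity
  have hb : b < 0 := by simp only [b]; linarith
  have hex : 1 ≤ Real.exp (C / ε) := Real.one_le_exp (by positivity)
  have hab : a ≤ b := by rw [ha]; nlinarith
  have h1 := h.A2b hab hb
  have h2 : ∫⁻ τ in Ioc a b, ENNReal.ofReal (ε / (1 - τ)) ≤ ENNReal.ofReal (Real.sqrt (4 * π) * m) :=
    le_trans (setLIntegral_mono' measurableSet_Ioc fun τ hτ => (hc τ (by have := hτ.2; simp only [b] at this; linarith)).le) h1
  have hcont : ContinuousOn (fun τ : ℝ => ε / (1 - τ)) (Icc a b) := by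
    refine ContinuousOn.div (by fun_prop) (by fun_prop) fun τ hτ => ?_
    have := hτ.2; linarith
  have hii : IntegrableOn (fun τ : ℝ => ε / (1 - τ)) (Ioc a b) := hcont.integrableOn_Icc.mono_set Ioc_subset_Icc_self
  rw [← ofReal_integral_eq_lintegral_ofReal hii (by
    filter_upwards [ae_restrict_mem measurableSet_Ioc] with τ hτ
    have := hτ.2
    have : 0 < 1 - τ := by linarith
    show 0 ≤ ε / (1 - τ)
    positivity), ENNReal.ofReal_le_ofReal_iff (by positivity), ← intervalIntegral.integral_of_le hab,
    intervalIntegral.integral_eq_sub_of_hasDerivAt (f := fun τ => -ε * Real.log (1 - τ)) (fun τ hτ => by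
      rw [uIcc_of_le hab] at hτ
      have := hτ.2
      have h3 : HasDerivAt (fun t : ℝ => 1 - t) (-1) τ := (hasDerivAt_id τ).const_sub 1
      have := (h3.log (by linarith)).const_mul (-ε)
      refine this.congr_deriv ?_
      ring) (by
      apply ContinuousOn.intervalIntegrable
      rw [uIcc_of_le hab]; exact hcont)] at h2
  have h4 : Real.log (1 - a) = Real.log (1 - b) + C / ε := by
    rw [ha, sub_sub_cancel, Real.log_mul (by linarith) (by positivity), Real.log_exp]
  simp only [h4] at h2
  have : ε * (C / ε) = C := by field_simp
  have : C ≤ Real.sqrt (4 * π) * m := by nlinarith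
  simp only [C] at this
  linarith
end

end Part7

section Part8

section
variable {X Y θ v κ κs : ℝ → ℝ → ℝ} {m : ℕ}

lemma ps_eq_zero {r y : ℝ} (hr : 0 < r) (h : ps r y = 0) : r ≤ y := by
  have h1 : pp (1 - y / r) = 0 := by
    unfold ps at h
    exact pow_eq_zero_iff (by norm_num) |>.mp h
  have h2 := le_pp (1 - y / r)
  rw [h1, sub_nonpos, le_div_iff₀ hr] at h2
  linarith

/-- Avoidance on one tail. -/
lemma FL.tail (h : FL X Y θ v κ κs m) {r t₁ b t : ℝ} (hr : 0 < r) (h1 : t₁ ≤ b) (hbt : b ≤ t) (ht : t < 0)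
    (U : Set ℝ) (hU : MeasurableSet U)
    (hed : ∀ τ ∈ Icc b t, ∃ a' b', a' ≤ b' ∧ Ioc a' b' ⊆ U ∧ r ≤ Ff X Y t₁ a' τ ∧ r ≤ Ff X Y t₁ b' τ ∧
      ∀ u ∈ U, u ∉ Ioc a' b' → r ≤ Ff X Y t₁ u τ)
    (h0 : ∀ u ∈ U, r ≤ Ff X Y t₁ u b) : ∀ u ∈ interior U, r ≤ Ff X Y t₁ u t := by
  obtain ⟨i1, i2, i3⟩ := h.fub1 (t₁ := t₁) hr U hU hbt ht h1
  have z : ∫ u in U, (1:ℝ) * ps r (Ff X Y t₁ u b) * Ph X Y u b * v u b = 0 := by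
    apply setIntegral_eq_zero_of_forall_eq_zero
    intro u hu
    rw [(ps_zero hr (h0 u hu)).1]; simp
  have hneg : ∫ τ in Ioc b t, ∫ u in U, gg X Y θ v κ κs (fun _ => 1) (fun _ => 0) (ps r) (ps1 r) t₁ u τ ≤ 0 := by
    apply setIntegral_nonpos measurableSet_Ioc
    intro τ hτ
    have hτ0 : τ < 0 := lt_of_le_of_lt hτ.2 ht
    obtain ⟨a', b', e1, e2, e3, e4, e5⟩ := hed τ (Ioc_subset_Icc_self hτ)
    rw [(h.slice_ibp (f := fun _ => 1) (f1 := fun _ => 0) (f2 := fun _ => 0)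
      (fun x => hasDerivAt_const x _) (fun x => hasDerivAt_const x _) continuous_const hr t₁ hτ0 U hU
      e1 e2 e3 e4 e5).1]
    apply setIntegral_nonpos hU
    intro u _
    refine (SS1_le (h.vpos u τ hτ0)).trans ?_
    rw [neg_nonpos]
    have := ps_nonneg r (Ff X Y t₁ u τ)
    have := (Ph_pos X Y u τ).le
    have := (h.vpos u τ hτ0).le
    positivity
  have hnn : ∀ u, 0 ≤ (1:ℝ) * ps r (Ff X Y t₁ u t) * Ph X Y u t * v u t := by
    intro u
    have := ps_nonneg r (Ff X Y t₁ u t)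
    have := (Ph_pos X Y u t).le
    have := (h.vpos u t ht).le
    positivity
  have hz : ∫ u in U, (1:ℝ) * ps r (Ff X Y t₁ u t) * Ph X Y u t * v u t = 0 :=
    le_antisymm (by linarith) (integral_nonneg hnn)
  rw [setIntegral_eq_zero_iff_of_nonneg_ae (Eventually.of_forall hnn) i2] at hz
  have hz' := ae_restrict_of_ae_restrict_of_subset interior_subset hz
  have c1 := slice_cont h.cPh ht
  have c2 := slice_cont h.cv ht
  have c3 := (ps_cont r).comp (slice_cont (h.cFf t₁) ht)
  simp only [Function.comp_def] at c3
  have := Measure.eqOn_open_of_ae_eq hz' isOpen_interior (by fun_prop) (by fun_prop)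
  intro u hu
  have h3 := this hu
  simp only [Pi.zero_apply] at h3
  have p1 := (Ph_pos X Y u t).ne'
  have p2 := (h.vpos u t ht).ne'
  apply ps_eq_zero hr
  simpa [p1, p2] using h3

lemma time_cont {F : ℝ → ℝ → ℝ} (hF : ContinuousOn (fun p : ℝ × ℝ => F p.1 p.2) (univ ×ˢ Iio 0))
    (u : ℝ) {t : ℝ} (ht : t < 0) : ContinuousAt (fun t => F u t) t := by
  have h1 : ContinuousOn (fun t => F u t) (Iio 0) :=
    hF.comp (by fun_prop : ContinuousOn (fun t : ℝ => (u, t)) (Iio 0)) (fun t ht => ⟨mem_univ _, ht⟩)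
  exact h1.continuousAt (Iio_mem_nhds ht)

lemma FL.A0 (h : FL X Y θ v κ κs m) {r t₁ b : ℝ} (hr : 0 < r) (h1 : t₁ ≤ b) (hb : b < 0) :
    ∃ N > 0, ∃ η > 0, b + η < 0 ∧ ∀ t ∈ Icc b (b + η), ∀ u, N ≤ |u| → r ≤ Ff X Y t₁ u t := by
  obtain ⟨N, hN0, hN⟩ := h.exN t₁ r hb
  have e1 := (time_cont (h.cFf t₁) N hb).eventually (lt_mem_nhds (hN N (le_abs_self N)))
  have e2 := (time_cont (h.cFf t₁) (-N) hb).eventually (lt_mem_nhds (hN (-N) (by rw [abs_neg]; exact le_abs_self N)))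
  obtain ⟨η, hη, hb'⟩ := Metric.eventually_nhds_iff.mp ((e1.and e2).and (Iio_mem_nhds hb))
  have key : ∀ t ∈ Icc b (b + η / 2), (r < Ff X Y t₁ N t ∧ r < Ff X Y t₁ (-N) t) ∧ t < 0 := by
    intro t ht
    apply hb'
    rw [Real.dist_eq, abs_lt]
    constructor <;> linarith [ht.1, ht.2]
  refine ⟨N, hN0, η / 2, by positivity, (key _ ⟨by linarith, le_rfl⟩).2, ?_⟩
  intro t ht u hu
  have ht0 := (key t ht).2
  have ha : |N| = N := abs_of_pos hN0
  rcases lt_trichotomy u (-N) with hc | hc | hc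
  · refine h.tail hr h1 ht.1 ht0 (Iic (-N)) measurableSet_Iic ?_ ?_ u (by rw [interior_Iic]; exact hc)
    · intro τ hτ
      obtain ⟨k1, k2⟩ := key τ ⟨hτ.1, hτ.2.trans ht.2⟩
      obtain ⟨M, hM0, hM⟩ := h.exN t₁ r k2
      refine ⟨-max M N, -N, by linarith [le_max_right M N], fun x hx => hx.2, (hM _ ?_).le, k1.2.le, ?_⟩
      · rw [abs_neg]; exact (le_max_left _ _).trans (le_abs_self _)
      · intro x hx hxo
        refine (hM x ?_).le
        have : x ≤ -max M N := by
          by_contra hcc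
          push Not at hcc
          exact hxo ⟨hcc, hx⟩
        have := le_max_left M N
        linarith [neg_le_abs x]
    · intro x hx
      refine (hN x ?_).le
      have : x ≤ -N := hx
      linarith [neg_le_abs x]
  · rw [hc]; exact (key t ht).1.2.le
  · have huN : N ≤ u := by
      rcases abs_cases u with ⟨h3, _⟩ | ⟨h3, _⟩ <;> linarith
    rcases huN.eq_or_lt with hc' | hc'
    · rw [← hc']; exact (key t ht).1.1.le
    refine h.tail hr h1 ht.1 ht0 (Ioi N) measurableSet_Ioi ?_ ?_ u (by rw [interior_Ioi]; exact hc')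
    · intro τ hτ
      obtain ⟨k1, k2⟩ := key τ ⟨hτ.1, hτ.2.trans ht.2⟩
      obtain ⟨M, hM0, hM⟩ := h.exN t₁ r k2
      refine ⟨N, max M N, le_max_right M N, fun x hx => hx.1, k1.1.le, (hM _ ?_).le, ?_⟩
      · exact (le_max_left _ _).trans (le_abs_self _)
      · intro x hx hxo
        refine (hM x ?_).le
        have : max M N < x := by
          by_contra hcc
          push Not at hcc
          exact hxo ⟨hx, hcc⟩
        have := le_max_left M N
        linarith [le_abs_self x]
    · intro x hx
      refine (hN x ?_).le
      have : N < x := hx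
      linarith [le_abs_self x]

/-- smooth convex approximation of `2 * max (x - β) 0` -/
def fd (β δ x : ℝ) : ℝ := (x - β) + Real.sqrt ((x - β) ^ 2 + δ ^ 2)
def fd1 (β δ x : ℝ) : ℝ := 1 + (x - β) / Real.sqrt ((x - β) ^ 2 + δ ^ 2)
def fd2 (β δ x : ℝ) : ℝ := δ ^ 2 / Real.sqrt ((x - β) ^ 2 + δ ^ 2) ^ 3

lemma fd_arg {β δ x : ℝ} (hδ : 0 < δ) : 0 < (x - β) ^ 2 + δ ^ 2 := by positivity

lemma sqrt_hd {β δ : ℝ} (hδ : 0 < δ) (x : ℝ) : HasDerivAt (fun x => Real.sqrt ((x - β) ^ 2 + δ ^ 2))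
    ((x - β) / Real.sqrt ((x - β) ^ 2 + δ ^ 2)) x := by
  have h1 : HasDerivAt (fun x => (x - β) ^ 2 + δ ^ 2) (2 * (x - β)) x := by
    have := (((hasDerivAt_id x).sub_const β).pow 2).add_const (δ ^ 2)
    refine this.congr_deriv ?_
    simp
  refine (h1.sqrt (fd_arg hδ).ne').congr_deriv ?_
  field_simp

lemma fd_deriv {β δ : ℝ} (hδ : 0 < δ) (x : ℝ) : HasDerivAt (fd β δ) (fd1 β δ x) x :=
  ((hasDerivAt_id x).sub_const β).add (sqrt_hd hδ x)

lemma fd1_deriv {β δ : ℝ} (hδ : 0 < δ) (x : ℝ) : HasDerivAt (fd1 β δ) (fd2 β δ x) x := by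
  have hs : 0 < Real.sqrt ((x - β) ^ 2 + δ ^ 2) := Real.sqrt_pos.mpr (fd_arg hδ)
  have h1 := (((hasDerivAt_id x).sub_const β).div (sqrt_hd (β := β) hδ x) hs.ne').const_add 1
  refine h1.congr_deriv ?_
  simp only [fd2, id]
  have h2 := Real.sq_sqrt (fd_arg (β := β) (x := x) hδ).le
  field_simp
  rw [h2]; ring

lemma fd2_cont {β δ : ℝ} (hδ : 0 < δ) : Continuous (fd2 β δ) := by
  unfold fd2
  refine Continuous.div (by fun_prop) (by fun_prop) fun x => ?_
  have hs : 0 < Real.sqrt ((x - β) ^ 2 + δ ^ 2) := Real.sqrt_pos.mpr (fd_arg hδ)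
  positivity

lemma fd_cont {β δ : ℝ} : Continuous (fd β δ) := by unfold fd; fun_prop

lemma fd1_cont {β δ : ℝ} (hδ : 0 < δ) : Continuous (fd1 β δ) :=
  continuous_iff_continuousAt.mpr fun y => (fd1_deriv hδ y).continuousAt

lemma abs_le_fds (β δ x : ℝ) : |x - β| ≤ Real.sqrt ((x - β) ^ 2 + δ ^ 2) := by
  apply Real.abs_le_sqrt; nlinarith [sq_nonneg δ]

lemma fd_nonneg (β δ x : ℝ) : 0 ≤ fd β δ x := by
  unfold fd; linarith [abs_le_fds β δ x, neg_le_abs (x - β)]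

lemma fd_ge (β δ x : ℝ) : 2 * (x - β) ≤ fd β δ x := by
  unfold fd; linarith [abs_le_fds β δ x, le_abs_self (x - β)]

lemma fd_le {β δ x : ℝ} (hδ : 0 < δ) (h : x ≤ β) : fd β δ x ≤ δ := by
  unfold fd
  have : Real.sqrt ((x - β) ^ 2 + δ ^ 2) ≤ δ - (x - β) := by
    rw [Real.sqrt_le_left (by linarith)]
    nlinarith
  linarith

lemma fd1_bd {β δ : ℝ} (hδ : 0 < δ) (x : ℝ) : |fd1 β δ x| ≤ 2 := by
  unfold fd1
  have hs : 0 < Real.sqrt ((x - β) ^ 2 + δ ^ 2) := Real.sqrt_pos.mpr (fd_arg hδ)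
  have : |(x - β) / Real.sqrt ((x - β) ^ 2 + δ ^ 2)| ≤ 1 := by
    rw [abs_div, abs_of_pos hs, div_le_one hs]; exact abs_le_fds _ _ _
  calc _ ≤ |(1:ℝ)| + |(x - β) / Real.sqrt ((x - β) ^ 2 + δ ^ 2)| := abs_add_le _ _
    _ ≤ 2 := by rw [abs_one]; linarith

lemma fd2_nonneg (β δ x : ℝ) : 0 ≤ fd2 β δ x := by unfold fd2; positivity

lemma cross_alg (P k w p f1 r l L q4 : ℝ) (hP0 : 0 ≤ P) (hP1 : P ≤ 1) (hr : 0 < r) (hl : 0 < l) (hL : l ≤ L)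
    (hf1 : |f1| ≤ 2) (hq4 : 27 / 64 ≤ q4) :
    -(4 * f1 * (k - w / (2 * l)) * (-(3 / r * P ^ 2)) * p) - 30 * L / r * (q4 * k ^ 2)
      ≤ 24 / r * ((w ^ 2 + p ^ 2) / l) := by
  have e1 : |(k - w / (2 * l)) * p| ≤ l * k ^ 2 / 2 + (w ^ 2 + p ^ 2) / l := by
    have a1 : 0 ≤ l / 2 * (k - p / l) ^ 2 := by positivity
    have a2 : 0 ≤ l / 2 * (k + p / l) ^ 2 := by positivity
    have a3 : 0 ≤ (w - p) ^ 2 / (4 * l) := by positivity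
    have a4 : 0 ≤ (w + p) ^ 2 / (4 * l) := by positivity
    have b1 : l / 2 * (k - p / l) ^ 2 = l * k ^ 2 / 2 - k * p + p ^ 2 * (1 / l) / 2 := by field_simp; ring
    have b2 : l / 2 * (k + p / l) ^ 2 = l * k ^ 2 / 2 + k * p + p ^ 2 * (1 / l) / 2 := by field_simp; ring
    have b3 : (w - p) ^ 2 / (4 * l) = (w ^ 2 * (1 / l) + p ^ 2 * (1 / l)) / 4 - w / (2 * l) * p := by field_simp; ring
    have b4 : (w + p) ^ 2 / (4 * l) = (w ^ 2 * (1 / l) + p ^ 2 * (1 / l)) / 4 + w / (2 * l) * p := by field_simp; ring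
    have b5 : (w ^ 2 + p ^ 2) / l = w ^ 2 * (1 / l) + p ^ 2 * (1 / l) := by field_simp
    have c1 : 0 ≤ w ^ 2 * (1 / l) := by positivity
    have c2 : 0 ≤ p ^ 2 * (1 / l) := by positivity
    rw [b5, abs_le]
    constructor <;> nlinarith
  have hP2 : P ^ 2 ≤ 1 := pow_le_one₀ hP0 hP1
  have e2 : -(4 * f1 * (k - w / (2 * l)) * (-(3 / r * P ^ 2)) * p) ≤ 24 / r * |(k - w / (2 * l)) * p| := by
    calc _ = 12 / r * P ^ 2 * (f1 * ((k - w / (2 * l)) * p)) := by ring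
      _ ≤ 12 / r * P ^ 2 * (|f1| * |(k - w / (2 * l)) * p|) := by
        refine mul_le_mul_of_nonneg_left ?_ (by positivity)
        rw [← abs_mul]; exact le_abs_self _
      _ ≤ 12 / r * 1 * (2 * |(k - w / (2 * l)) * p|) := by gcongr
      _ = _ := by ring
  have e3 : 24 / r * (l * k ^ 2 / 2) ≤ 30 * L / r * (q4 * k ^ 2) := by
    calc 24 / r * (l * k ^ 2 / 2) ≤ 24 / r * (L * k ^ 2 / 2) := by gcongr
      _ = 12 * L / r * k ^ 2 := by ring
      _ ≤ 12 * L / r * ((64 / 27 * q4) * k ^ 2) := by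
        have : 0 < L := by linarith
        have : 1 ≤ 64 / 27 * q4 := by linarith
        have h2 : k ^ 2 ≤ 64 / 27 * q4 * k ^ 2 := le_mul_of_one_le_left (sq_nonneg k) this
        gcongr
      _ = (256 / 9) * (L / r * (q4 * k ^ 2)) := by ring
      _ ≤ 30 * (L / r * (q4 * k ^ 2)) := by
        have : 0 < L := by linarith
        have : 0 < q4 := by linarith
        gcongr; norm_num
      _ = _ := by ring
  have e4 := mul_le_mul_of_nonneg_left e1 (by positivity : 0 ≤ 24 / r)
  rw [mul_add] at e4
  linarith

lemma ps4_ge {r y : ℝ} (hr : 0 < r) (h : y ≤ r) : 27 / 64 ≤ ps (4 * r) y := by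
  unfold ps
  have h1 : 3 / 4 ≤ pp (1 - y / (4 * r)) := by
    refine le_trans ?_ (le_pp _)
    have : y / (4 * r) ≤ 1 / 4 := by
      rw [div_le_div_iff₀ (by positivity) (by norm_num)]; linarith
    linarith
  calc (27:ℝ) / 64 = (3 / 4) ^ 3 := by norm_num
    _ ≤ _ := by gcongr

lemma FL.SStot_le (h : FL X Y θ v κ κs m) {β δ r a : ℝ} (hδ : 0 < δ) (hr : 0 < r) (u : ℝ) {t : ℝ} (hat : a ≤ t)
    (ht : t < 0) :
    SS X Y θ v κ (fd β δ) (fd1 β δ) (fd2 β δ) (ps r) (ps1 r) (ps2 r) a u t +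
      30 * (1 - a) / r * SS X Y θ v κ (fun _ => 1) (fun _ => 0) (fun _ => 0) (ps (4 * r)) (ps1 (4 * r)) (ps2 (4 * r)) a u t
    ≤ 24 / r * ((X u t ^ 2 + Y u t ^ 2) / (1 - t) * (Ph X Y u t * v u t)) := by
  have hl : 0 < 1 - t := by linarith
  have hL : 0 < 1 - a := by linarith
  have hv := h.vpos u t ht
  have hP := Ph_pos X Y u t
  have h1 := SS1_le (X := X) (Y := Y) (θ := θ) (κ := κ) (r := 4 * r) (t₁ := a) hv
  have hB : 0 ≤ 30 * (1 - a) / r := by positivity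
  have h1' := mul_le_mul_of_nonneg_left h1 hB
  have hpv : 0 ≤ Ph X Y u t * v u t := by positivity
  by_cases hc : r ≤ Ff X Y a u t
  · rw [SS_zero hr hc]
    have : 0 ≤ 24 / r * ((X u t ^ 2 + Y u t ^ 2) / (1 - t) * (Ph X Y u t * v u t)) := by positivity
    have h2 : 0 ≤ 30 * (1 - a) / r * (ps (4 * r) (Ff X Y a u t) * (κ u t + ww X Y θ u t / (2 * (1 - t))) ^ 2 * Ph X Y u t * v u t) := by
      have := ps_nonneg (4 * r) (Ff X Y a u t)
      positivity
    linarith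
  · push Not at hc
    have hF0 : 0 ≤ Ff X Y a u t := le_trans (by positivity) (Ff_nonneg X Y u hat)
    have hca := cross_alg (pp (1 - Ff X Y a u t / r)) (κ u t + ww X Y θ u t / (2 * (1 - t))) (ww X Y θ u t) (pt X Y θ u t)
      (fd1 β δ (θ u t)) r (1 - t) (1 - a) (ps (4 * r) (Ff X Y a u t)) (pp_nonneg _) (pp_le_one (by
        have : 0 ≤ Ff X Y a u t / r := by positivity
        linarith)) hr hl (by linarith) (fd1_bd hδ _) (ps4_ge hr hc.le)
    rw [ww_sq_le, add_sub_cancel_right] at hca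
    have hca' := mul_le_mul_of_nonneg_right hca hpv
    have t1 : 0 ≤ fd2 β δ (θ u t) * κ u t ^ 2 * ps r (Ff X Y a u t) * (Ph X Y u t * v u t) := by
      have := ps_nonneg r (Ff X Y a u t)
      have := fd2_nonneg β δ (θ u t)
      positivity
    have t2 : 0 ≤ 4 * fd β δ (θ u t) * ps2 r (Ff X Y a u t) * pt X Y θ u t ^ 2 * (Ph X Y u t * v u t) := by
      have : 0 ≤ ps2 r (Ff X Y a u t) := by
        unfold ps2
        have := pp_nonneg (1 - Ff X Y a u t / r)
        positivity
      have := fd_nonneg β δ (θ u t)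
      positivity
    have t3 : 0 ≤ fd β δ (θ u t) * ps r (Ff X Y a u t) * (κ u t + ww X Y θ u t / (2 * (1 - t))) ^ 2 * (Ph X Y u t * v u t) := by
      have := ps_nonneg r (Ff X Y a u t)
      have := fd_nonneg β δ (θ u t)
      positivity
    have id1 : SS X Y θ v κ (fd β δ) (fd1 β δ) (fd2 β δ) (ps r) (ps1 r) (ps2 r) a u t =
      -(fd2 β δ (θ u t) * κ u t ^ 2 * ps r (Ff X Y a u t) * (Ph X Y u t * v u t)) -
      4 * fd β δ (θ u t) * ps2 r (Ff X Y a u t) * pt X Y θ u t ^ 2 * (Ph X Y u t * v u t) -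
      fd β δ (θ u t) * ps r (Ff X Y a u t) * (κ u t + ww X Y θ u t / (2 * (1 - t))) ^ 2 * (Ph X Y u t * v u t) +
      (-(4 * fd1 β δ (θ u t) * κ u t * (-(3 / r * pp (1 - Ff X Y a u t / r) ^ 2)) * pt X Y θ u t)) * (Ph X Y u t * v u t) := by
      simp only [SS, ps1]; ring
    rw [id1]
    have id2 : (-(4 * fd1 β δ (θ u t) * κ u t * (-(3 / r * pp (1 - Ff X Y a u t / r) ^ 2)) * pt X Y θ u t) -
        30 * (1 - a) / r * (ps (4 * r) (Ff X Y a u t) * (κ u t + ww X Y θ u t / (2 * (1 - t))) ^ 2)) * (Ph X Y u t * v u t) =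
        (-(4 * fd1 β δ (θ u t) * κ u t * (-(3 / r * pp (1 - Ff X Y a u t / r) ^ 2)) * pt X Y θ u t)) * (Ph X Y u t * v u t) +
        30 * (1 - a) / r * -(ps (4 * r) (Ff X Y a u t) * (κ u t + ww X Y θ u t / (2 * (1 - t))) ^ 2 * Ph X Y u t * v u t) := by
      ring
    have id3 : 24 / r * ((X u t ^ 2 + Y u t ^ 2) / (1 - t)) * (Ph X Y u t * v u t) =
      24 / r * ((X u t ^ 2 + Y u t ^ 2) / (1 - t) * (Ph X Y u t * v u t)) := by ring
    rw [id2, id3] at hca'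
    linarith
end

end Part8

section Part9

section
variable {X Y θ v κ κs : ℝ → ℝ → ℝ} {m : ℕ}

/-- total density for the propagation argument -/
def ee (X Y θ v : ℝ → ℝ → ℝ) (β δ r a u t : ℝ) : ℝ :=
  fd β δ (θ u t) * ps r (Ff X Y a u t) * Ph X Y u t * v u t +
    30 * (1 - a) / r * (1 * ps (4 * r) (Ff X Y a u t) * Ph X Y u t * v u t)

def gt (X Y θ v κ κs : ℝ → ℝ → ℝ) (β δ r a u t : ℝ) : ℝ :=
  gg X Y θ v κ κs (fd β δ) (fd1 β δ) (ps r) (ps1 r) a u t +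
    30 * (1 - a) / r * gg X Y θ v κ κs (fun _ => 1) (fun _ => 0) (ps (4 * r)) (ps1 (4 * r)) a u t

lemma FL.ee_t (h : FL X Y θ v κ κs m) {β δ r a : ℝ} (hδ : 0 < δ) (u : ℝ) {t : ℝ} (ht : t < 0) :
    HasDerivAt (ee X Y θ v β δ r a u) (gt X Y θ v κ κs β δ r a u t) t :=
  (h.e_t (fd_deriv hδ) (ps_deriv r) a u t ht).add
    ((h.e_t (f := fun _ => 1) (f1 := fun _ => 0) (fun x => hasDerivAt_const x _) (ps_deriv (4 * r)) a u t ht).const_mul _)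

lemma FL.cgt (h : FL X Y θ v κ κs m) {β δ r a : ℝ} (hδ : 0 < δ) :
    ContinuousOn (fun p : ℝ × ℝ => gt X Y θ v κ κs β δ r a p.1 p.2) (univ ×ˢ Iio 0) :=
  (h.cgg fd_cont (fd1_cont hδ) (ps_cont r) (ps1_cont r) a).add
    ((h.cgg continuous_const continuous_const (ps_cont (4 * r)) (ps1_cont (4 * r)) a).const_smul (30 * (1 - a) / r))

lemma FL.cee (h : FL X Y θ v κ κs m) {β δ r a : ℝ} :
    ContinuousOn (fun p : ℝ × ℝ => ee X Y θ v β δ r a p.1 p.2) (univ ×ˢ Iio 0) := by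
  have a4 := h.cv
  have a7 := h.cPh
  have f1' := (fd_cont (β := β) (δ := δ)).comp_continuousOn h.cθ
  have q1' := (ps_cont r).comp_continuousOn (h.cFf a)
  have q2' := (ps_cont (4 * r)).comp_continuousOn (h.cFf a)
  simp only [Function.comp_def] at f1' q1' q2'
  unfold ee
  fun_prop

lemma FL.ee_nonneg (h : FL X Y θ v κ κs m) {β δ r a : ℝ} (hr : 0 < r) (ha : a ≤ 0) (u : ℝ) {t : ℝ} (ht : t < 0) :
    0 ≤ ee X Y θ v β δ r a u t := by
  have := ps_nonneg r (Ff X Y a u t)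
  have := ps_nonneg (4 * r) (Ff X Y a u t)
  have := fd_nonneg β δ (θ u t)
  have := (Ph_pos X Y u t).le
  have := (h.vpos u t ht).le
  have : 0 < 1 - a := by linarith
  unfold ee
  positivity

lemma ee_zero {β δ r a u t : ℝ} (hr : 0 < r) (h : 4 * r ≤ Ff X Y a u t) : ee X Y θ v β δ r a u t = 0 := by
  simp [ee, (ps_zero (by positivity : 0 < 4 * r) h).1, (ps_zero hr (by linarith : r ≤ Ff X Y a u t)).1]

lemma not_Ioc_abs {N u : ℝ} (h : u ∉ Ioc (-N) N) : N ≤ |u| := by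
  by_contra hc
  push Not at hc
  exact h ⟨(abs_lt.mp hc).1, (abs_lt.mp hc).2.le⟩

lemma FL.ee_int_eq {β δ r a N t : ℝ} (hr : 0 < r)
    (hN : ∀ u, N ≤ |u| → 4 * r ≤ Ff X Y a u t) :
    ∫ u, ee X Y θ v β δ r a u t = ∫ u in Ioc (-N) N, ee X Y θ v β δ r a u t := by
  rw [← setIntegral_univ]
  exact setIntegral_eq_of_subset_of_forall_sdiff_eq_zero MeasurableSet.univ (subset_univ _)
    (fun u hu => ee_zero hr (hN u (not_Ioc_abs hu.2)))

lemma FL.ee_int (h : FL X Y θ v κ κs m) {β δ r a : ℝ} (hr : 0 < r) {t : ℝ} (ht : t < 0) :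
    Integrable (fun u => ee X Y θ v β δ r a u t) := by
  obtain ⟨N, hN0, hN⟩ := h.exN a (4 * r) ht
  have c := slice_cont (h.cee (β := β) (δ := δ) (r := r) (a := a)) ht
  rw [← integrableOn_univ]
  refine IntegrableOn.of_forall_sdiff_eq_zero
    (c.integrableOn_Icc.mono_set (Ioc_subset_Icc_self : Ioc (-N) N ⊆ _)) MeasurableSet.univ
    (fun u hu => ee_zero hr (hN u (not_Ioc_abs hu.2)).le)

lemma FL.slice_le (h : FL X Y θ v κ κs m) {β δ r a N : ℝ} (hδ : 0 < δ) (hr : 0 < r) {t : ℝ} (hat : a ≤ t)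
    (ht : t < 0) (hN0 : 0 < N) (hN : ∀ u, N ≤ |u| → 4 * r ≤ Ff X Y a u t) :
    ∫ u in Ioc (-N) N, gt X Y θ v κ κs β δ r a u t ≤ 24 / r * (8 * (Real.sqrt (8 * π) * m)) := by
  have hr4 : 0 < 4 * r := by positivity
  have e1 : N ≤ |(-N)| := by rw [abs_neg]; exact le_abs_self N
  have e2 : N ≤ |N| := le_abs_self N
  obtain ⟨s1, s2⟩ := h.slice_ibp (fd_deriv (β := β) hδ) (fd1_deriv hδ) (fd2_cont hδ) hr a ht (Ioc (-N) N) measurableSet_Ioc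
    (by linarith : -N ≤ N) subset_rfl (by linarith [hN _ e1]) (by linarith [hN _ e2]) (fun u hu hu' => absurd hu hu')
  obtain ⟨s3, s4⟩ := h.slice_ibp (f := fun _ => 1) (f1 := fun _ => 0) (f2 := fun _ => 0)
      (fun x => hasDerivAt_const x _) (fun x => hasDerivAt_const x _) continuous_const hr4 a ht (Ioc (-N) N) measurableSet_Ioc
    (by linarith : -N ≤ N) subset_rfl (hN _ e1) (hN _ e2) (fun u hu hu' => absurd hu hu')
  have c1 := slice_cont (h.cgg (fd_cont (β := β) (δ := δ)) (fd1_cont (β := β) hδ) (ps_cont r) (ps1_cont r) a) ht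
  have c2 := slice_cont (h.cgg (f := fun _ => 1) (f1 := fun _ => 0) continuous_const continuous_const (ps_cont (4 * r)) (ps1_cont (4 * r)) a) ht
  obtain ⟨i, I⟩ := h.ent2 ht
  have hr24 : 0 ≤ 24 / r := by positivity
  unfold gt
  rw [integral_add (c1.integrableOn_Icc.mono_set Ioc_subset_Icc_self)
    ((c2.integrableOn_Icc.mono_set Ioc_subset_Icc_self).const_mul _), integral_const_mul, s1, s3, ← integral_const_mul,
    ← integral_add s2 (s4.const_mul _)]
  calc _ ≤ ∫ u in Ioc (-N) N, 24 / r * ((X u t ^ 2 + Y u t ^ 2) / (1 - t) * (Ph X Y u t * v u t)) :=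
        setIntegral_mono (s2.add (s4.const_mul _)) (i.integrableOn.const_mul _) (fun u => h.SStot_le hδ hr u hat ht)
    _ ≤ ∫ u, 24 / r * ((X u t ^ 2 + Y u t ^ 2) / (1 - t) * (Ph X Y u t * v u t)) := by
        refine setIntegral_le_integral (i.const_mul _) (Eventually.of_forall fun u => ?_)
        have := (Ph_pos X Y u t).le
        have := (h.vpos u t ht).le
        have : 0 < 1 - t := by linarith
        show 0 ≤ 24 / r * ((X u t ^ 2 + Y u t ^ 2) / (1 - t) * (Ph X Y u t * v u t))
        positivity
    _ ≤ _ := by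
        rw [integral_const_mul]
        exact mul_le_mul_of_nonneg_left I hr24

lemma FL.step (h : FL X Y θ v κ κs m) {β δ r a b : ℝ} (hδ : 0 < δ) (hr : 0 < r) (hab : a ≤ b) (hb : b < 0) :
    ∃ η > 0, b + η < 0 ∧ ∀ t ∈ Icc b (b + η), ∫ u, ee X Y θ v β δ r a u t ≤
      (∫ u, ee X Y θ v β δ r a u b) + 24 / r * (8 * (Real.sqrt (8 * π) * m)) * (t - b) := by
  obtain ⟨N, hN0, η, hη, hbη, hN⟩ := h.A0 (by positivity : 0 < 4 * r) hab hb
  refine ⟨η, hη, hbη, fun t ht => ?_⟩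
  have ht0 : t < 0 := lt_of_le_of_lt ht.2 hbη
  have hlt : ∀ τ ∈ Icc b t, τ < 0 := fun τ hτ => lt_of_le_of_lt hτ.2 ht0
  have cg : ContinuousOn (fun p : ℝ × ℝ => gt X Y θ v κ κs β δ r a p.1 p.2) (univ ×ˢ Icc b t) :=
    (h.cgt hδ).mono (prod_mono subset_rfl hlt)
  obtain ⟨K, hK⟩ := ((isCompact_Icc (a := -N) (b := N)).prod (isCompact_Icc (a := b) (b := t))).exists_bound_of_continuousOn
    (cg.mono (prod_mono (subset_univ _) subset_rfl))
  obtain ⟨i1, i2, i3⟩ := fub (Ioc (-N) N) measurableSet_Ioc b t ht.1 (ee X Y θ v β δ r a) (gt X Y θ v κ κs β δ r a)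
    (fun _ _ => |K|) (fun u _ τ hτ => h.ee_t hδ u (hlt τ hτ)) cg
    (fun u _ τ hτ => h.ee_nonneg hr (by linarith) u (hlt τ hτ)) (h.ee_int hr hb).integrableOn
    (fun u hu τ hτ => (le_abs_self _).trans ((hK (u, τ) ⟨Ioc_subset_Icc_self hu, hτ⟩).trans (le_abs_self K)))
    (fun _ _ _ _ => abs_nonneg K) (by
      rw [Measure.prod_restrict]
      refine integrableOn_const ?_
      rw [← Measure.volume_eq_prod, Measure.volume_eq_prod, Measure.prod_prod]
      simp [ENNReal.mul_eq_top])
  rw [FL.ee_int_eq hr (hN t ht), FL.ee_int_eq hr (hN b ⟨le_rfl, by linarith⟩), i3]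
  gcongr
  have i4 := i1.integral_prod_right
  have i5 : IntegrableOn (fun _ : ℝ => 24 / r * (8 * (Real.sqrt (8 * π) * m))) (Ioc b t) :=
    integrableOn_const (by simp)
  refine (setIntegral_mono_on i4 i5 measurableSet_Ioc fun τ hτ => ?_).trans ?_
  · exact h.slice_le hδ hr (hab.trans hτ.1.le) (hlt τ (Ioc_subset_Icc_self hτ)) hN0
      (hN τ ⟨hτ.1.le, hτ.2.trans ht.2⟩)
  · rw [setIntegral_const, smul_eq_mul, Measure.real, Real.volume_Ioc, ENNReal.toReal_ofReal (by linarith [ht.1]), mul_comm]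

lemma FL.propag (h : FL X Y θ v κ κs m) {β δ r a b : ℝ} (hδ : 0 < δ) (hr : 0 < r) (hab : a ≤ b) (hb : b < 0) :
    ∫ u, ee X Y θ v β δ r a u b ≤
      (∫ u, ee X Y θ v β δ r a u a) + 24 / r * (8 * (Real.sqrt (8 * π) * m)) * (b - a) := by
  obtain ⟨J, hJ⟩ : ∃ J : ℝ → ℝ, J = fun t => ∫ u, ee X Y θ v β δ r a u t := ⟨_, rfl⟩
  set c := 24 / r * (8 * (Real.sqrt (8 * π) * m)) with hc
  have hc0 : 0 ≤ c := by positivity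
  have ha0 : a < 0 := by linarith
  have hJ0 : ∀ t < 0, 0 ≤ J t := by
    intro t ht; rw [hJ]; exact integral_nonneg fun u => h.ee_nonneg hr ha0.le u ht
  have hJl : ∀ t < 0, ENNReal.ofReal (J t) = ∫⁻ u, ENNReal.ofReal (ee X Y θ v β δ r a u t) := by
    intro t ht
    rw [hJ]
    exact ofReal_integral_eq_lintegral_ofReal (h.ee_int hr ht)
      (Eventually.of_forall fun u => h.ee_nonneg hr ha0.le u ht)
  have hcl : IsClosed ({t | J t ≤ J a + c * (t - a)} ∩ Icc a b) := by
    apply IsSeqClosed.isClosed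
    intro s t hs hst
    have htI : t ∈ Icc a b := isClosed_Icc.mem_of_tendsto hst (Eventually.of_forall fun n => (hs n).2)
    have ht0 : t < 0 := lt_of_le_of_lt htI.2 hb
    have hs0 : ∀ n, s n < 0 := fun n => lt_of_le_of_lt (hs n).2.2 hb
    refine ⟨?_, htI⟩
    have hnn : 0 ≤ J a + c * (t - a) := by
      have := hJ0 a ha0
      have := mul_nonneg hc0 (by linarith [htI.1] : 0 ≤ t - a)
      linarith
    show J t ≤ J a + c * (t - a)
    rw [← ENNReal.ofReal_le_ofReal_iff hnn, hJl t ht0]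
    calc ∫⁻ u, ENNReal.ofReal (ee X Y θ v β δ r a u t)
        = ∫⁻ u, liminf (fun n => ENNReal.ofReal (ee X Y θ v β δ r a u (s n))) atTop := by
          congr 1
          ext u
          have : Tendsto (fun n => ENNReal.ofReal (ee X Y θ v β δ r a u (s n))) atTop
            (𝓝 (ENNReal.ofReal (ee X Y θ v β δ r a u t))) := by
            apply ENNReal.tendsto_ofReal
            exact (time_cont h.cee u ht0).tendsto.comp hst
          rw [this.liminf_eq]
      _ ≤ liminf (fun n => ∫⁻ u, ENNReal.ofReal (ee X Y θ v β δ r a u (s n))) atTop :=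
          lintegral_liminf_le' fun n => (slice_cont h.cee (hs0 n)).measurable.aemeasurable.ennreal_ofReal
      _ ≤ liminf (fun n => ENNReal.ofReal (J a + c * (s n - a))) atTop := by
          apply liminf_le_liminf
          · refine Eventually.of_forall fun n => ?_
            rw [← hJl _ (hs0 n)]
            exact ENNReal.ofReal_le_ofReal (hs n).1
          · isBoundedDefault
          · isBoundedDefault
      _ = ENNReal.ofReal (J a + c * (t - a)) := by
          apply Tendsto.liminf_eq
          apply ENNReal.tendsto_ofReal
          exact ((hst.sub_const a).const_mul c).const_add _
  have hsub := hcl.Icc_subset_of_forall_exists_gt (by simp) (by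
    rintro x ⟨hx, hxI⟩ y hy
    obtain ⟨η, hη, hxη, hst⟩ := h.step (β := β) hδ hr hxI.1 (by linarith [hxI.2] : x < 0)
    have hxy : x < y := hy
    have hm : 0 < min η (y - x) := lt_min hη (by linarith)
    refine ⟨x + min η (y - x), ?_, by linarith, by linarith [min_le_right η (y - x)]⟩
    have h1 := hst (x + min η (y - x)) ⟨by linarith, by linarith [min_le_left η (y - x)]⟩
    have hx' : J x ≤ J a + c * (x - a) := hx
    show J _ ≤ J a + c * (_ - a)
    have h2 : J (x + min η (y - x)) ≤ J x + c * (x + min η (y - x) - x) := by rw [hJ]; exact h1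
    linarith)
  have := hsub (right_mem_Icc.mpr hab)
  rw [hJ] at this
  exact this

lemma FL.A3 (h : FL X Y θ v κ κs m) (us ts : ℝ) (hts : ts < 0) :
    ∃ R₀ > 0, ∃ Λ > 0, ∀ R ≥ R₀, ∀ a < -Λ, ∀ β, (∀ u, X u a ^ 2 + Y u a ^ 2 < R ^ 2 * (1 - a) → θ u a ≤ β) →
      θ us ts ≤ β + 1 := by
  have cθ := slice_cont h.cθ hts
  have cX := slice_cont h.cX hts
  have cY := slice_cont h.cY hts
  have e1 : ∀ᶠ u in 𝓝 us, θ us ts - 1 / 2 < θ u ts := cθ.continuousAt.eventually (lt_mem_nhds (by linarith))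
  have c2 : Continuous (fun u => X u ts ^ 2 + Y u ts ^ 2) := by fun_prop
  have e2 : ∀ᶠ u in 𝓝 us, X u ts ^ 2 + Y u ts ^ 2 < X us ts ^ 2 + Y us ts ^ 2 + 1 :=
    c2.continuousAt.eventually (gt_mem_nhds (by simp))
  obtain ⟨σ, hσ, hnb⟩ := Metric.eventually_nhds_iff.mp (e1.and e2)
  set M := X us ts ^ 2 + Y us ts ^ 2 + 1 with hM
  set V := Ioo (us - σ) (us + σ) with hV
  have hnb' : ∀ u ∈ V, θ us ts - 1 / 2 < θ u ts ∧ X u ts ^ 2 + Y u ts ^ 2 < M := by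
    intro u hu
    apply hnb
    rw [Real.dist_eq, abs_lt]
    constructor <;> linarith [hu.1, hu.2]
  obtain ⟨iE, IE⟩ := h.ent1 hts
  set g₀ := ∫ u in V, Ph X Y u ts * v u ts with hg
  have hg0 : 0 < g₀ := by
    rw [hg, setIntegral_pos_iff_support_of_nonneg_ae]
    · have : Function.support (fun u => Ph X Y u ts * v u ts) = univ := by
        ext u; simp [(Ph_pos X Y u ts).ne', (h.vpos u ts hts).ne']
      rw [this, univ_inter, hV, Real.volume_Ioo, ENNReal.ofReal_pos]; linarith
    · exact Eventually.of_forall fun u => mul_nonneg (Ph_pos X Y u ts).le (h.vpos u ts hts).le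
    · exact iE.integrableOn
  set K := 31 * (Real.sqrt (4 * π) * m) + 192 * (Real.sqrt (8 * π) * m) with hK
  have hK0 : 0 ≤ K := by positivity
  refine ⟨8 * K / g₀ + 3, by positivity, M - ts, by nlinarith [sq_nonneg (X us ts), sq_nonneg (Y us ts)], ?_⟩
  intro R hR a ha β hyp
  by_contra hc
  push Not at hc
  have hM0 : 0 < M := by rw [hM]; positivity
  have hKg : 0 ≤ 8 * K / g₀ := by positivity
  have hR3 : 3 ≤ R := by linarith
  have hR0 : 0 < R := by linarith
  have hR9 : 9 ≤ R ^ 2 := by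
    have := pow_le_pow_left₀ (by norm_num : (0:ℝ) ≤ 3) hR3 2
    linarith
  have hats : a ≤ ts := by linarith
  have ha0 : a < 0 := by linarith
  have hl : 0 < 1 - a := by linarith
  have hr : 0 < R ^ 2 * (1 - a) := by positivity
  have hδ : 0 < 1 / R ^ 2 := by positivity
  have hB : 30 * (1 - a) / (R ^ 2 * (1 - a)) = 30 / R ^ 2 := by field_simp
  have hp := h.propag (β := β) hδ hr hats hts
  obtain ⟨iA, IA⟩ := h.ent1 ha0
  -- initial time
  have hini : ∫ u, ee X Y θ v β (1 / R ^ 2) (R ^ 2 * (1 - a)) a u a ≤ 31 / R ^ 2 * (Real.sqrt (4 * π) * m) := by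
    calc _ ≤ ∫ u, 31 / R ^ 2 * (Ph X Y u a * v u a) := by
          refine integral_mono (h.ee_int hr ha0) (iA.const_mul _) fun u => ?_
          have hpv : 0 ≤ Ph X Y u a * v u a := mul_nonneg (Ph_pos X Y u a).le (h.vpos u a ha0).le
          have hF0 : 0 ≤ Ff X Y a u a := le_trans (by positivity) (Ff_nonneg X Y u le_rfl)
          have p1 := ps_le_one hr hF0
          have p2 := ps_le_one (by positivity : 0 < 4 * (R ^ 2 * (1 - a))) hF0
          have p3 := ps_nonneg (R ^ 2 * (1 - a)) (Ff X Y a u a)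
          have q1 : fd β (1 / R ^ 2) (θ u a) * ps (R ^ 2 * (1 - a)) (Ff X Y a u a) ≤ 1 / R ^ 2 := by
            by_cases hcc : R ^ 2 * (1 - a) ≤ Ff X Y a u a
            · rw [(ps_zero hr hcc).1, mul_zero]; positivity
            · push Not at hcc
              have h4 : θ u a ≤ β := hyp u (by simpa [Ff] using hcc)
              have h5 := fd_le hδ h4
              have h6 := fd_nonneg β (1 / R ^ 2) (θ u a)
              nlinarith
          have q2 : 30 / R ^ 2 * ps (4 * (R ^ 2 * (1 - a))) (Ff X Y a u a) ≤ 30 / R ^ 2 :=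
            mul_le_of_le_one_right (by positivity) p2
          have q3 : 31 / R ^ 2 = 1 / R ^ 2 + 30 / R ^ 2 := by ring
          simp only [ee]
          rw [hB, q3]
          have := mul_le_mul_of_nonneg_right (add_le_add q1 q2) hpv
          linarith
      _ = 31 / R ^ 2 * ∫ u, Ph X Y u a * v u a := integral_const_mul _ _
      _ ≤ _ := mul_le_mul_of_nonneg_left IA (by positivity)
  have hfin : g₀ / 8 ≤ ∫ u, ee X Y θ v β (1 / R ^ 2) (R ^ 2 * (1 - a)) a u ts := by
    calc g₀ / 8 = ∫ u in V, 1 / 8 * (Ph X Y u ts * v u ts) := by rw [integral_const_mul]; ring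
      _ ≤ ∫ u in V, ee X Y θ v β (1 / R ^ 2) (R ^ 2 * (1 - a)) a u ts := by
          refine setIntegral_mono_on (iE.integrableOn.const_mul _) (h.ee_int hr hts).integrableOn measurableSet_Ioo
            fun u hu => ?_
          obtain ⟨n1, n2⟩ := hnb' u hu
          have hpv : 0 ≤ Ph X Y u ts * v u ts := mul_nonneg (Ph_pos X Y u ts).le (h.vpos u ts hts).le
          have f1 : 1 ≤ fd β (1 / R ^ 2) (θ u ts) := by
            linarith [fd_ge β (1 / R ^ 2) (θ u ts)]
          have p1 : 1 / 8 ≤ ps (R ^ 2 * (1 - a)) (Ff X Y a u ts) := by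
            unfold ps
            have hh : Ff X Y a u ts ≤ R ^ 2 * (1 - a) / 2 := by
              have := mul_le_mul_of_nonneg_right hR9 hl.le
              simp only [Ff]; linarith
            have h1 : 1 / 2 ≤ pp (1 - Ff X Y a u ts / (R ^ 2 * (1 - a))) := by
              refine le_trans ?_ (le_pp _)
              have : Ff X Y a u ts / (R ^ 2 * (1 - a)) ≤ 1 / 2 := by
                rw [div_le_iff₀ hr]; linarith
              linarith
            calc (1:ℝ) / 8 = (1 / 2) ^ 3 := by norm_num
              _ ≤ _ := by gcongr
          have p2 := ps_nonneg (4 * (R ^ 2 * (1 - a))) (Ff X Y a u ts)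
          have q1 : 1 / 8 ≤ fd β (1 / R ^ 2) (θ u ts) * ps (R ^ 2 * (1 - a)) (Ff X Y a u ts) := by nlinarith
          have q2 : 0 ≤ 30 / R ^ 2 * ps (4 * (R ^ 2 * (1 - a))) (Ff X Y a u ts) := by positivity
          simp only [ee]
          rw [hB]
          have := mul_le_mul_of_nonneg_right (add_le_add q1 q2) hpv
          linarith
      _ ≤ _ := setIntegral_le_integral (h.ee_int hr hts)
          (Eventually.of_forall fun u => h.ee_nonneg hr ha0.le u hts)
  have hmid : 24 / (R ^ 2 * (1 - a)) * (8 * (Real.sqrt (8 * π) * m)) * (ts - a) ≤ 192 / R ^ 2 * (Real.sqrt (8 * π) * m) := by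
    calc _ ≤ 24 / (R ^ 2 * (1 - a)) * (8 * (Real.sqrt (8 * π) * m)) * (1 - a) := by
          apply mul_le_mul_of_nonneg_left (by linarith) (by positivity)
      _ = _ := by field_simp; ring
  have hall : g₀ / 8 ≤ K / R ^ 2 := by
    have : K / R ^ 2 = 31 / R ^ 2 * (Real.sqrt (4 * π) * m) + 192 / R ^ 2 * (Real.sqrt (8 * π) * m) := by
      rw [hK]; ring
    linarith
  rw [div_le_div_iff₀ (by norm_num) (by positivity)] at hall
  have hRR : R ≤ R ^ 2 := by
    rw [sq]; exact le_mul_of_one_le_left hR0.le (by linarith)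
  have h8 : 8 * K / g₀ < R ^ 2 := by linarith
  rw [div_lt_iff₀ hg0] at h8
  linarith
end

end Part9

section Part10

variable {X Y θ v κ κs : ℝ → ℝ → ℝ} {m : ℕ}

/-- Reflection of a flow in the horizontal axis. -/
lemma FL.mirror (h : FL X Y θ v κ κs m) :
    FL X (fun u t => -Y u t) (fun u t => -θ u t) v (fun u t => -κ u t) (fun u t => -κs u t) m where
  Xu u t ht := by simpa using h.Xu u t ht
  Yu u t ht := by simpa using (h.Yu u t ht).fun_neg
  θu u t ht := by simpa using (h.θu u t ht).fun_neg
  κu u t ht := by simpa using (h.κu u t ht).fun_neg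
  Xt u t ht := by simpa using h.Xt u t ht
  Yt u t ht := by simpa using (h.Yt u t ht).fun_neg
  vt u t ht := by simpa using h.vt u t ht
  θt u t ht := by simpa using (h.θt u t ht).fun_neg
  vpos := h.vpos
  cX := h.cX
  cY := h.cY.neg
  cθ := h.cθ.neg
  cv := h.cv
  cκ := h.cκ.neg
  cκs := h.cκs.neg
  prop t ht := by simpa using h.prop t ht
  inj t ht u u' h1 h2 := h.inj t ht u u' h1 (neg_injective h2)
  ent t ht l hl := by simpa using h.ent t ht l hl

lemma FL.A3' (h : FL X Y θ v κ κs m) (us ts : ℝ) (hts : ts < 0) :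
    ∃ R₀ > 0, ∃ Λ > 0, ∀ R ≥ R₀, ∀ a < -Λ, ∀ β,
      (∀ u, X u a ^ 2 + Y u a ^ 2 < R ^ 2 * (1 - a) → β ≤ θ u a) → β - 1 ≤ θ us ts := by
  obtain ⟨R₀, hR₀, Λ, hΛ, H⟩ := h.mirror.A3 us ts hts
  refine ⟨R₀, hR₀, Λ, hΛ, fun R hR a ha β hyp => ?_⟩
  have := H R hR a ha (-β) (fun u hu => by
    have := hyp u (by simpa using hu)
    simpa using this)
  linarith

/-- Rescaled time slices satisfy the static hypotheses. -/
lemma FL.slice_SC (h : FL X Y θ v κ κs m) {a : ℝ} (ha : a < 0) {s : ℝ} (hs : 0 < s) :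
    SC (fun u => s⁻¹ * X u a) (fun u => s⁻¹ * Y u a) (fun u => θ u a) (fun u => s⁻¹ * v u a)
      (fun u => s * κ u a) where
  hX u := by simpa [mul_assoc] using (h.Xu u a ha).const_mul s⁻¹
  hY u := by simpa [mul_assoc] using (h.Yu u a ha).const_mul s⁻¹
  hθ u := by
    refine (h.θu u a ha).congr_deriv ?_
    field_simp
  hv u := mul_pos (inv_pos.mpr hs) (h.vpos u a ha)
  cv := (slice_cont h.cv ha).const_mul _
  cκ := (slice_cont h.cκ ha).const_mul _
  inj u u' h1 h2 := h.inj a ha u u' (mul_left_cancel₀ (inv_ne_zero hs.ne') h1)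
    (mul_left_cancel₀ (inv_ne_zero hs.ne') h2)
  prop := by
    have := (h.prop a ha).const_mul_atTop (pow_pos (inv_pos.mpr hs) 2)
    refine this.congr fun u => ?_
    ring

lemma lintegral_scale_le {f : ℝ → ℝ} {c C : ℝ} (hc : 0 ≤ c)
    (h : ∫⁻ u, ENNReal.ofReal (f u) ≤ ENNReal.ofReal C) :
    ∫⁻ u, ENNReal.ofReal (c * f u) ≤ ENNReal.ofReal (c * C) := by
  simp_rw [ENNReal.ofReal_mul hc]
  rw [lintegral_const_mul' _ _ ENNReal.ofReal_ne_top]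
  gcongr

lemma FL.slice_SB (h : FL X Y θ v κ κs m) {a : ℝ} (ha : a < 0) {ε : ℝ}
    (hD : ∫⁻ u, ENNReal.ofReal ((κ u a + ww X Y θ u a / (2 * (1 - a))) ^ 2 * Ph X Y u a * v u a)
      ≤ ENNReal.ofReal (ε / (1 - a))) {s : ℝ} (hs : 0 < s) (hsa : s ^ 2 = 1 - a) :
    SB (fun u => s⁻¹ * X u a) (fun u => s⁻¹ * Y u a) (fun u => θ u a) (fun u => s⁻¹ * v u a)
      (fun u => s * κ u a) m ε := by
  have hl : 0 < 1 - a := by linarith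
  have hsq : Real.sqrt (1 - a) = s := by rw [← hsa, Real.sqrt_sq hs.le]
  refine ⟨?_, ?_, ?_⟩
  · have := lintegral_scale_le (inv_pos.mpr hs).le (h.ent a ha (1 - a) hl)
    convert this using 1
    · refine lintegral_congr fun u => ?_
      congr 1
      rw [← hsa, mul_left_comm]
      congr 3
      field_simp
    · congr 1
      rw [Real.sqrt_mul (by positivity : 0 ≤ 4 * π) (1 - a), hsq]
      field_simp
  · have := lintegral_scale_le (inv_pos.mpr hs).le (h.ent a ha (2 * (1 - a)) (by positivity))
    convert this using 1
    · refine lintegral_congr fun u => ?_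
      congr 1
      rw [← hsa, mul_left_comm]
      congr 3
      field_simp
      ring
    · congr 1
      rw [show 4 * π * (2 * (1 - a)) = 8 * π * (1 - a) by ring,
        Real.sqrt_mul (by positivity : 0 ≤ 8 * π) (1 - a), hsq]
      field_simp
  · have := lintegral_scale_le hl.le hD
    convert this using 1
    · refine lintegral_congr fun u => ?_
      congr 1
      rw [Ph_eq X Y u ha, hsq, ← hsa]
      have : -((s⁻¹ * X u a) ^ 2 + (s⁻¹ * Y u a) ^ 2) / 4 = -(X u a ^ 2 + Y u a ^ 2) / (4 * s ^ 2) := by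
        field_simp
      rw [this, ww]
      field_simp
    · congr 1
      field_simp

lemma FL.main_aux (h : FL X Y θ v κ κs m) (hm : 0 < m) (u₁ t₁ u₂ t₂ : ℝ) (h1 : t₁ < 0) (h2 : t₂ < 0) :
    θ u₁ t₁ - θ u₂ t₂ ≤ (2 * (m:ℝ) - 1) * π := by
  obtain ⟨R₁, hR₁, Λ₁, hΛ₁, H₁⟩ := h.A3 u₁ t₁ h1
  obtain ⟨R₂, hR₂, Λ₂, hΛ₂, H₂⟩ := h.A3' u₂ t₂ h2
  set R := max R₁ R₂ with hRdef
  have hR0 : 0 < R := lt_max_of_lt_left hR₁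
  obtain ⟨ε, hε, HS⟩ := static_main m hm R hR0
  obtain ⟨a, haΛ, hD⟩ := h.A2 hε (max Λ₁ Λ₂) (lt_max_of_lt_left hΛ₁)
  have ha1 : a < -Λ₁ := by linarith [le_max_left Λ₁ Λ₂]
  have ha2 : a < -Λ₂ := by linarith [le_max_right Λ₁ Λ₂]
  have ha : a < 0 := by linarith
  have hl : 0 < 1 - a := by linarith
  have hs : 0 < Real.sqrt (1 - a) := Real.sqrt_pos.mpr hl
  have hsa : Real.sqrt (1 - a) ^ 2 = 1 - a := Real.sq_sqrt hl.le
  have hsc : ∀ u, X u a ^ 2 + Y u a ^ 2 < R ^ 2 * (1 - a) →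
      ((Real.sqrt (1 - a))⁻¹ * X u a) ^ 2 + ((Real.sqrt (1 - a))⁻¹ * Y u a) ^ 2 < R ^ 2 := by
    intro u hu
    have : ((Real.sqrt (1 - a))⁻¹ * X u a) ^ 2 + ((Real.sqrt (1 - a))⁻¹ * Y u a) ^ 2 =
        (X u a ^ 2 + Y u a ^ 2) / (1 - a) := by
      rw [mul_pow, mul_pow, inv_pow, hsa]; field_simp
    rw [this, div_lt_iff₀ hl]
    exact hu
  have key : ∀ p q, X p a ^ 2 + Y p a ^ 2 < R ^ 2 * (1 - a) → X q a ^ 2 + Y q a ^ 2 < R ^ 2 * (1 - a) →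
      |θ p a - θ q a| ≤ (2 * (m:ℝ) - 2) * π + 1 := fun p q hp hq =>
    HS _ _ _ _ _ (h.slice_SC ha hs) (h.slice_SB ha hD hs hsa) p q (hsc p hp) (hsc q hq)
  have step : ∀ q, X q a ^ 2 + Y q a ^ 2 < R ^ 2 * (1 - a) →
      θ u₁ t₁ ≤ θ q a + ((2 * (m:ℝ) - 2) * π + 1) + 1 := fun q hq =>
    H₁ R (le_max_left _ _) a ha1 _ (fun p hp => by linarith [(abs_le.mp (key p q hp hq)).2])
  have fin := H₂ R (le_max_right _ _) a ha2 (θ u₁ t₁ - ((2 * (m:ℝ) - 2) * π + 1) - 1)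
    (fun q hq => by linarith [step q hq])
  have := Real.pi_gt_three
  nlinarith
end Part10

section Part11

/-- Smoothness on the open half plane `t < 0`. -/
def Sm (F : ℝ → ℝ → ℝ) : Prop :=
  ContDiffOn ℝ (⊤ : ℕ∞) (fun p : ℝ × ℝ => F p.1 p.2) (univ ×ˢ Iio 0)
def Du (F : ℝ → ℝ → ℝ) (u t : ℝ) : ℝ := deriv (fun w => F w t) u
def Dt (F : ℝ → ℝ → ℝ) (u t : ℝ) : ℝ := deriv (fun s => F u s) t

lemma isOpen_half : IsOpen ((univ : Set ℝ) ×ˢ Iio (0:ℝ)) := isOpen_univ.prod isOpen_Iio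

variable {F G : ℝ → ℝ → ℝ}

lemma Sm.at (h : Sm F) (u : ℝ) {t : ℝ} (ht : t < 0) :
    ContDiffAt ℝ (⊤ : ℕ∞) (fun p : ℝ × ℝ => F p.1 p.2) (u, t) :=
  ContDiffOn.contDiffAt h (isOpen_half.mem_nhds ⟨mem_univ _, ht⟩)

lemma Sm.fd (h : Sm F) (u : ℝ) {t : ℝ} (ht : t < 0) :
    HasFDerivAt (fun p : ℝ × ℝ => F p.1 p.2) (fderiv ℝ (fun p : ℝ × ℝ => F p.1 p.2) (u, t)) (u, t) :=
  ((h.at u ht).differentiableAt (by simp)).hasFDerivAt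

lemma Sm.u_aux (h : Sm F) (u : ℝ) {t : ℝ} (ht : t < 0) :
    HasDerivAt (fun w => F w t) (fderiv ℝ (fun p : ℝ × ℝ => F p.1 p.2) (u, t) (1, 0)) u := by
  have h1 : HasDerivAt (fun w : ℝ => (w, t)) ((1:ℝ), (0:ℝ)) u :=
    (hasDerivAt_id u).prodMk (hasDerivAt_const u t)
  exact (h.fd u ht).comp_hasDerivAt u h1

lemma Sm.t_aux (h : Sm F) (u : ℝ) {t : ℝ} (ht : t < 0) :
    HasDerivAt (fun s => F u s) (fderiv ℝ (fun p : ℝ × ℝ => F p.1 p.2) (u, t) (0, 1)) t := by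
  have h1 : HasDerivAt (fun s : ℝ => (u, s)) ((0:ℝ), (1:ℝ)) t :=
    (hasDerivAt_const t u).prodMk (hasDerivAt_id t)
  exact (h.fd u ht).comp_hasDerivAt t h1

lemma Sm.hu (h : Sm F) (u : ℝ) {t : ℝ} (ht : t < 0) : HasDerivAt (fun w => F w t) (Du F u t) u :=
  (h.u_aux u ht).differentiableAt.hasDerivAt
lemma Sm.ht (h : Sm F) (u : ℝ) {t : ℝ} (ht : t < 0) : HasDerivAt (fun s => F u s) (Dt F u t) t :=
  (h.t_aux u ht).differentiableAt.hasDerivAt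

lemma Sm.cont (h : Sm F) : ContinuousOn (fun p : ℝ × ℝ => F p.1 p.2) (univ ×ˢ Iio 0) :=
  ContDiffOn.continuousOn h

lemma Sm.congr (h : Sm F) (e : ∀ u, ∀ t < 0, G u t = F u t) : Sm G :=
  ContDiffOn.congr h fun p hp => e p.1 p.2 hp.2

lemma Sm.fderiv_app (h : Sm F) (e : ℝ × ℝ) :
    Sm (fun u t => fderiv ℝ (fun p : ℝ × ℝ => F p.1 p.2) (u, t) e) := by
  have h1 : ContDiffOn ℝ (⊤ : ℕ∞) (fderiv ℝ (fun p : ℝ × ℝ => F p.1 p.2)) (univ ×ˢ Iio 0) :=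
    ContDiffOn.fderiv_of_isOpen h isOpen_half (by simp)
  exact h1.clm_apply contDiffOn_const

lemma Sm.sDu (h : Sm F) : Sm (Du F) :=
  (h.fderiv_app (1, 0)).congr fun u _ ht => (h.u_aux u ht).deriv
lemma Sm.sDt (h : Sm F) : Sm (Dt F) :=
  (h.fderiv_app (0, 1)).congr fun u _ ht => (h.t_aux u ht).deriv

lemma Sm.diff2 (h : Sm F) (u : ℝ) {t : ℝ} (ht : t < 0) :
    DifferentiableAt ℝ (fderiv ℝ (fun p : ℝ × ℝ => F p.1 p.2)) (u, t) :=
  ((h.at u ht).fderiv_right (m := 1) (by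
      rw [show ((1:WithTop ℕ∞) + 1) = ((2:ℕ∞) : WithTop ℕ∞) by rfl]
      exact_mod_cast le_top)).differentiableAt (by simp)

lemma Sm.app_fd (h : Sm F) (u : ℝ) {t : ℝ} (ht : t < 0) (e e' : ℝ × ℝ) :
    fderiv ℝ (fun p : ℝ × ℝ => fderiv ℝ (fun p : ℝ × ℝ => F p.1 p.2) (p.1, p.2) e) (u, t) e' =
    fderiv ℝ (fderiv ℝ (fun p : ℝ × ℝ => F p.1 p.2)) (u, t) e' e := by
  have h1 := (h.diff2 u ht).hasFDerivAt
  have h2 := h1.clm_apply (hasFDerivAt_const e (u, t))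
  have h3 := congrArg (fun L => L e') h2.fderiv
  simpa using h3

lemma Sm.comm (h : Sm F) (u : ℝ) {t : ℝ} (ht : t < 0) :
    Dt (Du F) u t = Du (Dt F) u t := by
  have hsym : IsSymmSndFDerivAt ℝ (fun p : ℝ × ℝ => F p.1 p.2) (u, t) :=
    (h.at u ht).isSymmSndFDerivAt (by
      rw [minSmoothness_of_isRCLikeNormedField]
      rw [show (2:WithTop ℕ∞) = ((2:ℕ∞) : WithTop ℕ∞) by rfl]
      exact_mod_cast le_top)
  have e1 : Dt (Du F) u t =
      fderiv ℝ (fun p : ℝ × ℝ => fderiv ℝ (fun p : ℝ × ℝ => F p.1 p.2) (p.1, p.2) (1, 0)) (u, t) (0, 1) := by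
    refine HasDerivAt.deriv (f := fun s => Du F u s) (((h.fderiv_app (1, 0)).t_aux u ht).congr_of_eventuallyEq ?_)
    filter_upwards [Iio_mem_nhds ht] with s hs
    exact (h.u_aux u hs).deriv
  have e2 : Du (Dt F) u t =
      fderiv ℝ (fun p : ℝ × ℝ => fderiv ℝ (fun p : ℝ × ℝ => F p.1 p.2) (p.1, p.2) (0, 1)) (u, t) (1, 0) := by
    refine HasDerivAt.deriv (f := fun s => Dt F s t) (((h.fderiv_app (0, 1)).u_aux u ht).congr_of_eventuallyEq ?_)
    filter_upwards with w
    exact (h.t_aux w ht).deriv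
  rw [e1, e2, h.app_fd u ht, h.app_fd u ht]
  exact hsym _ _
end Part11


lemma toR2_zero (x y : ℝ) : (toR2 x y) 0 = x := by simp [toR2]
lemma toR2_one (x y : ℝ) : (toR2 x y) 1 = y := by simp [toR2]
lemma toR2_eta (p : R2) : toR2 (p 0) (p 1) = p := by
  ext i; fin_cases i <;> simp [toR2]

lemma hasDerivAt_coord {f : ℝ → R2} {f' : R2} {x : ℝ} (h : HasDerivAt f f' x) (i : Fin 2) :
    HasDerivAt (fun s => f s i) (f' i) x :=
  (EuclideanSpace.proj (𝕜 := ℝ) i).hasFDerivAt.comp_hasDerivAt x h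

lemma hasDerivAt_toR2 {f g : ℝ → ℝ} {f' g' : ℝ} {x : ℝ} (hf : HasDerivAt f f' x)
    (hg : HasDerivAt g g' x) : HasDerivAt (fun s => toR2 (f s) (g s)) (toR2 f' g') x := by
  have h1 : HasDerivAt (fun s => f s • toR2 1 0 + g s • toR2 0 1) (f' • toR2 1 0 + g' • toR2 0 1) x :=
    (hf.smul_const _).add (hg.smul_const _)
  have e : ∀ a b : ℝ, a • toR2 1 0 + b • toR2 0 1 = toR2 a b := by
    intro a b
    ext i; fin_cases i <;> simp [toR2]
  simpa only [e] using h1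

lemma norm_sq_R2 (p : R2) : ‖p‖ ^ 2 = p 0 ^ 2 + p 1 ^ 2 := by
  rw [EuclideanSpace.real_norm_sq_eq, Fin.sum_univ_two]

/-- Speed. -/
def spd (γ : ℝ → ℝ → R2) (u t : ℝ) : ℝ := ‖deriv (fun v => γ v t) u‖

lemma FL_of_flow (γ : ℝ → ℝ → R2) (θ : ℝ → ℝ → ℝ) (m : ℕ)
    (hcsf : IsCSF γ (Iic 0))
    (hemb : ∀ t ∈ Iic (0:ℝ), Function.Injective fun u => γ u t)
    (hproper : ∀ t ∈ Iic (0:ℝ), IsProperMap fun u => γ u t)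
    (hEnt : entropyE γ (Iic 0) = (m : ℝ≥0∞))
    (hθ : ContDiffOn ℝ (⊤ : ℕ∞) (fun p : ℝ × ℝ => θ p.1 p.2) (univ ×ˢ Iic 0))
    (hangle : ∀ (u : ℝ), ∀ t ∈ Iic (0:ℝ),
      unitT γ u t = toR2 (Real.cos (θ u t)) (Real.sin (θ u t))) :
    ∃ X Y v κ κs : ℝ → ℝ → ℝ, FL X Y θ v κ κs m := by
  have hsub : (univ : Set ℝ) ×ˢ Iio (0:ℝ) ⊆ univ ×ˢ Iic 0 := prod_mono_right Iio_subset_Iic_self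
  have sγ := hcsf.smooth.mono hsub
  have sθ : Sm θ := hθ.mono hsub
  set X : ℝ → ℝ → ℝ := fun u t => γ u t 0 with hX
  set Y : ℝ → ℝ → ℝ := fun u t => γ u t 1 with hY
  have sX : Sm X := (EuclideanSpace.proj (𝕜 := ℝ) (0 : Fin 2)).contDiff.comp_contDiffOn sγ
  have sY : Sm Y := (EuclideanSpace.proj (𝕜 := ℝ) (1 : Fin 2)).contDiff.comp_contDiffOn sγ
  have dγ : ∀ u, ∀ t < 0, DifferentiableAt ℝ (fun p : ℝ × ℝ => γ p.1 p.2) (u, t) := fun u t ht =>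
    (sγ.contDiffAt (isOpen_half.mem_nhds (x := (u, t)) ⟨mem_univ _, ht⟩)).differentiableAt (by simp)
  have duγ : ∀ u, ∀ t < 0, HasDerivAt (fun w => γ w t) (deriv (fun w => γ w t) u) u := by
    intro u t ht
    have h1 : HasDerivAt (fun w : ℝ => (w, t)) ((1:ℝ), (0:ℝ)) u :=
      (hasDerivAt_id u).prodMk (hasDerivAt_const u t)
    have h2 := (dγ u t ht).hasFDerivAt.comp_hasDerivAt u h1
    exact h2.differentiableAt.hasDerivAt
  have dtγ : ∀ u, ∀ t < 0, HasDerivAt (fun s => γ u s) (deriv (fun s => γ u s) t) t := by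
    intro u t ht
    have h1 : HasDerivAt (fun s : ℝ => (u, s)) ((0:ℝ), (1:ℝ)) t :=
      (hasDerivAt_const t u).prodMk (hasDerivAt_id t)
    have h2 := (dγ u t ht).hasFDerivAt.comp_hasDerivAt t h1
    exact h2.differentiableAt.hasDerivAt
  have vpos : ∀ u, ∀ t < 0, 0 < spd γ u t := fun u t ht => norm_pos_iff.mpr (hcsf.regular u t (le_of_lt ht))
  have hdu : ∀ u, ∀ t < 0, deriv (fun w => γ w t) u =
      toR2 (spd γ u t * Real.cos (θ u t)) (spd γ u t * Real.sin (θ u t)) := by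
    intro u t ht
    have h1 := hangle u t (le_of_lt ht)
    unfold unitT aderiv at h1
    have h2 : deriv (fun w => γ w t) u = spd γ u t • toR2 (Real.cos (θ u t)) (Real.sin (θ u t)) := by
      have h0 : ‖deriv (fun v => γ v t) u‖ ≠ 0 := (vpos u t ht).ne'
      rw [← h1, spd, smul_inv_smul₀ h0]
    rw [h2]
    ext i; fin_cases i <;> simp [toR2]
  have Xu : ∀ u, ∀ t < 0, HasDerivAt (fun u => X u t) (spd γ u t * Real.cos (θ u t)) u := by
    intro u t ht
    have := hasDerivAt_coord (duγ u t ht) 0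
    rwa [hdu u t ht, toR2_zero] at this
  have Yu : ∀ u, ∀ t < 0, HasDerivAt (fun u => Y u t) (spd γ u t * Real.sin (θ u t)) u := by
    intro u t ht
    have := hasDerivAt_coord (duγ u t ht) 1
    rwa [hdu u t ht, toR2_one] at this
  have DuX : ∀ u, ∀ t < 0, Du X u t = spd γ u t * Real.cos (θ u t) := fun u t ht => (Xu u t ht).deriv
  have DuY : ∀ u, ∀ t < 0, Du Y u t = spd γ u t * Real.sin (θ u t) := fun u t ht => (Yu u t ht).deriv
  have ev : ∀ u, ∀ t < 0, spd γ u t = Du X u t * Real.cos (θ u t) + Du Y u t * Real.sin (θ u t) := by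
    intro u t ht
    rw [DuX u t ht, DuY u t ht]
    linear_combination (-spd γ u t) * Real.sin_sq_add_cos_sq (θ u t)
  have scos : Sm (fun u t => Real.cos (θ u t)) := Real.contDiff_cos.comp_contDiffOn sθ
  have ssin : Sm (fun u t => Real.sin (θ u t)) := Real.contDiff_sin.comp_contDiffOn sθ
  have sv : Sm (spd γ) := by
    refine Sm.congr (F := fun u t => Du X u t * Real.cos (θ u t) + Du Y u t * Real.sin (θ u t)) ?_ ev
    exact (ContDiffOn.mul sX.sDu scos).add (ContDiffOn.mul sY.sDu ssin)
  set κ : ℝ → ℝ → ℝ := fun u t => Du θ u t / spd γ u t with hκ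
  have sκ : Sm κ := ContDiffOn.div sθ.sDu sv fun p hp => (vpos p.1 p.2 hp.2).ne'
  set κs : ℝ → ℝ → ℝ := fun u t => Du κ u t / spd γ u t with hκs
  have sκs : Sm κs := ContDiffOn.div sκ.sDu sv fun p hp => (vpos p.1 p.2 hp.2).ne'
  have θu : ∀ u, ∀ t < 0, HasDerivAt (fun u => θ u t) (spd γ u t * κ u t) u := by
    intro u t ht
    refine (sθ.hu u ht).congr_deriv ?_
    have := (vpos u t ht).ne'
    simp only [hκ]; field_simp
  have κu : ∀ u, ∀ t < 0, HasDerivAt (fun u => κ u t) (spd γ u t * κs u t) u := by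
    intro u t ht
    refine (sκ.hu u ht).congr_deriv ?_
    have := (vpos u t ht).ne'
    simp only [hκs]; field_simp
  have hflow : ∀ u, ∀ t < 0, deriv (fun s => γ u s) t =
      toR2 (-κ u t * Real.sin (θ u t)) (κ u t * Real.cos (θ u t)) := by
    intro u t ht
    have h1 := hcsf.flow u t (le_of_lt ht)
    rw [derivWithin_of_mem_nhds (Iic_mem_nhds ht)] at h1
    rw [h1]
    have h2 : (fun w => aderiv γ γ w t) = fun w => toR2 (Real.cos (θ w t)) (Real.sin (θ w t)) :=
      funext fun w => hangle w t (le_of_lt ht)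
    have h3 := (hasDerivAt_toR2 (θu u t ht).cos (θu u t ht).sin).deriv
    rw [aderiv, h2, h3]
    have h4 : ‖deriv (fun v => γ v t) u‖ = spd γ u t := rfl
    have := (vpos u t ht).ne'
    rw [h4]
    ext i; fin_cases i
    · simp [toR2]; field_simp
    · simp [toR2]; field_simp
  have Xt : ∀ u, ∀ t < 0, HasDerivAt (fun t => X u t) (-κ u t * Real.sin (θ u t)) t := by
    intro u t ht
    have := hasDerivAt_coord (dtγ u t ht) 0
    rwa [hflow u t ht, toR2_zero] at this
  have Yt : ∀ u, ∀ t < 0, HasDerivAt (fun t => Y u t) (κ u t * Real.cos (θ u t)) t := by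
    intro u t ht
    have := hasDerivAt_coord (dtγ u t ht) 1
    rwa [hflow u t ht, toR2_one] at this
  have Xut : ∀ u, ∀ t < 0, HasDerivAt (fun t => Du X u t) (-(spd γ u t * κs u t) * Real.sin (θ u t)
      + -κ u t * (Real.cos (θ u t) * (spd γ u t * κ u t))) t := by
    intro u t ht
    refine (sX.sDu.ht u ht).congr_deriv ?_
    rw [sX.comm u ht]
    have : (fun w => Dt X w t) = fun w => -κ w t * Real.sin (θ w t) := funext fun w => (Xt w t ht).deriv
    rw [Du, this]
    exact ((κu u t ht).fun_neg.mul (θu u t ht).sin).deriv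
  have Yut : ∀ u, ∀ t < 0, HasDerivAt (fun t => Du Y u t) ((spd γ u t * κs u t) * Real.cos (θ u t)
      + κ u t * (-Real.sin (θ u t) * (spd γ u t * κ u t))) t := by
    intro u t ht
    refine (sY.sDu.ht u ht).congr_deriv ?_
    rw [sY.comm u ht]
    have : (fun w => Dt Y w t) = fun w => κ w t * Real.cos (θ w t) := funext fun w => (Yt w t ht).deriv
    rw [Du, this]
    exact ((κu u t ht).mul (θu u t ht).cos).deriv
  have hθt : ∀ u, ∀ t < 0, HasDerivAt (fun t => θ u t) (κs u t) t := by
    intro u t ht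
    have hd := sθ.ht u ht
    have h1 := ((Xut u t ht).mul hd.sin).sub ((Yut u t ht).mul hd.cos)
    have h0 : HasDerivAt (fun _ : ℝ => (0:ℝ)) 0 t := hasDerivAt_const t 0
    have h2 := h1.unique (h0.congr_of_eventuallyEq (by
      filter_upwards [Iio_mem_nhds ht] with s hs
      simp only [Pi.sub_apply, Pi.mul_apply, DuX u s hs, DuY u s hs]; ring))
    rw [DuX u t ht, DuY u t ht] at h2
    have hs := Real.sin_sq_add_cos_sq (θ u t)
    have h3 : spd γ u t * (Dt θ u t - κs u t) = 0 := by
      linear_combination h2 - spd γ u t * (Dt θ u t - κs u t) * hs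
    have h4 := (mul_eq_zero.mp h3).resolve_left (vpos u t ht).ne'
    exact hd.congr_deriv (by linarith)
  have hvt : ∀ u, ∀ t < 0, HasDerivAt (fun t => spd γ u t) (-κ u t ^ 2 * spd γ u t) t := by
    intro u t ht
    have hd := sθ.ht u ht
    have h1 := ((Xut u t ht).mul hd.cos).add ((Yut u t ht).mul hd.sin)
    have h2 := h1.congr_of_eventuallyEq (f₁ := fun t => spd γ u t) (by
      filter_upwards [Iio_mem_nhds ht] with s hs
      exact ev u s hs)
    refine h2.congr_deriv ?_
    rw [DuX u t ht, DuY u t ht]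
    have hs := Real.sin_sq_add_cos_sq (θ u t)
    linear_combination (-κ u t ^ 2 * spd γ u t) * hs
  refine ⟨X, Y, spd γ, κ, κs, Xu, Yu, θu, κu, Xt, Yt, hvt, hθt, vpos, sX.cont, sY.cont, sθ.cont, sv.cont,
    sκ.cont, sκs.cont, ?_, ?_, ?_⟩
  · intro t ht
    have h1 := (isProperMap_iff_tendsto_cocompact.mp (hproper t (le_of_lt ht))).2
    have h2 := (tendsto_pow_atTop (two_ne_zero)).comp ((tendsto_norm_cocompact_atTop (E := R2)).comp h1)
    refine h2.congr fun u => ?_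
    simp only [Function.comp]
    exact norm_sq_R2 _
  · intro t ht u u' h1 h2
    apply hemb t (le_of_lt ht)
    show γ u t = γ u' t
    rw [← toR2_eta (γ u t), ← toR2_eta (γ u' t)]
    simp only [hX, hY] at h1 h2
    rw [h1, h2]
  · intro t ht l hl
    have h1 : gaussLenE γ 0 l t ≤ m := by
      rw [← hEnt, entropyE]
      exact le_iSup₂_of_le t (le_of_lt ht) (le_iSup_of_le 0 (le_iSup₂_of_le l hl le_rfl))
    have hp : 0 < Real.sqrt (4 * π * l) := by
      have := Real.pi_pos
      exact Real.sqrt_pos.mpr (by positivity)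
    unfold gaussLenE at h1
    rw [mul_comm, ← div_eq_mul_inv, ENNReal.div_le_iff (by simpa using hp) ENNReal.ofReal_ne_top] at h1
    rw [ENNReal.ofReal_mul hp.le, ENNReal.ofReal_natCast,
      mul_comm (ENNReal.ofReal (Real.sqrt (4 * π * l))) (m : ℝ≥0∞)]
    refine le_trans (le_of_eq ?_) h1
    refine lintegral_congr fun u => ?_
    rw [sub_zero, norm_sq_R2]
    rfl

/-- For an ancient complete non-compact embedded smooth curve shortening
flow with entropy a positive integer `m` and smooth angle function `θ` normalized so that
`θ(0,t₀) ∈ [0,2π)` for some `t₀ ≤ 0`, one has `|θ| ≤ (2m+1)π` everywhere. -/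
theorem abs_angle_le_of_entropy_eq
    (γ : ℝ → ℝ → R2) (θ : ℝ → ℝ → ℝ) (m : ℕ) (hm : 0 < m)
    (hcsf : IsCSF γ (Iic 0))
    (hemb : ∀ t ∈ Iic (0:ℝ), Function.Injective fun u => γ u t)
    (hproper : ∀ t ∈ Iic (0:ℝ), IsProperMap fun u => γ u t)
    (hEnt : entropyE γ (Iic 0) = (m : ℝ≥0∞))
    (hθ : ContDiffOn ℝ (⊤ : ℕ∞) (fun p : ℝ × ℝ => θ p.1 p.2) (univ ×ˢ Iic 0))
    (hangle : ∀ (u : ℝ), ∀ t ∈ Iic (0:ℝ),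
      unitT γ u t = toR2 (Real.cos (θ u t)) (Real.sin (θ u t)))
    (t₀ : ℝ) (ht₀ : t₀ ≤ 0) (hθ0 : θ 0 t₀ ∈ Ico (0:ℝ) (2 * π)) :
    ∀ (u : ℝ), ∀ t ∈ Iic (0:ℝ), |θ u t| ≤ (2 * (m:ℝ) + 1) * π := by
  obtain ⟨X, Y, v, κ, κs, h⟩ := FL_of_flow γ θ m hcsf hemb hproper hEnt hθ hangle
  have lim : ∀ u, ∀ t ≤ 0, Tendsto (fun s : ℝ => θ u (t - s)) (𝓝[>] 0) (𝓝 (θ u t)) := by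
    intro u t ht
    have h1 : ContinuousOn (fun s : ℝ => θ u (t - s)) (Ici 0) :=
      hθ.continuousOn.comp (f := fun s : ℝ => (u, t - s)) (by fun_prop)
        (fun s hs => ⟨mem_univ _, by simp only [mem_Ici, mem_Iic] at *; linarith⟩)
    have h2 := (h1 0 (mem_Ici.mpr le_rfl)).mono_left (nhdsWithin_mono _ Ioi_subset_Ici_self)
    simpa using h2
  have key : ∀ u₁ t₁ u₂ t₂, t₁ ≤ 0 → t₂ ≤ 0 → θ u₁ t₁ - θ u₂ t₂ ≤ (2 * (m:ℝ) - 1) * π := by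
    intro u₁ t₁ u₂ t₂ h1 h2
    refine le_of_tendsto ((lim u₁ t₁ h1).sub (lim u₂ t₂ h2)) ?_
    filter_upwards [self_mem_nhdsWithin] with s hs
    have hs' : (0:ℝ) < s := hs
    exact h.main_aux hm u₁ (t₁ - s) u₂ (t₂ - s) (by linarith) (by linarith)
  intro u t ht
  have k1 := key u t 0 t₀ ht ht₀
  have k2 := key 0 t₀ u t ht₀ ht
  obtain ⟨b1, b2⟩ := hθ0
  have := Real.pi_pos
  rw [abs_le]
  constructor <;> linarith
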